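/- arXiv:math/0210094 — 14 statements merged into one kernel-verified Lean document; each statement's English description precedes it below -/
import Mathlib

section
/- Let K be a field of characteristic p, where p ∈ {2, 3, 5}, let R = K[X,Y,Z]/(X² + Y³ + Z⁵), and let x, y, z denote the images of X, Y, Z in R. Then x^p lies in the ideal (y^p, z^p) of R, but x does not lie in the ideal (y, z) of R. In particular, x lies in the Frobenius closure of (y, z) but not in (y, z), so the ideal (y, z) of R is not Frobenius closed. -/
open MvPolynomial

/-- Let `K` be a field of characteristic `p ∈ {2, 3, 5}`, let
`R = K[X,Y,Z]/(X² + Y³ + Z⁵)`, and let `x, y, z` be the images of the variables.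
Then `x^p ∈ (y^p, z^p)` but `x ∉ (y, z)`, so `(y, z)` is not Frobenius closed. -/
theorem stmt_0 (K : Type*) [Field K] (p : ℕ) [CharP K p]
    (hp : p = 2 ∨ p = 3 ∨ p = 5)
    (I : Ideal (MvPolynomial (Fin 3) K))
    (hI : I = Ideal.span {X 0 ^ 2 + X 1 ^ 3 + X 2 ^ 5})
    (x y z : MvPolynomial (Fin 3) K ⧸ I)
    (hx : x = Ideal.Quotient.mk I (X 0))
    (hy : y = Ideal.Quotient.mk I (X 1))
    (hz : z = Ideal.Quotient.mk I (X 2)) :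
    x ^ p ∈ Ideal.span ({y ^ p, z ^ p} : Set (MvPolynomial (Fin 3) K ⧸ I)) ∧
      x ∉ Ideal.span ({y, z} : Set (MvPolynomial (Fin 3) K ⧸ I)) := by
  have h : x ^ 2 + y ^ 3 + z ^ 5 = 0 := by
    rw [hx, hy, hz, ← map_pow, ← map_pow, ← map_pow, ← map_add, ← map_add,
      Ideal.Quotient.eq_zero_iff_mem, hI]
    exact Ideal.mem_span_singleton_self _
  refine ⟨?_, fun hmem => ?_⟩
  · rw [Ideal.mem_span_pair]
    obtain rfl | rfl | rfl := hp
    · exact ⟨-y, -z ^ 3, by linear_combination -h⟩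
    · exact ⟨-x, -x * z ^ 2, by linear_combination -x * h⟩
    · exact ⟨x * y, x * (2 * y ^ 3 + z ^ 5),
        by linear_combination -x * (x ^ 2 - y ^ 3 - z ^ 5) * h⟩
  · -- The dual number point `(ε, 0, 0)` of the surface kills `(y, z)` but not `x`.
    let f : MvPolynomial (Fin 3) K →ₐ[K] DualNumber K := aeval ![DualNumber.eps, 0, 0]
    have hf : ∀ a ∈ I, f.toRingHom a = 0 := by
      rw [hI]
      refine fun a ha => (Ideal.span_le (I := RingHom.ker f.toRingHom)).2 ?_ ha
      simp [f, RingHom.mem_ker, pow_two]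
    let g := Ideal.Quotient.lift I f.toRingHom hf
    have hgx : g x = DualNumber.eps := by simp [g, f, hx]
    have hgy : g y = 0 := by simp [g, f, hy]
    have hgz : g z = 0 := by simp [g, f, hz]
    obtain ⟨a, b, hab⟩ := Ideal.mem_span_pair.1 hmem
    have heps : (DualNumber.eps : DualNumber K) = 0 := by
      rw [← hgx, ← hab]
      simp [hgy, hgz]
    simpa using congrArg TrivSqZeroExt.snd heps
end

section
/- Let K be a field of characteristic 2, let R = K[X,Y,Z]/(X² + Y³ + Z⁵), and let x, y, z denote the images of X, Y, Z in R. Then x² lies in the ideal (y², z⁴) of R, but x does not lie in the ideal (y, z²) of R. -/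
open MvPolynomial

/-- Let `K` be a field of characteristic 2, let `R = K[X,Y,Z]/(X² + Y³ + Z⁵)`,
and let `x, y, z` be the images of the variables. Then `x² ∈ (y², z⁴)` but
`x ∉ (y, z²)`. -/
theorem stmt_1 (K : Type*) [Field K] [CharP K 2]
    (I : Ideal (MvPolynomial (Fin 3) K))
    (hI : I = Ideal.span {X 0 ^ 2 + X 1 ^ 3 + X 2 ^ 5})
    (x y z : MvPolynomial (Fin 3) K ⧸ I)
    (hx : x = Ideal.Quotient.mk I (X 0))
    (hy : y = Ideal.Quotient.mk I (X 1))
    (hz : z = Ideal.Quotient.mk I (X 2)) :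
    x ^ 2 ∈ Ideal.span ({y ^ 2, z ^ 4} : Set (MvPolynomial (Fin 3) K ⧸ I)) ∧
      x ∉ Ideal.span ({y, z ^ 2} : Set (MvPolynomial (Fin 3) K ⧸ I)) := by
  subst hI hx hy hz
  constructor
  · rw [Ideal.mem_span_pair]
    refine ⟨-Ideal.Quotient.mk _ (X 1), -Ideal.Quotient.mk _ (X 2), ?_⟩
    simp only [← map_pow, ← map_neg, ← map_mul, ← map_add]
    rw [eq_comm, Ideal.Quotient.eq]
    exact Ideal.mem_span_singleton.mpr ⟨1, by ring⟩
  · intro h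
    -- Evaluate at `x = ε`, `y = z = 0` in the dual numbers.
    let f : MvPolynomial (Fin 3) K →+* DualNumber K :=
      (aeval ![DualNumber.eps, 0, 0] : MvPolynomial (Fin 3) K →ₐ[K] DualNumber K)
    have hf : ∀ a ∈ Ideal.span {(X 0 ^ 2 + X 1 ^ 3 + X 2 ^ 5 : MvPolynomial (Fin 3) K)},
        f a = 0 := by
      intro a ha
      obtain ⟨b, rfl⟩ := Ideal.mem_span_singleton.mp ha
      simp [f, pow_two]
    obtain ⟨a, b, hab⟩ := Ideal.mem_span_pair.mp h
    have key := congrArg (Ideal.Quotient.lift _ f hf) hab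
    have h_eps : (DualNumber.eps : DualNumber K) = 0 := by
      simpa [f, eq_comm] using key
    simpa using congrArg TrivSqZeroExt.snd h_eps
end

section
/- Let K be a field of characteristic 2, let d ≥ 3 be an integer, let R = K[X₀, X₁, …, X_d]/(X₀³ + X₁³ + ⋯ + X_d³), and let x₀, …, x_d denote the images of the variables in R. Then x₀⁴ lies in the ideal (x₁², …, x_d²) of R, but x₀² does not lie in the ideal (x₁, …, x_d) of R. In particular, x₀² lies in the Frobenius closure of (x₁, …, x_d) but not in (x₁, …, x_d), so R is not F-pure. -/
open MvPolynomial

/-- Let `K` be a field of characteristic 2, `d ≥ 3`, and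
`R = K[X₀,…,X_d]/(X₀³ + ⋯ + X_d³)`, with `x i` the images of the variables.
Then `x₀⁴ ∈ (x₁², …, x_d²)` but `x₀² ∉ (x₁, …, x_d)`; in particular `x₀²` lies
in the Frobenius closure of `(x₁, …, x_d)` but not in the ideal itself. -/
theorem stmt_2 (K : Type*) [Field K] [CharP K 2] (d : ℕ) (hd : 3 ≤ d)
    (I : Ideal (MvPolynomial (Fin (d + 1)) K))
    (hI : I = Ideal.span {∑ i : Fin (d + 1), X i ^ 3})
    (x : Fin (d + 1) → MvPolynomial (Fin (d + 1)) K ⧸ I)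
    (hx : ∀ i, x i = Ideal.Quotient.mk I (X i)) :
    x 0 ^ 4 ∈ Ideal.span (Set.range fun i : Fin d => x i.succ ^ 2) ∧
      x 0 ^ 2 ∉ Ideal.span (Set.range fun i : Fin d => x i.succ) := by
  subst hI
  refine ⟨?_, fun hmem => ?_⟩
  · have hsum : x 0 ^ 3 + ∑ i : Fin d, x i.succ ^ 3 = 0 := by
      rw [← Fin.sum_univ_succ (fun i => x i ^ 3)]
      simp only [hx, ← map_pow, ← map_sum]
      exact Ideal.Quotient.eq_zero_iff_mem.mpr (Ideal.mem_span_singleton_self _)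
    have hpow : x 0 ^ 4 = ∑ i : Fin d, (-(x 0 * x i.succ)) * x i.succ ^ 2 := by
      calc x 0 ^ 4 = x 0 * x 0 ^ 3 := by ring
        _ = x 0 * -∑ i : Fin d, x i.succ ^ 3 := by rw [eq_neg_of_add_eq_zero_left hsum]
        _ = _ := by
          rw [← Finset.sum_neg_distrib, Finset.mul_sum]
          exact Finset.sum_congr rfl fun i _ => by ring
    rw [hpow]
    exact Ideal.sum_mem _ fun i _ => Ideal.mul_mem_left _ _ (Ideal.subset_span ⟨i, rfl⟩)
  · let J : Ideal (Polynomial K) := Ideal.span {Polynomial.X ^ 3}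
    let φ : MvPolynomial (Fin (d + 1)) K →ₐ[K] Polynomial K ⧸ J :=
      aeval (Fin.cons (Ideal.Quotient.mk J Polynomial.X) fun _ => 0)
    have hφ : ∀ a ∈ Ideal.span {∑ i : Fin (d + 1), (X i : MvPolynomial (Fin (d + 1)) K) ^ 3},
        φ.toRingHom a = 0 := by
      intro a ha
      refine (Ideal.span_singleton_le_iff_mem (RingHom.ker φ.toRingHom)).mpr ?_ ha
      have hX : Ideal.Quotient.mk J Polynomial.X ^ 3 = 0 := by
        rw [← map_pow]
        exact Ideal.Quotient.eq_zero_iff_mem.mpr (Ideal.mem_span_singleton_self _)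
      simp [RingHom.mem_ker, φ, Fin.sum_univ_succ, hX]
    have hle : Ideal.span (Set.range fun i : Fin d => x i.succ) ≤
        RingHom.ker (Ideal.Quotient.lift _ φ.toRingHom hφ) := by
      rw [Ideal.span_le]
      rintro _ ⟨i, rfl⟩
      simp [RingHom.mem_ker, hx, φ]
    have hzero : Ideal.Quotient.mk J (Polynomial.X ^ 2) = 0 := by
      simpa [RingHom.mem_ker, hx, φ] using hle hmem
    have hdvd : (Polynomial.X : Polynomial K) ^ 3 ∣ Polynomial.X ^ 2 :=
      Ideal.mem_span_singleton.mp (Ideal.Quotient.eq_zero_iff_mem.mp hzero)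
    have := (pow_dvd_pow_iff Polynomial.X_ne_zero Polynomial.not_isUnit_X).mp hdvd
    omega
end

section
/- Let K be a field of characteristic 2, let d ≥ 3 and n ≥ 1 be integers, let R = K[X₀, X₁, …, X_d]/(X₀³ + X₁³ + ⋯ + X_d³), and let x₀, …, x_d denote the images of the variables. For i = 1, …, d set g_i = x₀^{d−2} x_i^n x_{i+1}^{n−1} x_{i+2}^{n−1} ⋯ x_{i+d−2}^{n−1}, where the subscripts i+1, …, i+d−2 are taken cyclically in {1, …, d} (so g₁ = x₀^{d−2} x₁^n x₂^{n−1} ⋯ x_{d−1}^{n−1} and g_d = x₀^{d−2} x_d^n x₁^{n−1} ⋯ x_{d−2}^{n−1}). Let u = x₀^d (x₁ x₂ ⋯ x_d)^{n−1}. Then u² lies in the ideal (g₁², …, g_d²) of R, but u does not lie in the ideal (g₁, …, g_d) of R. In particular, u lies in the Frobenius closure of (g₁, …, g_d) but not in the ideal itself. -/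
open MvPolynomial

/-- A product of powers of variables with all exponents less than `n` is not in the ideal generated
by the `n`-th powers of the variables. -/
theorem prod_X_pow_notMem_span_X_pow {σ K : Type*} [Fintype σ] [Field K] {m n : ℕ} (h : m < n) :
    (∏ j : σ, X j) ^ m ∉ Ideal.span (Set.range fun j : σ => (X j : MvPolynomial σ K) ^ n) := by
  classical
  have h1 : (Set.range fun j : σ => (X j : MvPolynomial σ K) ^ n) =
      (fun s => monomial s (1 : K)) '' Set.range fun j : σ => Finsupp.single j n := by
    rw [← Set.range_comp]
    simp [Function.comp_def, X_pow_eq_monomial]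
  have h2 : (∏ j : σ, (X j : MvPolynomial σ K)) ^ m =
      monomial (∑ j : σ, Finsupp.single j m) 1 := by
    rw [← Finset.prod_pow, monomial_sum_one]
    simp [X_pow_eq_monomial]
  rw [h1, h2, mem_ideal_span_monomial_image]
  intro H
  obtain ⟨_, ⟨j, rfl⟩, hj⟩ := H _ <| by
    rw [mem_support_iff, coeff_monomial, if_pos rfl]
    exact one_ne_zero
  have := hj j
  simp [Finsupp.finsetSum_apply, Finsupp.single_apply] at this
  omega

/-- The variable `X none` does not divide the Fermat cubic. -/
theorem not_X_none_dvd_cubic {σ K : Type*} [Fintype σ] [Nonempty σ] [Field K] :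
    ¬ (X none : MvPolynomial (Option σ) K) ∣ X none ^ 3 + ∑ j : σ, X (some j) ^ 3 := by
  classical
  rintro ⟨c, hc⟩
  obtain ⟨i⟩ := ‹Nonempty σ›
  have := congrArg (eval fun k : Option σ => if k = some i then (1 : K) else 0) hc
  simp [ite_pow] at this

/-- Modulo the `n`-th powers of the variables other than `X none`, the polynomial
`X none ^ 2 * (∏ j, X (some j)) ^ m` with `m < n` is not a multiple of the Fermat cubic. -/
theorem sq_mul_prod_pow_ne_add_cubic_mul {σ K : Type*} [Fintype σ] [Field K] {m n : ℕ} (h : m < n)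
    {a : MvPolynomial (Option σ) K}
    (ha : a ∈ Ideal.span (Set.range fun j : σ => (X (some j) : MvPolynomial (Option σ) K) ^ n))
    (b : MvPolynomial (Option σ) K) :
    X none ^ 2 * (∏ j : σ, X (some j)) ^ m ≠ a + (X none ^ 3 + ∑ j : σ, X (some j) ^ 3) * b := by
  intro H
  let M : Ideal (MvPolynomial σ K) := Ideal.span (Set.range fun j : σ => X j ^ n)
  let φ : MvPolynomial (Option σ) K →ₐ[K] Polynomial (MvPolynomial σ K ⧸ M) :=
    aeval fun k : Option σ => k.elim Polynomial.X fun j => Polynomial.C (Ideal.Quotient.mk M (X j))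
  have hφ0 : φ (X none) = Polynomial.X := by simp [φ]
  have hφ (j : σ) : φ (X (some j)) = Polynomial.C (Ideal.Quotient.mk M (X j)) := by simp [φ]
  have hφa : φ a = 0 := by
    have hle : Ideal.span (Set.range fun j : σ => (X (some j) : MvPolynomial (Option σ) K) ^ n) ≤
        RingHom.ker φ := by
      rw [Ideal.span_le]
      rintro _ ⟨j, rfl⟩
      have hj : Ideal.Quotient.mk M (X j ^ n) = 0 :=
        Ideal.Quotient.eq_zero_iff_mem.mpr (Ideal.subset_span ⟨j, rfl⟩)
      rw [SetLike.mem_coe, RingHom.mem_ker, map_pow, hφ, ← map_pow, ← map_pow, hj, map_zero]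
    exact hle ha
  have hP : Ideal.Quotient.mk M ((∏ j : σ, X j) ^ m) ≠ 0 := fun h0 =>
    prod_X_pow_notMem_span_X_pow h (Ideal.Quotient.eq_zero_iff_mem.mp h0)
  have : Nontrivial (MvPolynomial σ K ⧸ M) := ⟨_, _, hP⟩
  set s : MvPolynomial σ K ⧸ M := ∑ j, Ideal.Quotient.mk M (X j) ^ 3 with hs
  have hlhs : φ (X none ^ 2 * (∏ j : σ, X (some j)) ^ m) =
      Polynomial.C (Ideal.Quotient.mk M ((∏ j : σ, X j) ^ m)) * Polynomial.X ^ 2 := by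
    simp only [map_mul, map_pow, map_prod, hφ0, hφ]
    ring
  have hcub : φ (X none ^ 3 + ∑ j : σ, X (some j) ^ 3) = Polynomial.X ^ 3 + Polynomial.C s := by
    simp only [map_add, map_pow, map_sum, hφ0, hφ, hs]
  have hdvd : Polynomial.X ^ 3 + Polynomial.C s ∣
      Polynomial.C (Ideal.Quotient.mk M ((∏ j : σ, X j) ^ m)) * Polynomial.X ^ 2 := by
    refine ⟨φ b, ?_⟩
    rw [← hlhs, H, map_add, map_mul, hφa, hcub, zero_add]
  refine (Polynomial.monic_X_pow_add_C s three_ne_zero).not_dvd_of_natDegree_lt ?_ ?_ hdvd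
  · rwa [Polynomial.C_mul_X_pow_eq_monomial, Ne, Polynomial.monomial_eq_zero_iff]
  · rw [Polynomial.natDegree_C_mul_X_pow _ _ hP, Polynomial.natDegree_X_pow_add_C]
    norm_num

/-- Let `K` be a field of characteristic 2, `d ≥ 3`, `n ≥ 1`, and
`R = K[X₀,…,X_d]/(X₀³ + ⋯ + X_d³)`.  The nonzero indices `1, …, d` are taken
cyclically, so we index them by `ZMod d` (the variable `x (some j)` plays the
role of `x_{1 + (j - 1 mod d)}`).  For each cyclic index `i`, set
`g i = x₀^{d−2} · x_i^n · ∏_{j in the cyclic window i+1,…,i+d−2} x_j^{n−1}`;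
equivalently `g i = x₀^{d−2} · x_i · ∏_{j ≠ i−1} x_j^{n−1}`, since the window
`{i, i+1, …, i+d−2}` consists of all cyclic indices except `i − 1`.  Let
`u = x₀^d (x₁ ⋯ x_d)^{n−1}`.  Then `u² ∈ (g₁², …, g_d²)` but
`u ∉ (g₁, …, g_d)`; in particular `u` lies in the Frobenius closure of
`(g₁, …, g_d)` but not in the ideal itself. -/
theorem stmt_3 (K : Type*) [Field K] [CharP K 2] (d n : ℕ) (hd : 3 ≤ d)
    (hn : 1 ≤ n) [NeZero d]
    (I : Ideal (MvPolynomial (Option (ZMod d)) K))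
    (hI : I = Ideal.span {X none ^ 3 + ∑ j : ZMod d, X (some j) ^ 3})
    (x : Option (ZMod d) → MvPolynomial (Option (ZMod d)) K ⧸ I)
    (hx : ∀ i, x i = Ideal.Quotient.mk I (X i))
    (g : ZMod d → MvPolynomial (Option (ZMod d)) K ⧸ I)
    (hg : ∀ i, g i = x none ^ (d - 2) * x (some i) *
        ∏ j ∈ Finset.univ.erase (i - 1), x (some j) ^ (n - 1))
    (u : MvPolynomial (Option (ZMod d)) K ⧸ I)
    (hu : u = x none ^ d * (∏ j : ZMod d, x (some j)) ^ (n - 1)) :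
    u ^ 2 ∈ Ideal.span (Set.range fun i => g i ^ 2) ∧
      u ∉ Ideal.span (Set.range g) := by
  have : Fact (1 < d) := ⟨by omega⟩
  have hne (i : ZMod d) : i ≠ i - 1 := fun h => one_ne_zero (sub_eq_self.mp h.symm)
  constructor
  · have hcub : x none ^ 3 = -∑ j : ZMod d, x (some j) ^ 3 := by
      rw [eq_neg_iff_add_eq_zero]
      simp only [hx, ← map_pow, ← map_sum, ← map_add]
      rw [Ideal.Quotient.eq_zero_iff_mem, hI]
      exact Ideal.mem_span_singleton_self _
    have hu2 : u ^ 2 = -∑ j : ZMod d, x none * x (some j) * x (some (j - 1)) ^ (2 * (n - 1)) *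
        g j ^ 2 := by
      have hj (j : ZMod d) : x none * x (some j) * x (some (j - 1)) ^ (2 * (n - 1)) * g j ^ 2 =
          x none ^ (2 * d - 3) * (∏ j : ZMod d, x (some j)) ^ (2 * (n - 1)) * x (some j) ^ 3 := by
        rw [hg, ← Finset.mul_prod_erase Finset.univ (fun j => x (some j)) (Finset.mem_univ (j - 1)),
          Finset.prod_pow, show 2 * d - 3 = (d - 2) * 2 + 1 by omega]
        ring
      simp_rw [hj]
      rw [← Finset.mul_sum, ← mul_neg, ← hcub, hu, mul_pow, ← pow_mul, ← pow_mul,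
        show d * 2 = 2 * d - 3 + 3 by omega]
      ring
    rw [hu2]
    exact neg_mem <| sum_mem fun j _ => Ideal.mul_mem_left _ _ (Ideal.subset_span ⟨j, rfl⟩)
  · intro hmem
    obtain ⟨c, hc⟩ := Ideal.mem_span_range_iff_exists_fun.mp hmem
    choose a ha using fun i => Ideal.Quotient.mk_surjective (c i)
    let w : ZMod d → MvPolynomial (Option (ZMod d)) K := fun i =>
      X (some i) * ∏ j ∈ Finset.univ.erase (i - 1), X (some j) ^ (n - 1)
    have hgw (i : ZMod d) : g i = Ideal.Quotient.mk I (X none ^ (d - 2) * w i) := by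
      simp only [hg, hx, w, map_mul, map_pow, map_prod, mul_assoc]
    have hw (i : ZMod d) : w i ∈ Ideal.span
        (Set.range fun j : ZMod d => (X (some j) : MvPolynomial (Option (ZMod d)) K) ^ n) := by
      refine Ideal.mem_of_dvd _ ?_ (Ideal.subset_span ⟨i, rfl⟩)
      obtain ⟨m, rfl⟩ : ∃ m, n = m + 1 := ⟨n - 1, by omega⟩
      beta_reduce
      rw [pow_succ']
      exact mul_dvd_mul_left _ (Finset.dvd_prod_of_mem (fun j => X (some j) ^ m)
        (Finset.mem_erase.mpr ⟨hne i, Finset.mem_univ i⟩))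
    have hfac : X none ^ 3 + ∑ j : ZMod d, X (some j) ^ 3 ∣
        X none ^ (d - 2) * (X none ^ 2 * (∏ j : ZMod d, X (some j)) ^ (n - 1) - ∑ i, a i * w i) := by
      rw [← Ideal.mem_span_singleton, ← hI, ← Ideal.Quotient.eq_zero_iff_mem, mul_sub, map_sub,
        sub_eq_zero, ← mul_assoc, ← pow_add, Nat.sub_add_cancel (by omega), Finset.mul_sum]
      trans u
      · simp only [hu, hx, map_mul, map_pow, map_prod]
      · rw [← hc, map_sum]
        refine Finset.sum_congr rfl fun i _ => ?_
        rw [mul_left_comm, map_mul, ha, hgw]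
    obtain ⟨b, hb⟩ := hfac
    obtain ⟨b', rfl⟩ := (X_prime (i := none)).pow_dvd_of_dvd_mul_left _ not_X_none_dvd_cubic
      (Dvd.intro _ hb)
    rw [mul_left_comm] at hb
    have hb' := mul_left_cancel₀ (pow_ne_zero _ (X_prime.ne_zero)) hb
    exact sq_mul_prod_pow_ne_add_cubic_mul (n := n) (by omega)
      (sum_mem fun i _ => Ideal.mul_mem_left _ (a i) (hw i)) b' (sub_eq_iff_eq_add'.mp hb')
end

section
/- Let K be a field of prime characteristic p, let K[t, x] be a polynomial ring in two variables over K, and let L be its field of fractions. Let φ : K[T, U, V, W] → L be the K-algebra homomorphism determined by φ(T) = t, φ(U) = t⁴x, φ(V) = t⁴x⁻¹, and φ(W) = t⁴(x+1)⁻¹. Then the kernel of φ is exactly the ideal generated by T⁸ − UV, T⁴(V − W) − VW, and U(V − W) − T⁴W. In particular, the ring K[t, t⁴x, t⁴x⁻¹, t⁴(x+1)⁻¹] is isomorphic as a K-algebra to K[T, U, V, W]/(T⁸ − UV, T⁴(V − W) − VW, U(V − W) − T⁴W). -/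
open MvPolynomial

section ReductionModRelations

variable {D B : Type*} [CommRing D] [CommRing B] [Algebra D B]

theorem mul_aeval_mem_of_mul_pow_mem (N : Submodule D B) (y z : B)
    (h : ∀ i : ℕ, y * z ^ i ∈ N) (f : Polynomial D) : y * Polynomial.aeval z f ∈ N := by
  rw [Polynomial.aeval_eq_sum_range, Finset.mul_sum]
  refine N.sum_mem fun i _ => ?_
  rw [mul_smul_comm]
  exact N.smul_mem _ (h i)

/-- The `D`-submodule of elements `a(U) + b(V) + c(W)`. -/
noncomputable def sumOfAevalRanges (D : Type*) {B : Type*} [CommRing D] [CommRing B] [Algebra D B]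
    (U V W : B) : Submodule D B :=
  LinearMap.range (Polynomial.aeval (R := D) U).toLinearMap ⊔
    LinearMap.range (Polynomial.aeval (R := D) V).toLinearMap ⊔
    LinearMap.range (Polynomial.aeval (R := D) W).toLinearMap

theorem mem_sumOfAevalRanges {U V W z : B} :
    z ∈ sumOfAevalRanges D U V W ↔ ∃ a b c : Polynomial D,
      z = Polynomial.aeval U a + Polynomial.aeval V b + Polynomial.aeval W c := by
  simp only [sumOfAevalRanges, Submodule.mem_sup, LinearMap.mem_range, AlgHom.toLinearMap_apply]
  constructor
  · rintro ⟨_, ⟨_, ⟨a, rfl⟩, _, ⟨b, rfl⟩, rfl⟩, _, ⟨c, rfl⟩, rfl⟩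
    exact ⟨a, b, c, rfl⟩
  · rintro ⟨a, b, c, rfl⟩
    exact ⟨_, ⟨_, ⟨a, rfl⟩, _, ⟨b, rfl⟩, rfl⟩, _, ⟨c, rfl⟩, rfl⟩

theorem mul_mem_sumOfAevalRanges {U V W y z : B}
    (hU : ∀ i : ℕ, y * U ^ i ∈ sumOfAevalRanges D U V W)
    (hV : ∀ i : ℕ, y * V ^ i ∈ sumOfAevalRanges D U V W)
    (hW : ∀ i : ℕ, y * W ^ i ∈ sumOfAevalRanges D U V W)
    (hz : z ∈ sumOfAevalRanges D U V W) : y * z ∈ sumOfAevalRanges D U V W := by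
  obtain ⟨a, b, c, rfl⟩ := mem_sumOfAevalRanges.1 hz
  rw [mul_add, mul_add]
  exact add_mem (add_mem (mul_aeval_mem_of_mul_pow_mem _ _ _ hU a)
    (mul_aeval_mem_of_mul_pow_mem _ _ _ hV b)) (mul_aeval_mem_of_mul_pow_mem _ _ _ hW c)

theorem adjoin_le_sumOfAevalRanges {U V W : B} {s : D}
    (hUV : U * V = (s ^ 2) • (1 : B)) (hVW : V * W = s • V - s • W)
    (hUW : U * W = (s ^ 2) • (1 : B) - s • W) :
    Subalgebra.toSubmodule (Algebra.adjoin D {U, V, W}) ≤ sumOfAevalRanges D U V W := by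
  set M := sumOfAevalRanges D U V W
  have pU (i : ℕ) : U ^ i ∈ M := mem_sumOfAevalRanges.2 ⟨Polynomial.X ^ i, 0, 0, by simp⟩
  have pV (i : ℕ) : V ^ i ∈ M := mem_sumOfAevalRanges.2 ⟨0, Polynomial.X ^ i, 0, by simp⟩
  have pW (i : ℕ) : W ^ i ∈ M := mem_sumOfAevalRanges.2 ⟨0, 0, Polynomial.X ^ i, by simp⟩
  have mU {z : B} (hz : z ∈ M) : U * z ∈ M := by
    refine mul_mem_sumOfAevalRanges (fun i => ?_) (fun i => ?_) (fun i => ?_) hz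
    · simpa [pow_succ'] using pU (i + 1)
    · cases i with
      | zero => simpa using pU 1
      | succ i =>
        rw [pow_succ', ← mul_assoc, hUV, smul_mul_assoc, one_mul]
        exact M.smul_mem _ (pV i)
    · cases i with
      | zero => simpa using pU 1
      | succ i =>
        rw [pow_succ', ← mul_assoc, hUW, sub_mul, smul_mul_assoc, one_mul, smul_mul_assoc,
          ← pow_succ']
        exact sub_mem (M.smul_mem _ (pW i)) (M.smul_mem _ (pW _))
  have mV {z : B} (hz : z ∈ M) : V * z ∈ M := by
    refine mul_mem_sumOfAevalRanges (fun i => ?_) (fun i => ?_) (fun i => ?_) hz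
    · cases i with
      | zero => simpa using pV 1
      | succ i =>
        rw [pow_succ', ← mul_assoc, mul_comm V, hUV, smul_mul_assoc, one_mul]
        exact M.smul_mem _ (pU i)
    · simpa [pow_succ'] using pV (i + 1)
    · induction i with
      | zero => simpa using pV 1
      | succ i ih =>
        rw [pow_succ', ← mul_assoc, hVW, sub_mul, smul_mul_assoc, smul_mul_assoc, ← pow_succ']
        exact sub_mem (M.smul_mem _ ih) (M.smul_mem _ (pW _))
  have mW {z : B} (hz : z ∈ M) : W * z ∈ M := by
    refine mul_mem_sumOfAevalRanges (fun i => ?_) (fun i => ?_) (fun i => ?_) hz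
    · induction i with
      | zero => simpa using pW 1
      | succ i ih =>
        rw [pow_succ', ← mul_assoc, mul_comm W, hUW, sub_mul, smul_mul_assoc, one_mul,
          smul_mul_assoc]
        exact sub_mem (M.smul_mem _ (pU i)) (M.smul_mem _ ih)
    · induction i with
      | zero => simpa using pW 1
      | succ i ih =>
        rw [pow_succ', ← mul_assoc, mul_comm W, hVW, sub_mul, smul_mul_assoc, smul_mul_assoc,
          ← pow_succ']
        exact sub_mem (M.smul_mem _ (pV _)) (M.smul_mem _ ih)
    · simpa [pow_succ'] using pW (i + 1)
  have key (z : B) (hz : z ∈ Algebra.adjoin D {U, V, W}) : ∀ m ∈ M, z * m ∈ M := by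
    induction hz using Algebra.adjoin_induction with
    | mem y hy =>
      intro m hm
      rcases hy with rfl | rfl | rfl
      exacts [mU hm, mV hm, mW hm]
    | algebraMap r =>
      intro m hm
      rw [← Algebra.smul_def]
      exact M.smul_mem _ hm
    | add y z _ _ hy hz =>
      intro m hm
      rw [add_mul]
      exact add_mem (hy m hm) (hz m hm)
    | mul y z _ _ hy hz =>
      intro m hm
      rw [mul_assoc]
      exact hy _ (hz m hm)
  intro z hz
  simpa using key z hz 1 (by simpa using pU 0)

theorem exists_normal_form {U V W z : B} {s : D}
    (hUV : U * V = (s ^ 2) • (1 : B)) (hVW : V * W = s • V - s • W)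
    (hUW : U * W = (s ^ 2) • (1 : B) - s • W) (hz : z ∈ Algebra.adjoin D {U, V, W}) :
    ∃ a b c : Polynomial D, b.coeff 0 = 0 ∧ c.coeff 0 = 0 ∧
      z = Polynomial.aeval U a + Polynomial.aeval V b + Polynomial.aeval W c := by
  obtain ⟨a, b, c, rfl⟩ :=
    mem_sumOfAevalRanges.1 (adjoin_le_sumOfAevalRanges hUV hVW hUW hz)
  refine ⟨a + Polynomial.C (b.coeff 0) + Polynomial.C (c.coeff 0),
    b - Polynomial.C (b.coeff 0), c - Polynomial.C (c.coeff 0), by simp, by simp, ?_⟩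
  simp only [map_add, map_sub, Polynomial.aeval_C]
  ring

end ReductionModRelations

section PartialFractions

variable {D : Type*} [CommRing D]

theorem Polynomial.degree_reverse_lt {b : Polynomial D} (hb : b.coeff 0 = 0) :
    b.reverse.degree < b.natDegree := by
  by_cases h0 : b = 0
  · simp [h0]
  rw [← Polynomial.natDegree_lt_iff_degree_lt (by simpa using h0), Polynomial.reverse_natDegree]
  have h1 : b.natTrailingDegree ≠ 0 := by
    rw [Ne, Polynomial.natTrailingDegree_eq_zero]
    tauto
  have h2 := b.natTrailingDegree_le_natDegree
  omega

theorem Polynomial.eq_zero_of_isCoprime_of_mul_eq {p q r s f : Polynomial D}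
    (hp : p.Monic) (hpq : IsCoprime p q) (hr : r.degree < p.degree)
    (h : f * (p * q) + r * q + s * p = 0) : r = 0 := by
  by_contra hne
  have hdvd : p ∣ r := hpq.dvd_of_dvd_mul_right ⟨-(f * q + s), by linear_combination h⟩
  exact hp.not_dvd_of_degree_lt hne hr hdvd

theorem Polynomial.eval₂_inv_mul_pow_natDegree {L : Type*} [Field L] (g : D →+* L)
    {y : L} (hy : y ≠ 0) (b : Polynomial D) :
    b.eval₂ g y⁻¹ * y ^ b.natDegree = b.reverse.eval₂ g y := by
  let := invertibleOfNonzero (inv_ne_zero hy)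
  have h := Polynomial.eval₂_reverse_mul_pow g y⁻¹ b
  rw [invOf_eq_inv, inv_inv] at h
  rw [← h, mul_assoc, ← mul_pow, inv_mul_cancel₀ hy, one_pow, mul_one]

variable [IsDomain D]

/-- Uniqueness of the partial fraction expansion with poles at `0`, `-1` and `∞`. -/
theorem eq_zero_of_partial_fractions {L : Type*} [Field L] (g : D →+* L) (x : L)
    (hinj : Function.Injective (Polynomial.eval₂RingHom g x)) {a b c : Polynomial D}
    (hb : b.coeff 0 = 0) (hc : c.coeff 0 = 0)
    (h : a.eval₂ g x + b.eval₂ g x⁻¹ + c.eval₂ g (x + 1)⁻¹ = 0) :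
    a = 0 ∧ b = 0 ∧ c = 0 := by
  have hx : x ≠ 0 := fun h0 =>
    Polynomial.X_ne_zero (R := D) (hinj (by simp [h0]))
  have hx1 : x + 1 ≠ 0 := fun h0 =>
    (Polynomial.monic_X_add_C (1 : D)).ne_zero (hinj (by simp [h0]))
  have hmon : (Polynomial.X + 1 : Polynomial D).Monic := Polynomial.monic_X_add_C 1
  have hdeg : (Polynomial.X + 1 : Polynomial D).natDegree = 1 := Polynomial.natDegree_X_add_C 1
  set n := b.natDegree
  set m := c.natDegree
  have e1 := Polynomial.eval₂_inv_mul_pow_natDegree g hx b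
  have e2 := Polynomial.eval₂_inv_mul_pow_natDegree g hx1 c
  have hpoly : a * (Polynomial.X ^ n * (Polynomial.X + 1) ^ m) +
      b.reverse * (Polynomial.X + 1) ^ m +
      c.reverse.comp (Polynomial.X + 1) * Polynomial.X ^ n = 0 := by
    apply hinj
    simp only [map_add, map_mul, map_pow, Polynomial.coe_eval₂RingHom, Polynomial.eval₂_X,
      Polynomial.eval₂_comp, map_one, map_zero, Polynomial.eval₂_add, Polynomial.eval₂_one]
    rw [← e1, ← e2]
    linear_combination x ^ n * (x + 1) ^ m * h
  have hcop : IsCoprime ((Polynomial.X : Polynomial D) ^ n) ((Polynomial.X + 1) ^ m) :=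
    IsCoprime.pow ⟨-1, 1, by ring⟩
  have rb : b.reverse = 0 :=
    Polynomial.eq_zero_of_isCoprime_of_mul_eq (Polynomial.monic_X_pow n) hcop
      (by simpa using Polynomial.degree_reverse_lt hb) hpoly
  have rc : c.reverse.comp (Polynomial.X + 1) = 0 := by
    refine Polynomial.eq_zero_of_isCoprime_of_mul_eq (hmon.pow m) hcop.symm ?_
      (f := a) (s := b.reverse) (by linear_combination hpoly)
    rw [Polynomial.degree_eq_natDegree (hmon.pow m).ne_zero, hmon.natDegree_pow, hdeg, mul_one]
    by_cases h0 : c.reverse = 0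
    · simp [h0]
    have := Polynomial.degree_reverse_lt hc
    rw [← Polynomial.natDegree_lt_iff_degree_lt h0] at this
    refine Polynomial.degree_le_natDegree.trans_lt ?_
    rwa [Polynomial.natDegree_comp, hdeg, mul_one, Nat.cast_lt]
  have b0 : b = 0 := by simpa using rb
  have c0 : c = 0 := by
    rw [Polynomial.comp_eq_zero_iff] at rc
    rcases rc with rc | rc
    · simpa using rc
    · have := congrArg Polynomial.natDegree rc.2
      simp [hdeg] at this
  refine ⟨hinj ?_, b0, c0⟩
  simpa [b0, c0] using h

theorem eq_zero_of_scaled_partial_fractions {L : Type*} [Field L] (g : D →+* L) (x : L)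
    (hinj : Function.Injective (Polynomial.eval₂RingHom g x)) {s : D} (hs : s ≠ 0)
    {a b c : Polynomial D} (hb : b.coeff 0 = 0) (hc : c.coeff 0 = 0)
    (h : a.eval₂ g (g s * x) + b.eval₂ g (g s * x⁻¹) + c.eval₂ g (g s * (x + 1)⁻¹) = 0) :
    a = 0 ∧ b = 0 ∧ c = 0 := by
  have hcomp (f : Polynomial D) (y : L) :
      (f.comp (Polynomial.C s * Polynomial.X)).eval₂ g y = f.eval₂ g (g s * y) := by
    simp [Polynomial.eval₂_comp]
  have hzero {f : Polynomial D} (hf : f.comp (Polynomial.C s * Polynomial.X) = 0) : f = 0 := by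
    ext i
    have := congrArg (Polynomial.coeff · i) hf
    simpa [Polynomial.comp_C_mul_X_coeff, hs] using this
  simp only [← hcomp] at h
  obtain ⟨ha, hb, hc⟩ := eq_zero_of_partial_fractions g x hinj
    (by simp [Polynomial.comp_C_mul_X_coeff, hb]) (by simp [Polynomial.comp_C_mul_X_coeff, hc]) h
  exact ⟨hzero ha, hzero hb, hzero hc⟩

end PartialFractions

theorem injective_eval₂RingHom_of_isFractionRing {K L : Type*} [Field K] [Field L] [Algebra K L]
    [Algebra (MvPolynomial (Fin 2) K) L] [IsScalarTower K (MvPolynomial (Fin 2) K) L]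
    [IsFractionRing (MvPolynomial (Fin 2) K) L] :
    Function.Injective (Polynomial.eval₂RingHom
      (Polynomial.aeval (R := K) (algebraMap (MvPolynomial (Fin 2) K) L (X 0))).toRingHom
      (algebraMap (MvPolynomial (Fin 2) K) L (X 1))) := by
  let e : Polynomial (Polynomial K) →+* MvPolynomial (Fin 2) K := Polynomial.eval₂RingHom
    (Polynomial.aeval (R := K) (X 0 : MvPolynomial (Fin 2) K)).toRingHom (X 1)
  let r : MvPolynomial (Fin 2) K →ₐ[K] Polynomial (Polynomial K) :=
    aeval ![Polynomial.C Polynomial.X, Polynomial.X]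
  have hr : r.toRingHom.comp e = RingHom.id _ := by
    ext <;> simp [e, r, Polynomial.algebraMap_apply]
  have he : Function.Injective e :=
    Function.LeftInverse.injective (g := r) fun y => RingHom.congr_fun hr y
  have hcomp : Polynomial.eval₂RingHom
      (Polynomial.aeval (R := K) (algebraMap (MvPolynomial (Fin 2) K) L (X 0))).toRingHom
      (algebraMap (MvPolynomial (Fin 2) K) L (X 1)) =
      (algebraMap (MvPolynomial (Fin 2) K) L).comp e := by
    ext k
    · simpa [e] using IsScalarTower.algebraMap_apply K (MvPolynomial (Fin 2) K) L k
    · simp [e]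
    · simp [e]
  rw [hcomp]
  exact (IsFractionRing.injective (MvPolynomial (Fin 2) K) L).comp he

/-- Let `K` be a field of prime characteristic `p`, let `K[t,x]` be a polynomial
ring in two variables with fraction field `L`, and let
`φ : K[T,U,V,W] → L` be the `K`-algebra map sending `T, U, V, W` to
`t, t⁴x, t⁴x⁻¹, t⁴(x+1)⁻¹`.  Then
`ker φ = (T⁸ − UV, T⁴(V − W) − VW, U(V − W) − T⁴W)`; in particular
`K[t, t⁴x, t⁴x⁻¹, t⁴(x+1)⁻¹]` is isomorphic as a `K`-algebra to
`K[T,U,V,W]/(T⁸ − UV, T⁴(V − W) − VW, U(V − W) − T⁴W)`. -/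
theorem stmt_4 (K : Type*) [Field K] (p : ℕ) [Fact p.Prime] [CharP K p]
    (L : Type*) [Field L] [Algebra K L]
    [Algebra (MvPolynomial (Fin 2) K) L]
    [IsScalarTower K (MvPolynomial (Fin 2) K) L]
    [IsFractionRing (MvPolynomial (Fin 2) K) L]
    (t x : L)
    (ht : t = algebraMap (MvPolynomial (Fin 2) K) L (X 0))
    (hx : x = algebraMap (MvPolynomial (Fin 2) K) L (X 1))
    (φ : MvPolynomial (Fin 4) K →ₐ[K] L)
    (hφ : φ = aeval ![t, t ^ 4 * x, t ^ 4 * x⁻¹, t ^ 4 * (x + 1)⁻¹]) :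
    RingHom.ker φ = Ideal.span
      {X 0 ^ 8 - X 1 * X 2, X 0 ^ 4 * (X 2 - X 3) - X 2 * X 3,
        X 1 * (X 2 - X 3) - X 0 ^ 4 * X 3} ∧
    Nonempty ((MvPolynomial (Fin 4) K ⧸ Ideal.span
        ({X 0 ^ 8 - X 1 * X 2, X 0 ^ 4 * (X 2 - X 3) - X 2 * X 3,
          X 1 * (X 2 - X 3) - X 0 ^ 4 * X 3} : Set (MvPolynomial (Fin 4) K))) ≃ₐ[K]
      Algebra.adjoin K ({t, t ^ 4 * x, t ^ 4 * x⁻¹, t ^ 4 * (x + 1)⁻¹} : Set L)) := by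
  set I : Ideal (MvPolynomial (Fin 4) K) := Ideal.span
      {X 0 ^ 8 - X 1 * X 2, X 0 ^ 4 * (X 2 - X 3) - X 2 * X 3,
        X 1 * (X 2 - X 3) - X 0 ^ 4 * X 3} with hI
  have hinj := injective_eval₂RingHom_of_isFractionRing (K := K) (L := L)
  rw [← ht, ← hx] at hinj
  have hx0 : x ≠ 0 := fun h0 =>
    Polynomial.X_ne_zero (R := Polynomial K) (hinj (by simp [h0]))
  have hx1 : x + 1 ≠ 0 := fun h0 =>
    (Polynomial.monic_X_add_C (1 : Polynomial K)).ne_zero (hinj (by simp [h0]))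
  have hle : I ≤ RingHom.ker φ := by
    rw [hI, Ideal.span_le]
    rintro f (rfl | rfl | rfl) <;>
      simp only [SetLike.mem_coe, RingHom.mem_ker, hφ, map_sub, map_mul, map_pow, aeval_X,
        Matrix.cons_val] <;> field_simp <;> ring
  have hker : RingHom.ker φ = I := by
    refine le_antisymm (fun f hf => ?_) hle
    let q := Ideal.Quotient.mkₐ K I
    let ψ : (MvPolynomial (Fin 4) K ⧸ I) →ₐ[K] L := Ideal.Quotient.liftₐ I φ hle
    have hψ (i : Fin 4) : ψ (q (X i)) = ![t, t ^ 4 * x, t ^ 4 * x⁻¹, t ^ 4 * (x + 1)⁻¹] i := by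
      change φ (X i) = _
      rw [hφ, aeval_X]
    let := (Polynomial.aeval (R := K) (q (X 0))).toAlgebra
    have hmap : algebraMap (Polynomial K) (MvPolynomial (Fin 4) K ⧸ I) =
      (Polynomial.aeval (R := K) (q (X 0))).toRingHom := rfl
    have hq {y : MvPolynomial (Fin 4) K} (hy : y ∈ I) : q y = 0 :=
      Ideal.Quotient.eq_zero_iff_mem.2 hy
    have r1 := hq (Ideal.subset_span (Or.inl rfl))
    have r2 := hq (Ideal.subset_span (Or.inr (Or.inl rfl)))
    have r3 := hq (Ideal.subset_span (Or.inr (Or.inr rfl)))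
    simp only [map_sub, map_mul, map_pow] at r1 r2 r3
    have hmem (f : MvPolynomial (Fin 4) K) :
        q f ∈ Algebra.adjoin (Polynomial K) {q (X 1), q (X 2), q (X 3)} := by
      induction f using MvPolynomial.induction_on with
      | C k =>
        have : q (C k) = algebraMap (Polynomial K) _ (Polynomial.C k) := by
          simp only [hmap, AlgHom.toRingHom_eq_coe, RingHom.coe_coe, Polynomial.aeval_C]
          exact q.commutes k
        rw [this]
        exact Subalgebra.algebraMap_mem _ _
      | add f g hf hg =>
        rw [map_add]
        exact add_mem hf hg
      | mul_X f i hf =>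
        rw [map_mul]
        refine mul_mem hf ?_
        fin_cases i
        · have : q (X 0) = algebraMap (Polynomial K) _ Polynomial.X := by simp [hmap]
          exact this ▸ Subalgebra.algebraMap_mem _ _
        all_goals exact Algebra.subset_adjoin (by simp)
    obtain ⟨a, b, c, hb, hc, habc⟩ := exists_normal_form (s := (Polynomial.X : Polynomial K) ^ 4)
      (by simp [Algebra.smul_def, hmap]; linear_combination -r1)
      (by simp [Algebra.smul_def, hmap]; linear_combination -r2)
      (by simp [Algebra.smul_def, hmap]; linear_combination -r1 - r3) (hmem f)
    have hg : ψ.toRingHom.comp (algebraMap (Polynomial K) (MvPolynomial (Fin 4) K ⧸ I)) =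
        (Polynomial.aeval (R := K) t).toRingHom := by
      rw [hmap]
      ext <;> simp [hψ]
    have hev (y : MvPolynomial (Fin 4) K ⧸ I) (d : Polynomial (Polynomial K)) :
        ψ (Polynomial.aeval y d) = d.eval₂ (Polynomial.aeval (R := K) t).toRingHom (ψ y) := by
      rw [← hg, Polynomial.aeval_def]
      exact Polynomial.hom_eval₂ d _ ψ.toRingHom y
    have h0 : ψ (q f) = 0 := hf
    rw [habc, map_add, map_add, hev, hev, hev, hψ, hψ, hψ] at h0
    obtain ⟨rfl, rfl, rfl⟩ := eq_zero_of_scaled_partial_fractions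
      (Polynomial.aeval (R := K) t).toRingHom x hinj
      (s := (Polynomial.X : Polynomial K) ^ 4) (pow_ne_zero 4 Polynomial.X_ne_zero) hb hc
      (by simpa using h0)
    exact Ideal.Quotient.eq_zero_iff_mem.1 (show q f = 0 by simpa using habc)
  refine ⟨hker, ⟨(Ideal.quotientEquivAlgOfEq K hker.symm).trans
    ((Ideal.quotientKerEquivRange φ).trans (Subalgebra.equivOfEq _ _ ?_))⟩⟩
  rw [hφ, ← Algebra.adjoin_range_eq_range_aeval]
  congr 1
  ext y
  simp
  tauto
end

section
/- Let K be a field and let K[X, Y] be the polynomial ring in two variables. Then the K-subalgebra of K[X, Y] generated by the four polynomials XY(X−Y), XY², X(X−Y)², and Y(X−Y)² is equal to the K-subalgebra generated by X³, X²Y, XY², and Y³. -/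
open MvPolynomial

/-- Let `K` be a field.  The `K`-subalgebra of `K[X,Y]` generated by
`XY(X−Y), XY², X(X−Y)², Y(X−Y)²` equals the `K`-subalgebra generated by
`X³, X²Y, XY², Y³` (the third Veronese subring). -/
theorem stmt_5 (K : Type*) [Field K] :
    Algebra.adjoin K ({X 0 * X 1 * (X 0 - X 1), X 0 * X 1 ^ 2,
        X 0 * (X 0 - X 1) ^ 2, X 1 * (X 0 - X 1) ^ 2} : Set (MvPolynomial (Fin 2) K)) =
      Algebra.adjoin K ({X 0 ^ 3, X 0 ^ 2 * X 1, X 0 * X 1 ^ 2, X 1 ^ 3} :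
        Set (MvPolynomial (Fin 2) K)) := by
  apply le_antisymm <;> refine Algebra.adjoin_le fun p hp => ?_
  · set A := Algebra.adjoin K ({X 0 ^ 3, X 0 ^ 2 * X 1, X 0 * X 1 ^ 2, X 1 ^ 3} :
      Set (MvPolynomial (Fin 2) K))
    have h₁ : X 0 ^ 3 ∈ A := Algebra.subset_adjoin (by simp)
    have h₂ : X 0 ^ 2 * X 1 ∈ A := Algebra.subset_adjoin (by simp)
    have h₃ : X 0 * X 1 ^ 2 ∈ A := Algebra.subset_adjoin (by simp)
    have h₄ : X 1 ^ 3 ∈ A := Algebra.subset_adjoin (by simp)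
    rw [SetLike.mem_coe]
    rcases hp with rfl | rfl | rfl | rfl
    · convert A.sub_mem h₂ h₃ using 1
      ring
    · exact h₃
    · convert A.add_mem (A.sub_mem (A.sub_mem h₁ h₂) h₂) h₃ using 1
      ring
    · convert A.add_mem (A.sub_mem (A.sub_mem h₂ h₃) h₃) h₄ using 1
      ring
  · set B := Algebra.adjoin K ({X 0 * X 1 * (X 0 - X 1), X 0 * X 1 ^ 2,
      X 0 * (X 0 - X 1) ^ 2, X 1 * (X 0 - X 1) ^ 2} : Set (MvPolynomial (Fin 2) K))
    have h₁ : X 0 * X 1 * (X 0 - X 1) ∈ B := Algebra.subset_adjoin (by simp)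
    have h₂ : X 0 * X 1 ^ 2 ∈ B := Algebra.subset_adjoin (by simp)
    have h₃ : X 0 * (X 0 - X 1) ^ 2 ∈ B := Algebra.subset_adjoin (by simp)
    have h₄ : X 1 * (X 0 - X 1) ^ 2 ∈ B := Algebra.subset_adjoin (by simp)
    rw [SetLike.mem_coe]
    rcases hp with rfl | rfl | rfl | rfl
    · convert B.add_mem (B.add_mem (B.add_mem h₃ h₁) h₁) h₂ using 1
      ring
    · convert B.add_mem h₁ h₂ using 1
      ring
    · exact h₂
    · convert B.add_mem (B.sub_mem h₄ h₁) h₂ using 1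
      ring
end

section
/- Let K be a field and let ψ : K[S, U, V, W] → K[X, Y] be the K-algebra homomorphism determined by ψ(S) = XY(X−Y), ψ(U) = XY², ψ(V) = X(X−Y)², and ψ(W) = Y(X−Y)². Then the kernel of ψ is exactly the ideal generated by S² − UV, S(V − W) − VW, and U(V − W) − SW. In particular, K[S, U, V, W]/(S² − UV, S(V − W) − VW, U(V − W) − SW) is isomorphic as a K-algebra to the subalgebra of K[X, Y] generated by X³, X²Y, XY², Y³. -/
open MvPolynomial

/-- The standard monomial expressing `x ^ m * y ^ n` through the third powers `p`, `s` and the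
mixed cubics `q`, `r`; it is zero if `3` does not divide `m + n`. -/
def veroneseCoeff {A : Type*} [CommRing A] (p q r s : A) (m n : ℕ) : A :=
  if (m + n) % 3 = 0 then
    p ^ (m / 3) * s ^ (n / 3) * (if m % 3 = 2 then q else if m % 3 = 1 then r else 1)
  else 0

section veroneseCoeff

variable {A : Type*} [CommRing A] {p q r s : A}

theorem veroneseCoeff_zero_zero : veroneseCoeff p q r s 0 0 = 1 := by
  simp [veroneseCoeff]

theorem veroneseCoeff_of_not_dvd {m n : ℕ} (h : (m + n) % 3 ≠ 0) :
    veroneseCoeff p q r s m n = 0 := if_neg h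

theorem veroneseCoeff_three_mul (i j : ℕ) :
    veroneseCoeff p q r s (3 * i) (3 * j) = p ^ i * s ^ j := by
  have h : (3 * i + 3 * j) % 3 = 0 := by omega
  simp [veroneseCoeff, h]

theorem veroneseCoeff_three_mul_add_two (i j : ℕ) :
    veroneseCoeff p q r s (3 * i + 2) (3 * j + 1) = p ^ i * s ^ j * q := by
  have h : (3 * i + 2 + (3 * j + 1)) % 3 = 0 := by omega
  have hi : (3 * i + 2) / 3 = i := by omega
  have hj : (3 * j + 1) / 3 = j := by omega
  have hm : (3 * i + 2) % 3 = 2 := by omega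
  rw [veroneseCoeff, if_pos h, hi, hj, hm, if_pos rfl]

theorem veroneseCoeff_three_mul_add_one (i j : ℕ) :
    veroneseCoeff p q r s (3 * i + 1) (3 * j + 2) = p ^ i * s ^ j * r := by
  have h : (3 * i + 1 + (3 * j + 2)) % 3 = 0 := by omega
  have hi : (3 * i + 1) / 3 = i := by omega
  have hj : (3 * j + 2) / 3 = j := by omega
  have hm : (3 * i + 1) % 3 = 1 := by omega
  rw [veroneseCoeff, if_pos h, hi, hj, hm, if_neg (by decide), if_pos rfl]

theorem exists_residues_of_three_dvd_add {m n : ℕ} (h : (m + n) % 3 = 0) :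
    ∃ i j, (m = 3 * i ∧ n = 3 * j) ∨ (m = 3 * i + 2 ∧ n = 3 * j + 1) ∨
      (m = 3 * i + 1 ∧ n = 3 * j + 2) :=
  ⟨m / 3, n / 3, by omega⟩

theorem veroneseCoeff_add_three_left (m n : ℕ) :
    veroneseCoeff p q r s (m + 3) n = veroneseCoeff p q r s m n * p := by
  by_cases h : (m + n) % 3 = 0
  · obtain ⟨i, j, ⟨rfl, rfl⟩ | ⟨rfl, rfl⟩ | ⟨rfl, rfl⟩⟩ := exists_residues_of_three_dvd_add h
    · rw [show 3 * i + 3 = 3 * (i + 1) by ring]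
      simp only [veroneseCoeff_three_mul]
      ring
    · rw [show 3 * i + 2 + 3 = 3 * (i + 1) + 2 by ring]
      simp only [veroneseCoeff_three_mul_add_two]
      ring
    · rw [show 3 * i + 1 + 3 = 3 * (i + 1) + 1 by ring]
      simp only [veroneseCoeff_three_mul_add_one]
      ring
  · rw [veroneseCoeff_of_not_dvd h, veroneseCoeff_of_not_dvd (by omega), zero_mul]

theorem veroneseCoeff_add_three_right (m n : ℕ) :
    veroneseCoeff p q r s m (n + 3) = veroneseCoeff p q r s m n * s := by
  by_cases h : (m + n) % 3 = 0
  · obtain ⟨i, j, ⟨rfl, rfl⟩ | ⟨rfl, rfl⟩ | ⟨rfl, rfl⟩⟩ := exists_residues_of_three_dvd_add h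
    · rw [show 3 * j + 3 = 3 * (j + 1) by ring]
      simp only [veroneseCoeff_three_mul]
      ring
    · rw [show 3 * j + 1 + 3 = 3 * (j + 1) + 1 by ring]
      simp only [veroneseCoeff_three_mul_add_two]
      ring
    · rw [show 3 * j + 2 + 3 = 3 * (j + 1) + 2 by ring]
      simp only [veroneseCoeff_three_mul_add_one]
      ring
  · rw [veroneseCoeff_of_not_dvd h, veroneseCoeff_of_not_dvd (by omega), zero_mul]

theorem veroneseCoeff_add_two_add_one (hq : q ^ 2 = p * r) (hqr : q * r = p * s) (m n : ℕ) :
    veroneseCoeff p q r s (m + 2) (n + 1) = veroneseCoeff p q r s m n * q := by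
  by_cases h : (m + n) % 3 = 0
  · obtain ⟨i, j, ⟨rfl, rfl⟩ | ⟨rfl, rfl⟩ | ⟨rfl, rfl⟩⟩ := exists_residues_of_three_dvd_add h
    · simp only [veroneseCoeff_three_mul, veroneseCoeff_three_mul_add_two]
    · rw [show 3 * i + 2 + 2 = 3 * (i + 1) + 1 by ring, show 3 * j + 1 + 1 = 3 * j + 2 by ring,
        veroneseCoeff_three_mul_add_one, veroneseCoeff_three_mul_add_two]
      linear_combination -(p ^ i * s ^ j) * hq
    · rw [show 3 * i + 1 + 2 = 3 * (i + 1) by ring, show 3 * j + 2 + 1 = 3 * (j + 1) by ring,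
        veroneseCoeff_three_mul_add_one, veroneseCoeff_three_mul]
      linear_combination -(p ^ i * s ^ j) * hqr
  · rw [veroneseCoeff_of_not_dvd h, veroneseCoeff_of_not_dvd (by omega), zero_mul]

theorem veroneseCoeff_add_one_add_two (hr : r ^ 2 = q * s) (hqr : q * r = p * s) (m n : ℕ) :
    veroneseCoeff p q r s (m + 1) (n + 2) = veroneseCoeff p q r s m n * r := by
  by_cases h : (m + n) % 3 = 0
  · obtain ⟨i, j, ⟨rfl, rfl⟩ | ⟨rfl, rfl⟩ | ⟨rfl, rfl⟩⟩ := exists_residues_of_three_dvd_add h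
    · simp only [veroneseCoeff_three_mul, veroneseCoeff_three_mul_add_one]
    · rw [show 3 * i + 2 + 1 = 3 * (i + 1) by ring, show 3 * j + 1 + 2 = 3 * (j + 1) by ring,
        veroneseCoeff_three_mul, veroneseCoeff_three_mul_add_two]
      linear_combination -(p ^ i * s ^ j) * hqr
    · rw [show 3 * i + 1 + 1 = 3 * i + 2 by ring, show 3 * j + 2 + 2 = 3 * (j + 1) + 1 by ring,
        veroneseCoeff_three_mul_add_one, veroneseCoeff_three_mul_add_two]
      linear_combination -(p ^ i * s ^ j) * hr
  · rw [veroneseCoeff_of_not_dvd h, veroneseCoeff_of_not_dvd (by omega), zero_mul]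

end veroneseCoeff

/-- Elements satisfying the equations of the twisted cubic admit a linear map from the polynomial
ring that turns multiplication by the cubic monomials into multiplication by these elements. -/
theorem exists_veronese_linearMap {K A : Type*} [Field K] [CommRing A] [Algebra K A]
    {p q r s : A} (hq : q ^ 2 = p * r) (hr : r ^ 2 = q * s) (hqr : q * r = p * s) :
    ∃ φ : MvPolynomial (Fin 2) K →ₗ[K] A, φ 1 = 1 ∧
      (∀ g, φ (g * X 0 ^ 3) = φ g * p) ∧ (∀ g, φ (g * (X 0 ^ 2 * X 1)) = φ g * q) ∧
      (∀ g, φ (g * (X 0 * X 1 ^ 2)) = φ g * r) ∧ (∀ g, φ (g * X 1 ^ 3) = φ g * s) := by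
  let φ : MvPolynomial (Fin 2) K →ₗ[K] A :=
    (basisMonomials (Fin 2) K).constr K fun d => veroneseCoeff p q r s (d 0) (d 1)
  have hφ (d : Fin 2 →₀ ℕ) : φ (monomial d 1) = veroneseCoeff p q r s (d 0) (d 1) :=
    (basisMonomials (Fin 2) K).constr_basis K _ d
  have hmul (a b : ℕ) (x : A) (hx : ∀ m n, veroneseCoeff p q r s (m + a) (n + b) =
      veroneseCoeff p q r s m n * x) (g : MvPolynomial (Fin 2) K) :
      φ (g * (X 0 ^ a * X 1 ^ b)) = φ g * x := by
    suffices φ ∘ₗ LinearMap.mulRight K (X 0 ^ a * X 1 ^ b) = LinearMap.mulRight K x ∘ₗ φ from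
      LinearMap.congr_fun this g
    refine (basisMonomials (Fin 2) K).ext fun d => ?_
    simp only [coe_basisMonomials, LinearMap.comp_apply, LinearMap.mulRight_apply,
      X_pow_eq_monomial, monomial_mul, mul_one, hφ]
    simpa using hx (d 0) (d 1)
  refine ⟨φ, ?_, fun g => ?_, fun g => ?_, fun g => ?_, fun g => ?_⟩
  · simpa [veroneseCoeff_zero_zero] using hφ 0
  · simpa using hmul 3 0 p veroneseCoeff_add_three_left g
  · simpa using hmul 2 1 q (veroneseCoeff_add_two_add_one hq hqr) g
  · simpa using hmul 1 2 r (veroneseCoeff_add_one_add_two hr hqr) g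
  · simpa using hmul 0 3 s veroneseCoeff_add_three_right g

/-- A retraction `φ` of `ψ` modulo `I`, linear over the image of `ψ`, bounds the kernel of `ψ`. -/
theorem ker_le_of_linearMap {K σ B : Type*} [Field K] [CommRing B] [Algebra K B]
    {ψ : MvPolynomial σ K →ₐ[K] B} {I : Ideal (MvPolynomial σ K)}
    (φ : B →ₗ[K] MvPolynomial σ K ⧸ I) (h_one : φ 1 = 1)
    (h_mul : ∀ g i, φ (g * ψ (X i)) = φ g * Ideal.Quotient.mk I (X i)) :
    RingHom.ker ψ ≤ I := by
  have key (f : MvPolynomial σ K) : φ (ψ f) = Ideal.Quotient.mk I f := by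
    induction f using MvPolynomial.induction_on with
    | C a =>
      rw [← algebraMap_eq, AlgHom.commutes, Algebra.algebraMap_eq_smul_one, map_smul, h_one,
        Algebra.algebraMap_eq_smul_one]
      rfl
    | add f g hf hg => simp only [map_add, hf, hg]
    | mul_X f i hf => rw [map_mul, h_mul, hf, map_mul]
  intro f hf
  rw [← Ideal.Quotient.eq_zero_iff_mem, ← key f, (RingHom.mem_ker).1 hf, map_zero]

/-- The four products of linear forms generate the third Veronese subring. -/
theorem adjoin_range_eq_veronese (K : Type*) [Field K] :
    Algebra.adjoin K (Set.range (![X 0 * X 1 * (X 0 - X 1), X 0 * X 1 ^ 2,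
      X 0 * (X 0 - X 1) ^ 2, X 1 * (X 0 - X 1) ^ 2] : Fin 4 → MvPolynomial (Fin 2) K)) =
    Algebra.adjoin K {X 0 ^ 3, X 0 ^ 2 * X 1, X 0 * X 1 ^ 2, X 1 ^ 3} := by
  apply le_antisymm
  · set T := Algebra.adjoin K ({X 0 ^ 3, X 0 ^ 2 * X 1, X 0 * X 1 ^ 2, X 1 ^ 3} :
      Set (MvPolynomial (Fin 2) K))
    have hp : X 0 ^ 3 ∈ T := Algebra.subset_adjoin (by simp)
    have hq : X 0 ^ 2 * X 1 ∈ T := Algebra.subset_adjoin (by simp)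
    have hr : X 0 * X 1 ^ 2 ∈ T := Algebra.subset_adjoin (by simp)
    have hs : X 1 ^ 3 ∈ T := Algebra.subset_adjoin (by simp)
    rw [Algebra.adjoin_le_iff]
    rintro _ ⟨i, rfl⟩
    fin_cases i
    · change X 0 * X 1 * (X 0 - X 1) ∈ T
      convert T.sub_mem hq hr using 1
      ring
    · exact hr
    · change X 0 * (X 0 - X 1) ^ 2 ∈ T
      convert T.add_mem (T.sub_mem hp (T.add_mem hq hq)) hr using 1
      ring
    · change X 1 * (X 0 - X 1) ^ 2 ∈ T
      convert T.add_mem (T.sub_mem hq (T.add_mem hr hr)) hs using 1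
      ring
  · set T := Algebra.adjoin K (Set.range (![X 0 * X 1 * (X 0 - X 1), X 0 * X 1 ^ 2,
      X 0 * (X 0 - X 1) ^ 2, X 1 * (X 0 - X 1) ^ 2] : Fin 4 → MvPolynomial (Fin 2) K))
    have h₀ : X 0 * X 1 * (X 0 - X 1) ∈ T := Algebra.subset_adjoin ⟨0, rfl⟩
    have h₁ : X 0 * X 1 ^ 2 ∈ T := Algebra.subset_adjoin ⟨1, rfl⟩
    have h₂ : X 0 * (X 0 - X 1) ^ 2 ∈ T := Algebra.subset_adjoin ⟨2, rfl⟩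
    have h₃ : X 1 * (X 0 - X 1) ^ 2 ∈ T := Algebra.subset_adjoin ⟨3, rfl⟩
    rw [Algebra.adjoin_le_iff]
    rintro _ (rfl | rfl | rfl | rfl)
    · change X 0 ^ 3 ∈ T
      convert T.add_mem (T.add_mem h₂ (T.add_mem h₀ h₀)) h₁ using 1
      ring
    · change X 0 ^ 2 * X 1 ∈ T
      convert T.add_mem h₀ h₁ using 1
      ring
    · exact h₁
    · change X 1 ^ 3 ∈ T
      convert T.add_mem (T.sub_mem h₃ h₀) h₁ using 1
      ring

/-- Let `K` be a field and `ψ : K[S,U,V,W] → K[X,Y]` the `K`-algebra map sending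
`S, U, V, W` to `XY(X−Y), XY², X(X−Y)², Y(X−Y)²`.  Then
`ker ψ = (S² − UV, S(V − W) − VW, U(V − W) − SW)`; in particular
`K[S,U,V,W]/(S² − UV, S(V − W) − VW, U(V − W) − SW)` is isomorphic as a
`K`-algebra to the subalgebra `K[X³, X²Y, XY², Y³]` of `K[X,Y]`. -/
theorem stmt_6 (K : Type*) [Field K]
    (ψ : MvPolynomial (Fin 4) K →ₐ[K] MvPolynomial (Fin 2) K)
    (hψ : ψ = aeval ![X 0 * X 1 * (X 0 - X 1), X 0 * X 1 ^ 2,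
      X 0 * (X 0 - X 1) ^ 2, X 1 * (X 0 - X 1) ^ 2]) :
    RingHom.ker ψ = Ideal.span
      {X 0 ^ 2 - X 1 * X 2, X 0 * (X 2 - X 3) - X 2 * X 3,
        X 1 * (X 2 - X 3) - X 0 * X 3} ∧
    Nonempty ((MvPolynomial (Fin 4) K ⧸ Ideal.span
        ({X 0 ^ 2 - X 1 * X 2, X 0 * (X 2 - X 3) - X 2 * X 3,
          X 1 * (X 2 - X 3) - X 0 * X 3} : Set (MvPolynomial (Fin 4) K))) ≃ₐ[K]
      Algebra.adjoin K ({X 0 ^ 3, X 0 ^ 2 * X 1, X 0 * X 1 ^ 2, X 1 ^ 3} :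
        Set (MvPolynomial (Fin 2) K))) := by
  have hker : RingHom.ker ψ = Ideal.span
      {X 0 ^ 2 - X 1 * X 2, X 0 * (X 2 - X 3) - X 2 * X 3,
        X 1 * (X 2 - X 3) - X 0 * X 3} := by
    apply le_antisymm
    · set I : Ideal (MvPolynomial (Fin 4) K) := Ideal.span
        {X 0 ^ 2 - X 1 * X 2, X 0 * (X 2 - X 3) - X 2 * X 3,
          X 1 * (X 2 - X 3) - X 0 * X 3}
      let x (i : Fin 4) : MvPolynomial (Fin 4) K ⧸ I := Ideal.Quotient.mk I (X i)
      have h₁ : x 0 ^ 2 - x 1 * x 2 = 0 :=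
        Ideal.Quotient.eq_zero_iff_mem.2 (Ideal.subset_span (by simp))
      have h₂ : x 0 * (x 2 - x 3) - x 2 * x 3 = 0 :=
        Ideal.Quotient.eq_zero_iff_mem.2 (Ideal.subset_span (by simp))
      have h₃ : x 1 * (x 2 - x 3) - x 0 * x 3 = 0 :=
        Ideal.Quotient.eq_zero_iff_mem.2 (Ideal.subset_span (by simp))
      obtain ⟨φ, h_one, hp, hq, hr, hs⟩ := exists_veronese_linearMap (K := K)
        (p := x 2 + 2 * x 0 + x 1) (q := x 0 + x 1) (r := x 1) (s := x 3 - x 0 + x 1)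
        (by linear_combination h₁) (by linear_combination h₁ + h₃)
        (by linear_combination h₂ + 2 * h₁ + h₃)
      refine ker_le_of_linearMap φ h_one fun g i => ?_
      change _ = φ g * x i
      subst hψ
      rw [aeval_X]
      fin_cases i
      · have e : g * (X 0 * X 1 * (X 0 - X 1)) =
            g * (X 0 ^ 2 * X 1) - g * (X 0 * X 1 ^ 2) := by ring
        change φ (g * (X 0 * X 1 * (X 0 - X 1))) = φ g * x 0
        rw [e, map_sub, hq, hr]
        ring
      · exact hr g
      · have e : g * (X 0 * (X 0 - X 1) ^ 2) = g * X 0 ^ 3 - g * (X 0 ^ 2 * X 1) -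
            g * (X 0 ^ 2 * X 1) + g * (X 0 * X 1 ^ 2) := by ring
        change φ (g * (X 0 * (X 0 - X 1) ^ 2)) = φ g * x 2
        rw [e, map_add, map_sub, map_sub, hp, hq, hr]
        ring
      · have e : g * (X 1 * (X 0 - X 1) ^ 2) = g * (X 0 ^ 2 * X 1) - g * (X 0 * X 1 ^ 2) -
            g * (X 0 * X 1 ^ 2) + g * X 1 ^ 3 := by ring
        change φ (g * (X 1 * (X 0 - X 1) ^ 2)) = φ g * x 3
        rw [e, map_add, map_sub, map_sub, hs, hq, hr]
        ring
    · rw [Ideal.span_le]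
      rintro _ (rfl | rfl | rfl) <;>
      · simp only [SetLike.mem_coe, RingHom.mem_ker, hψ, map_sub, map_mul, map_pow, aeval_X]
        simp only [Matrix.cons_val]
        ring
  refine ⟨hker, ⟨?_⟩⟩
  have hrange : ψ.range = Algebra.adjoin K {X 0 ^ 3, X 0 ^ 2 * X 1, X 0 * X 1 ^ 2, X 1 ^ 3} := by
    rw [hψ, ← Algebra.adjoin_range_eq_range_aeval, adjoin_range_eq_veronese]
  exact (Ideal.quotientEquivAlgOfEq K hker.symm).trans
    ((Ideal.quotientKerEquivRange ψ).trans (Subalgebra.equivOfEq _ _ hrange))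
end

section
/- Let K be a field, let K[s, t] be a polynomial ring in two variables, and let L be its field of fractions. Let ψ : K[X, Y, Z] → L be the K-algebra homomorphism determined by ψ(X) = s⁸t¹⁰/(s+t)³, ψ(Y) = s⁵t⁷/(s+t)², and ψ(Z) = −s³t⁴/(s+t). Then the kernel of ψ is exactly the principal ideal generated by X² + Y³ + Z⁵. In particular, ψ(X)² + ψ(Y)³ + ψ(Z)⁵ = 0 in L, and K[X,Y,Z]/(X² + Y³ + Z⁵) is isomorphic as a K-algebra to the subring of L generated by these three elements. -/
open MvPolynomial

/-- A monic quadratic `T² + c` over a domain is irreducible if `-c` is not a square. -/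
theorem Polynomial.irreducible_X_sq_add_C {R : Type*} [CommRing R] [IsDomain R] {c : R}
    (hc : ∀ d : R, d ^ 2 + c ≠ 0) :
    Irreducible (Polynomial.X ^ 2 + Polynomial.C c) := by
  have hdeg : (Polynomial.X ^ 2 + Polynomial.C c).natDegree = 2 :=
    Polynomial.natDegree_X_pow_add_C
  have hmonic : (Polynomial.X ^ 2 + Polynomial.C c).Monic :=
    Polynomial.monic_X_pow_add_C c two_ne_zero
  rw [hmonic.irreducible_iff_roots_eq_zero_of_degree_le_three hdeg.ge (by omega),
    Multiset.eq_zero_iff_forall_notMem]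
  intro d hd
  exact hc d (by simpa using Polynomial.isRoot_of_mem_roots hd)

/-- The `E₈` polynomial `X² + Y³ + Z⁵` is prime over every field. -/
theorem MvPolynomial.prime_sq_add_cube_add_pow_five (K : Type*) [Field K] :
    Prime (X 0 ^ 2 + X 1 ^ 3 + X 2 ^ 5 : MvPolynomial (Fin 3) K) := by
  rw [← irreducible_iff_prime, ← MulEquiv.irreducible_iff (finSuccEquiv K 2)]
  have hF : finSuccEquiv K 2 (X 0 ^ 2 + X 1 ^ 3 + X 2 ^ 5) =
      Polynomial.X ^ 2 + Polynomial.C (X 0 ^ 3 + X 1 ^ 5) := by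
    have h1 : finSuccEquiv K 2 (X 1) = Polynomial.C (X 0) := finSuccEquiv_X_succ (j := 0)
    have h2 : finSuccEquiv K 2 (X 2) = Polynomial.C (X 1) := finSuccEquiv_X_succ (j := 1)
    simp only [map_add, map_pow, finSuccEquiv_X_zero, h1, h2, add_assoc]
  rw [hF]
  refine Polynomial.irreducible_X_sq_add_C fun d hd => ?_
  have h := congrArg (aeval ![(0 : Polynomial K), Polynomial.X]) hd
  simp only [map_add, map_pow, aeval_X, Matrix.cons_val_zero, Matrix.cons_val_one, map_zero] at h
  have hdeg := congrArg Polynomial.natDegree (eq_neg_of_add_eq_zero_left h)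
  simp at hdeg
  omega

/-- If `x² + y³ + z⁵ = 0` with `x, y` nonzero, then `s = -xz/y²`, `t = -yz/x` satisfy
`s + t = z⁶/(xy²)`. -/
theorem neg_div_add_neg_div_eq {M : Type*} [Field M] {x y z : M} (hx : x ≠ 0) (hy : y ≠ 0)
    (h : x ^ 2 + y ^ 3 + z ^ 5 = 0) :
    -(x * z) / y ^ 2 + -(y * z) / x = z ^ 6 / (x * y ^ 2) := by
  field_simp
  linear_combination -z * h

/-- The substitution `s = -xz/y²`, `t = -yz/x`, `s + t = z⁶/(xy²)` inverts the
parametrization of the surface `x² + y³ + z⁵ = 0`. -/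
theorem parametrization_inverse {M : Type*} [Field M] {x y z : M} (hx : x ≠ 0) (hy : y ≠ 0)
    (hz : z ≠ 0) :
    ![(-(x * z) / y ^ 2) ^ 8 * (-(y * z) / x) ^ 10 / (z ^ 6 / (x * y ^ 2)) ^ 3,
      (-(x * z) / y ^ 2) ^ 5 * (-(y * z) / x) ^ 7 / (z ^ 6 / (x * y ^ 2)) ^ 2,
      -((-(x * z) / y ^ 2) ^ 3 * (-(y * z) / x) ^ 4) / (z ^ 6 / (x * y ^ 2))] = ![x, y, z] := by
  congr 1
  · field_simp
  congr 1
  · field_simp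
  congr 1
  field_simp

/-- Evaluation at `(s⁸t¹⁰/(s+t)³, s⁵t⁷/(s+t)², -s³t⁴/(s+t))` factors through any algebra in which
`s + t` is invertible. -/
theorem map_aeval_eq_aeval_div {K B N : Type*} [Field K] [CommRing B] [Algebra K B] [Field N]
    [Algebra K N] (g : B →ₐ[K] N) {σ τ ι : B} (hι : (σ + τ) * ι = 1)
    (f : MvPolynomial (Fin 3) K) :
    g (aeval ![σ ^ 8 * τ ^ 10 * ι ^ 3, σ ^ 5 * τ ^ 7 * ι ^ 2, -(σ ^ 3 * τ ^ 4) * ι] f) =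
      aeval ![g σ ^ 8 * g τ ^ 10 / (g σ + g τ) ^ 3, g σ ^ 5 * g τ ^ 7 / (g σ + g τ) ^ 2,
        -(g σ ^ 3 * g τ ^ 4) / (g σ + g τ)] f := by
  have h : g ι = (g σ + g τ)⁻¹ :=
    eq_inv_of_mul_eq_one_right (by rw [← map_add, ← map_mul, hι, map_one])
  rw [← AlgHom.comp_apply, comp_aeval]
  congr 2
  funext i
  fin_cases i <;> simp [h, div_eq_mul_inv]

/-- A homomorphism to a field that does not kill `w` sends powers of `w` to units. -/
theorem isUnit_map_powers {P N F : Type*} [CommRing P] [Field N] [FunLike F P N]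
    [MonoidHomClass F P N] (φ : F) {w : P} (h : φ w ≠ 0) (y : Submonoid.powers w) :
    IsUnit (φ y) := by
  obtain ⟨_, n, rfl⟩ := y
  simpa using (pow_ne_zero n h).isUnit

/-- An algebraic relation between the rational functions `s⁸t¹⁰/(s+t)³`, `s⁵t⁷/(s+t)²`,
`-s³t⁴/(s+t)` holds at every point, over any field extension, where `s + t` does not vanish. -/
theorem aeval_eq_zero_of_aeval_fraction_eq_zero {K L M : Type*} [Field K] [Field L] [Field M]
    [Algebra K L] [Algebra K M] [Algebra (MvPolynomial (Fin 2) K) L]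
    [IsScalarTower K (MvPolynomial (Fin 2) K) L] [IsFractionRing (MvPolynomial (Fin 2) K) L]
    {s t : L} (hs : s = algebraMap (MvPolynomial (Fin 2) K) L (X 0))
    (ht : t = algebraMap (MvPolynomial (Fin 2) K) L (X 1)) (hst : s + t ≠ 0)
    {a b : M} (hab : a + b ≠ 0) {f : MvPolynomial (Fin 3) K}
    (hf : aeval ![s ^ 8 * t ^ 10 / (s + t) ^ 3, s ^ 5 * t ^ 7 / (s + t) ^ 2,
      -(s ^ 3 * t ^ 4) / (s + t)] f = 0) :
    aeval ![a ^ 8 * b ^ 10 / (a + b) ^ 3, a ^ 5 * b ^ 7 / (a + b) ^ 2,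
      -(a ^ 3 * b ^ 4) / (a + b)] f = 0 := by
  let P := MvPolynomial (Fin 2) K
  let w : P := X 0 + X 1
  let B := Localization.Away w
  have hι : (algebraMap P B (X 0) + algebraMap P B (X 1)) * IsLocalization.Away.invSelf w = 1 := by
    simpa [w, map_add] using IsLocalization.Away.mul_invSelf (S := B) w
  have hL : IsScalarTower.toAlgHom K P L w ≠ 0 := by
    simpa [w, hs, ht] using hst
  have hM : aeval ![a, b] w ≠ 0 := by simpa [w] using hab
  let gL : B →ₐ[K] L := IsLocalization.liftAlgHom (M := Submonoid.powers w)
    (f := IsScalarTower.toAlgHom K P L) (isUnit_map_powers _ hL)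
  let gM : B →ₐ[K] M := IsLocalization.liftAlgHom (M := Submonoid.powers w)
    (f := aeval ![a, b]) (isUnit_map_powers _ hM)
  have hgL (p : P) : gL (algebraMap P B p) = algebraMap P L p := IsLocalization.lift_eq _ p
  have hgM (p : P) : gM (algebraMap P B p) = aeval ![a, b] p := IsLocalization.lift_eq _ p
  have hinj : Function.Injective gL := by
    refine (IsLocalization.lift_injective_iff (M := Submonoid.powers w) _).2 fun x y => ?_
    refine ⟨fun h => ?_, fun h => congrArg _ (IsFractionRing.injective P L h)⟩
    simpa [hgL] using congrArg gL h
  have eL := map_aeval_eq_aeval_div gL hι f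
  have eM := map_aeval_eq_aeval_div gM hι f
  rw [hgL, hgL, ← hs, ← ht, hf] at eL
  rw [(map_eq_zero_iff gL hinj).1 eL, map_zero, hgM, hgM, aeval_X, aeval_X] at eM
  exact eM.symm

/-- A polynomial vanishing at the three given rational functions is a multiple of
`X² + Y³ + Z⁵`: on the surface, `s = -XZ/Y²` and `t = -YZ/X` invert the parametrization. -/
theorem sq_add_cube_add_pow_five_dvd_of_aeval_eq_zero {K L : Type*} [Field K] [Field L]
    [Algebra K L] [Algebra (MvPolynomial (Fin 2) K) L]
    [IsScalarTower K (MvPolynomial (Fin 2) K) L] [IsFractionRing (MvPolynomial (Fin 2) K) L]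
    {s t : L} (hs : s = algebraMap (MvPolynomial (Fin 2) K) L (X 0))
    (ht : t = algebraMap (MvPolynomial (Fin 2) K) L (X 1)) (hst : s + t ≠ 0)
    {f : MvPolynomial (Fin 3) K}
    (hf : aeval ![s ^ 8 * t ^ 10 / (s + t) ^ 3, s ^ 5 * t ^ 7 / (s + t) ^ 2,
      -(s ^ 3 * t ^ 4) / (s + t)] f = 0) :
    (X 0 ^ 2 + X 1 ^ 3 + X 2 ^ 5 : MvPolynomial (Fin 3) K) ∣ f := by
  set F : MvPolynomial (Fin 3) K := X 0 ^ 2 + X 1 ^ 3 + X 2 ^ 5 with hF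
  have hprime : Prime F := prime_sq_add_cube_add_pow_five K
  have : (Ideal.span {F}).IsPrime := (Ideal.span_singleton_prime hprime.ne_zero).2 hprime
  let A := MvPolynomial (Fin 3) K ⧸ Ideal.span {F}
  let M := FractionRing A
  let π : MvPolynomial (Fin 3) K →ₐ[K] M :=
    (IsScalarTower.toAlgHom K A M).comp (Ideal.Quotient.mkₐ K (Ideal.span {F}))
  have hπ (p : MvPolynomial (Fin 3) K) : π p = 0 ↔ F ∣ p := by
    rw [← Ideal.mem_span_singleton, ← Ideal.Quotient.eq_zero_iff_mem]
    exact map_eq_zero_iff _ (IsFractionRing.injective A M)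
  have hne (i : Fin 3) (v : Fin 3 → K) (hv : eval v F = 0) (hi : v i ≠ 0) : π (X i) ≠ 0 := by
    rw [Ne, hπ]
    rintro ⟨q, hq⟩
    exact hi (by simpa [hv] using congrArg (eval v) hq)
  have hx : π (X 0) ≠ 0 := hne 0 ![1, -1, 0] (by simp [hF]; ring) (by simp)
  have hy : π (X 1) ≠ 0 := hne 1 ![1, -1, 0] (by simp [hF]; ring) (by simp)
  have hz : π (X 2) ≠ 0 := hne 2 ![1, 0, -1] (by simp [hF]; ring) (by simp)
  have hrel : π (X 0) ^ 2 + π (X 1) ^ 3 + π (X 2) ^ 5 = 0 := by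
    simpa [hF] using (hπ F).2 dvd_rfl
  have hsum := neg_div_add_neg_div_eq hx hy hrel
  have hsum_ne : -(π (X 0) * π (X 2)) / π (X 1) ^ 2 + -(π (X 1) * π (X 2)) / π (X 0) ≠ 0 := by
    rw [hsum]
    positivity
  have h := aeval_eq_zero_of_aeval_fraction_eq_zero hs ht hst hsum_ne hf
  rw [hsum, parametrization_inverse hx hy hz] at h
  rw [← hπ, aeval_unique π, ← h]
  congr 2
  funext i
  fin_cases i <;> rfl

/-- Let `K` be a field, `K[s,t]` a polynomial ring in two variables with
fraction field `L`, and `ψ : K[X,Y,Z] → L` the `K`-algebra map sending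
`X, Y, Z` to `s⁸t¹⁰/(s+t)³, s⁵t⁷/(s+t)², −s³t⁴/(s+t)`.  Then
`ker ψ = (X² + Y³ + Z⁵)`; in particular `ψ(X)² + ψ(Y)³ + ψ(Z)⁵ = 0`, and
`K[X,Y,Z]/(X² + Y³ + Z⁵)` is isomorphic as a `K`-algebra to the subring of `L`
generated by these three elements. -/
theorem stmt_7 (K : Type*) [Field K]
    (L : Type*) [Field L] [Algebra K L]
    [Algebra (MvPolynomial (Fin 2) K) L]
    [IsScalarTower K (MvPolynomial (Fin 2) K) L]
    [IsFractionRing (MvPolynomial (Fin 2) K) L]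
    (s t : L)
    (hs : s = algebraMap (MvPolynomial (Fin 2) K) L (X 0))
    (ht : t = algebraMap (MvPolynomial (Fin 2) K) L (X 1))
    (ψ : MvPolynomial (Fin 3) K →ₐ[K] L)
    (hψ : ψ = aeval ![s ^ 8 * t ^ 10 / (s + t) ^ 3, s ^ 5 * t ^ 7 / (s + t) ^ 2,
      -(s ^ 3 * t ^ 4) / (s + t)]) :
    RingHom.ker ψ = Ideal.span {X 0 ^ 2 + X 1 ^ 3 + X 2 ^ 5} ∧
    (s ^ 8 * t ^ 10 / (s + t) ^ 3) ^ 2 + (s ^ 5 * t ^ 7 / (s + t) ^ 2) ^ 3 +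
      (-(s ^ 3 * t ^ 4) / (s + t)) ^ 5 = 0 ∧
    Nonempty ((MvPolynomial (Fin 3) K ⧸ Ideal.span
        ({X 0 ^ 2 + X 1 ^ 3 + X 2 ^ 5} : Set (MvPolynomial (Fin 3) K))) ≃ₐ[K]
      Algebra.adjoin K ({s ^ 8 * t ^ 10 / (s + t) ^ 3, s ^ 5 * t ^ 7 / (s + t) ^ 2,
        -(s ^ 3 * t ^ 4) / (s + t)} : Set L)) := by
  have hs0 : s + t ≠ 0 := by
    rw [hs, ht, ← map_add, Ne, map_eq_zero_iff _ (IsFractionRing.injective _ L)]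
    intro h
    simpa using congrArg (eval ![(1 : K), 0]) h
  have hrel : (s ^ 8 * t ^ 10 / (s + t) ^ 3) ^ 2 + (s ^ 5 * t ^ 7 / (s + t) ^ 2) ^ 3 +
      (-(s ^ 3 * t ^ 4) / (s + t)) ^ 5 = 0 := by
    field_simp
    ring
  have hker : RingHom.ker ψ = Ideal.span {X 0 ^ 2 + X 1 ^ 3 + X 2 ^ 5} := by
    apply le_antisymm
    · intro f hf
      rw [RingHom.mem_ker, hψ] at hf
      exact Ideal.mem_span_singleton.2
        (sq_add_cube_add_pow_five_dvd_of_aeval_eq_zero hs ht hs0 hf)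
    · rw [Ideal.span_singleton_le_iff_mem, RingHom.mem_ker, hψ]
      simpa using hrel
  refine ⟨hker, hrel, ⟨?_⟩⟩
  have hrange : ψ.range = Algebra.adjoin K ({s ^ 8 * t ^ 10 / (s + t) ^ 3,
      s ^ 5 * t ^ 7 / (s + t) ^ 2, -(s ^ 3 * t ^ 4) / (s + t)} : Set L) := by
    rw [hψ, ← Algebra.adjoin_range_eq_range_aeval]
    simp [Set.insert_comm, Set.pair_comm]
  exact (Ideal.quotientEquivAlgOfEq K hker.symm).trans
    ((Ideal.quotientKerEquivRange ψ).trans (Subalgebra.equivOfEq _ _ hrange))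
end

section
/- Let K be a field, let K[s, t] be a polynomial ring in two variables, and let L be its field of fractions. Let φ : K[A, B, C, T] → L be the K-algebra homomorphism determined by φ(A) = t³/s, φ(B) = st², φ(C) = st⁵/(s+t), and φ(T) = t. Then the kernel of φ is exactly the ideal generated by AB − T⁵, BC + CT³ − BT⁵, and AC + CT² − ABT². -/
open MvPolynomial

/-- The value at `u / v` of a polynomial `p`, multiplied by `v ^ p.natDegree`. -/
noncomputable def homogenizedEval {D R : Type*} [CommRing D] [CommRing R] (h : D →+* R)
    (u v : R) (p : Polynomial D) : R :=
  ∑ i ∈ Finset.range (p.natDegree + 1), h (p.coeff i) * u ^ i * v ^ (p.natDegree - i)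

theorem map_homogenizedEval {D R L : Type*} [CommRing D] [CommRing R] [Field L] (h : D →+* R)
    (g : R →+* L) (u v : R) (hv : g v ≠ 0) (p : Polynomial D) :
    g (homogenizedEval h u v p) =
      p.eval₂ (g.comp h) (g u / g v) * g v ^ p.natDegree := by
  rw [Polynomial.eval₂_eq_sum_range, Finset.sum_mul, homogenizedEval, map_sum]
  refine Finset.sum_congr rfl fun i hi => ?_
  have hi' : i ≤ p.natDegree := Nat.lt_succ_iff.mp (Finset.mem_range.mp hi)
  obtain ⟨k, hk⟩ := Nat.exists_eq_add_of_le hi'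
  rw [hk, Nat.add_sub_cancel_left, pow_add]
  simp only [map_mul, map_pow, RingHom.comp_apply, div_pow]
  field_simp

theorem homogenizedEval_of_map_eq_zero {D R E : Type*} [CommRing D] [CommRing R] [CommRing E]
    (h : D →+* R) (e : R →+* E) (u v : R) (hv : e v = 0) (p : Polynomial D) :
    e (homogenizedEval h u v p) = e (h p.leadingCoeff) * e u ^ p.natDegree := by
  rw [homogenizedEval, map_sum, Finset.sum_range_succ, Finset.sum_eq_zero]
  · simp
  · intro i hi
    have : p.natDegree - i ≠ 0 := Nat.sub_ne_zero_of_lt (Finset.mem_range.mp hi)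
    simp [hv, this]

/-- If `u / v` has a pole along the prime `ker e` and `p (u / v)` does not, then `p` is constant. -/
theorem natDegree_eq_zero_of_regular {D R E L : Type*} [CommRing D] [CommRing R] [CommRing E]
    [IsDomain E] [Field L] (h : D →+* R) (g : R →+* L) (hg : Function.Injective g) (e : R →+* E)
    (heh : Function.Injective (e.comp h)) {u v w y : R} (hu : e u ≠ 0) (hv : e v = 0)
    (hv0 : g v ≠ 0) (hw : e w ≠ 0) (p : Polynomial D)
    (hp : p.eval₂ (g.comp h) (g u / g v) * g w = g y) : p.natDegree = 0 := by
  by_contra hn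
  have key : homogenizedEval h u v p * w = y * v ^ p.natDegree := by
    apply hg
    rw [map_mul, map_homogenizedEval h g u v hv0, map_mul, ← hp, map_pow]
    ring
  have := congrArg e key
  rw [map_mul, homogenizedEval_of_map_eq_zero h e u v hv, map_mul, map_pow, hv, zero_pow hn,
    mul_zero] at this
  have hlead : e (h p.leadingCoeff) = 0 := by
    simpa [hw, hu] using this
  have : p.leadingCoeff = 0 := heh (by simpa using hlead)
  rw [Polynomial.leadingCoeff_eq_zero] at this
  simp [this] at hn

section NormalForm

variable {D Q : Type*} [CommRing D] [CommRing Q] [Algebra D Q]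

/-- The sums of a polynomial in `a`, a polynomial in `b` and a polynomial in `c`. -/
noncomputable def separatedSums (D : Type*) {Q : Type*} [CommRing D] [CommRing Q] [Algebra D Q]
    (a b c : Q) : Submodule D Q :=
  Submodule.span D (Set.range (a ^ · : ℕ → Q) ∪ Set.range (b ^ · : ℕ → Q) ∪
    Set.range (c ^ · : ℕ → Q))

theorem exists_aeval_of_mem_separatedSums {a b c x : Q} (hx : x ∈ separatedSums D a b c) :
    ∃ p q r : Polynomial D,
      x = Polynomial.aeval a p + Polynomial.aeval b q + Polynomial.aeval c r := by
  induction hx using Submodule.span_induction with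
  | mem x hx =>
    rcases hx with (⟨n, rfl⟩ | ⟨n, rfl⟩) | ⟨n, rfl⟩
    · exact ⟨Polynomial.X ^ n, 0, 0, by simp⟩
    · exact ⟨0, Polynomial.X ^ n, 0, by simp⟩
    · exact ⟨0, 0, Polynomial.X ^ n, by simp⟩
  | zero => exact ⟨0, 0, 0, by simp⟩
  | add x y _ _ hx hy =>
    obtain ⟨p, q, r, rfl⟩ := hx
    obtain ⟨p', q', r', rfl⟩ := hy
    exact ⟨p + p', q + q', r + r', by simp only [map_add]; ring⟩
  | smul d x _ hx =>
    obtain ⟨p, q, r, rfl⟩ := hx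
    exact ⟨d • p, d • q, d • r, by simp only [map_smul, smul_add]⟩

theorem mul_mem_separatedSums {a b c y : Q}
    (ha : ∀ n : ℕ, y * a ^ n ∈ separatedSums D a b c)
    (hb : ∀ n : ℕ, y * b ^ n ∈ separatedSums D a b c)
    (hc : ∀ n : ℕ, y * c ^ n ∈ separatedSums D a b c) {x : Q}
    (hx : x ∈ separatedSums D a b c) : y * x ∈ separatedSums D a b c := by
  induction hx using Submodule.span_induction with
  | mem x hx =>
    rcases hx with (⟨n, rfl⟩ | ⟨n, rfl⟩) | ⟨n, rfl⟩
    exacts [ha n, hb n, hc n]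
  | zero => simp
  | add x y _ _ hx hy => rw [mul_add]; exact add_mem hx hy
  | smul d x _ hx => rw [mul_smul_comm]; exact Submodule.smul_mem _ d hx

theorem pow_left_mem_separatedSums (a b c : Q) (n : ℕ) : a ^ n ∈ separatedSums D a b c :=
  Submodule.subset_span (Or.inl (Or.inl ⟨n, rfl⟩))

theorem pow_mid_mem_separatedSums (a b c : Q) (n : ℕ) : b ^ n ∈ separatedSums D a b c :=
  Submodule.subset_span (Or.inl (Or.inr ⟨n, rfl⟩))

theorem pow_right_mem_separatedSums (a b c : Q) (n : ℕ) : c ^ n ∈ separatedSums D a b c :=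
  Submodule.subset_span (Or.inr ⟨n, rfl⟩)

/-- Straightening relations expressing the pairwise products of `a`, `b`, `c` make the separated
sums stable under multiplication by `a`, `b` and `c`. -/
theorem mul_mem_separatedSums_of_relations {a b c : Q} {k l m n o : D}
    (hab : a * b = algebraMap D Q k) (hbc : b * c = l • b + m • c)
    (hac : a * c = algebraMap D Q n + o • c) {x : Q} (hx : x ∈ separatedSums D a b c) :
    a * x ∈ separatedSums D a b c ∧ b * x ∈ separatedSums D a b c ∧
      c * x ∈ separatedSums D a b c := by
  have pa := pow_left_mem_separatedSums (D := D) a b c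
  have pb := pow_mid_mem_separatedSums (D := D) a b c
  have pc := pow_right_mem_separatedSums (D := D) a b c
  have sm (d : D) {z : Q} (hz : z ∈ separatedSums D a b c) :
      algebraMap D Q d * z ∈ separatedSums D a b c := by
    rw [← Algebra.smul_def]; exact Submodule.smul_mem _ d hz
  simp only [Algebra.smul_def] at hbc hac
  refine ⟨mul_mem_separatedSums ?_ ?_ ?_ hx, mul_mem_separatedSums ?_ ?_ ?_ hx,
    mul_mem_separatedSums ?_ ?_ ?_ hx⟩
  · intro i
    rw [← pow_succ']
    exact pa _
  · rintro (_ | i)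
    · simpa using pa 1
    · rw [show a * b ^ (i + 1) = algebraMap D Q k * b ^ i by rw [← hab]; ring]
      exact sm _ (pb i)
  · rintro (_ | i)
    · simpa using pa 1
    · rw [show a * c ^ (i + 1) = algebraMap D Q n * c ^ i + algebraMap D Q o * c ^ (i + 1) by
        linear_combination c ^ i * hac]
      exact add_mem (sm _ (pc _)) (sm _ (pc _))
  · rintro (_ | i)
    · simpa using pb 1
    · rw [show b * a ^ (i + 1) = algebraMap D Q k * a ^ i by rw [← hab]; ring]
      exact sm _ (pa i)
  · intro i
    rw [← pow_succ']
    exact pb _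
  · intro i
    induction i with
    | zero => simpa using pb 1
    | succ i ih =>
      rw [show b * c ^ (i + 1) = algebraMap D Q l * (b * c ^ i) + algebraMap D Q m * c ^ (i + 1) by
        linear_combination c ^ i * hbc]
      exact add_mem (sm _ ih) (sm _ (pc _))
  · intro i
    induction i with
    | zero => simpa using pc 1
    | succ i ih =>
      rw [show c * a ^ (i + 1) = algebraMap D Q n * a ^ i + algebraMap D Q o * (c * a ^ i) by
        linear_combination a ^ i * hac]
      exact add_mem (sm _ (pa _)) (sm _ ih)
  · intro i
    induction i with
    | zero => simpa using pc 1
    | succ i ih =>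
      rw [show c * b ^ (i + 1) = algebraMap D Q l * b ^ (i + 1) + algebraMap D Q m * (c * b ^ i) by
        linear_combination b ^ i * hbc]
      exact add_mem (sm _ (pb _)) (sm _ ih)
  · intro i
    rw [← pow_succ']
    exact pc _

end NormalForm

/-- Partial fractions: polynomials over `K[t]` in `t³/s`, `st²` and `st⁵/(s+t)` are linearly
independent up to constants. -/
theorem partialFractions_eq_zero {K L : Type*} [Field K] [Field L]
    (g : MvPolynomial (Fin 2) K →+* L) (hg : Function.Injective g)
    (p q r : Polynomial (Polynomial K))
    (h : Polynomial K →+* MvPolynomial (Fin 2) K)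
    (hh : h = (Polynomial.aeval (X 1) : Polynomial K →ₐ[K] MvPolynomial (Fin 2) K).toRingHom)
    (hpqr : p.eval₂ (g.comp h) (g (X 1) ^ 3 / g (X 0)) +
      q.eval₂ (g.comp h) (g (X 0) * g (X 1) ^ 2) +
      r.eval₂ (g.comp h) (g (X 0) * g (X 1) ^ 5 / (g (X 0) + g (X 1))) = 0) :
    ∃ c d : Polynomial K, p = Polynomial.C c ∧ r = Polynomial.C d ∧
      q = Polynomial.C (-(c + d)) := by
  let e (z : Polynomial K) : MvPolynomial (Fin 2) K →ₐ[K] Polynomial K :=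
    aeval ![z, Polynomial.X]
  have he (z : Polynomial K) : Function.Injective ((e z).toRingHom.comp h) := by
    have : ((e z).comp (Polynomial.aeval (X 1))) = AlgHom.id K (Polynomial K) := by
      ext; simp [e]
    intro x y hxy
    simpa [hh] using (DFunLike.congr_fun this x).symm.trans
      ((by simpa [hh] using hxy : _ = _).trans (DFunLike.congr_fun this y))
  have hs : g (X 0) ≠ 0 := by
    rw [Ne, map_eq_zero_iff g hg]; exact X_ne_zero 0
  have hst : g (X 0 + X 1) ≠ 0 := by
    rw [Ne, map_eq_zero_iff g hg]
    intro h0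
    simpa [e] using congrArg (e 0) h0
  have hq : q.eval₂ (g.comp h) (g (X 0) * g (X 1) ^ 2) = g (q.eval₂ h (X 0 * X 1 ^ 2)) := by
    rw [Polynomial.hom_eval₂]; simp
  rw [← map_pow, ← map_pow g _ 5, ← map_mul, ← map_add, hq] at hpqr
  have hr : r.natDegree = 0 := by
    refine natDegree_eq_zero_of_regular h g hg (e (-Polynomial.X)).toRingHom (he _)
      (u := X 0 * X 1 ^ 5)
      (w := X 0 ^ p.natDegree) (y := -(homogenizedEval h (X 1 ^ 3) (X 0) p +
        q.eval₂ h (X 0 * X 1 ^ 2) * X 0 ^ p.natDegree)) ?_ ?_ hst ?_ r ?_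
    · simp [e]
    · simp [e]
    · simp [e]
    · rw [map_neg, map_add g (homogenizedEval _ _ _ _), map_homogenizedEval h g _ _ hs,
        map_mul g (q.eval₂ _ _), map_pow g (X 0)]
      linear_combination g (X 0) ^ p.natDegree * hpqr
  obtain ⟨d, rfl⟩ := Polynomial.natDegree_eq_zero.mp hr
  rw [Polynomial.eval₂_C, RingHom.comp_apply] at hpqr
  have hp : p.natDegree = 0 := by
    refine natDegree_eq_zero_of_regular h g hg (e 0).toRingHom (he _)
      (u := X 1 ^ 3) (w := 1) (y := -(q.eval₂ h (X 0 * X 1 ^ 2) + h d)) ?_ ?_ hs ?_ p ?_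
    · simp [e]
    · simp [e]
    · simp
    · rw [map_neg, map_add, map_one]
      linear_combination hpqr
  obtain ⟨c, rfl⟩ := Polynomial.natDegree_eq_zero.mp hp
  refine ⟨c, d, rfl, rfl, ?_⟩
  rw [Polynomial.eval₂_C, RingHom.comp_apply, ← map_add, ← map_add, map_eq_zero_iff g hg] at hpqr
  let f : MvPolynomial (Fin 2) K →ₐ[K] Polynomial (Polynomial K) :=
    aeval ![Polynomial.X, Polynomial.C Polynomial.X]
  have hf : f.toRingHom.comp h = Polynomial.C := by
    ext <;> simp [f, hh]
  have hcomp : (q + Polynomial.C (c + d)).comp (Polynomial.C (Polynomial.X ^ 2) * Polynomial.X)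
      = 0 := by
    have := congrArg f.toRingHom hpqr
    rw [map_add, map_add, Polynomial.hom_eval₂, ← RingHom.comp_apply, ← RingHom.comp_apply,
      hf, map_zero] at this
    rw [← this, Polynomial.comp, Polynomial.eval₂_add, Polynomial.eval₂_C]
    simp [f, mul_comm]
    ring
  rw [Polynomial.comp_C_mul_X_eq_zero_iff (by simp)] at hcomp
  rw [map_neg]
  exact eq_neg_of_add_eq_zero_left hcomp

/-- Let `K` be a field, `K[s,t]` a polynomial ring in two variables with
fraction field `L`, and `φ : K[A,B,C,T] → L` the `K`-algebra map sending
`A, B, C, T` to `t³/s, st², st⁵/(s+t), t`.  Then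
`ker φ = (AB − T⁵, BC + CT³ − BT⁵, AC + CT² − ABT²)`. -/
theorem stmt_8 (K : Type*) [Field K]
    (L : Type*) [Field L] [Algebra K L]
    [Algebra (MvPolynomial (Fin 2) K) L]
    [IsScalarTower K (MvPolynomial (Fin 2) K) L]
    [IsFractionRing (MvPolynomial (Fin 2) K) L]
    (s t : L)
    (hs : s = algebraMap (MvPolynomial (Fin 2) K) L (X 0))
    (ht : t = algebraMap (MvPolynomial (Fin 2) K) L (X 1))
    (φ : MvPolynomial (Fin 4) K →ₐ[K] L)
    (hφ : φ = aeval ![t ^ 3 / s, s * t ^ 2, s * t ^ 5 / (s + t), t]) :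
    RingHom.ker φ = Ideal.span
      {X 0 * X 1 - X 3 ^ 5,
        X 1 * X 2 + X 2 * X 3 ^ 3 - X 1 * X 3 ^ 5,
        X 0 * X 2 + X 2 * X 3 ^ 2 - X 0 * X 1 * X 3 ^ 2} := by
  subst hs ht hφ
  set g := algebraMap (MvPolynomial (Fin 2) K) L with hg
  have ginj : Function.Injective g := IsFractionRing.injective _ _
  have hs : g (X 0) ≠ 0 := by
    rw [Ne, map_eq_zero_iff g ginj]; exact X_ne_zero 0
  have hst : g (X 0) + g (X 1) ≠ 0 := by
    rw [← map_add, Ne, map_eq_zero_iff g ginj]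
    intro h0
    simpa using congrArg (aeval ![(0 : K), 1]) h0
  set φ : MvPolynomial (Fin 4) K →ₐ[K] L := aeval ![g (X 1) ^ 3 / g (X 0), g (X 0) * g (X 1) ^ 2,
    g (X 0) * g (X 1) ^ 5 / (g (X 0) + g (X 1)), g (X 1)] with hφ
  have φ0 : φ (X 0) = g (X 1) ^ 3 / g (X 0) := by simp [hφ]
  have φ1 : φ (X 1) = g (X 0) * g (X 1) ^ 2 := by simp [hφ]
  have φ2 : φ (X 2) = g (X 0) * g (X 1) ^ 5 / (g (X 0) + g (X 1)) := by simp [hφ]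
  have φ3 : φ (X 3) = g (X 1) := by simp [hφ]
  set I : Ideal (MvPolynomial (Fin 4) K) := Ideal.span
      {X 0 * X 1 - X 3 ^ 5,
        X 1 * X 2 + X 2 * X 3 ^ 3 - X 1 * X 3 ^ 5,
        X 0 * X 2 + X 2 * X 3 ^ 2 - X 0 * X 1 * X 3 ^ 2} with hI
  have hle : I ≤ RingHom.ker φ := by
    rw [hI, Ideal.span_le]
    rintro x (rfl | rfl | rfl) <;>
    · simp only [SetLike.mem_coe, RingHom.mem_ker, map_sub, map_add, map_mul, map_pow,
        φ0, φ1, φ2, φ3]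
      field_simp
      ring
  refine le_antisymm (fun x hx => ?_) hle
  let π := Ideal.Quotient.mk I
  have r1 : π (X 0) * π (X 1) = π (X 3) ^ 5 := by
    simp only [← map_mul, ← map_pow]
    exact Ideal.Quotient.eq.mpr (Ideal.subset_span (by simp))
  have r2 : π (X 1) * π (X 2) + π (X 2) * π (X 3) ^ 3 = π (X 1) * π (X 3) ^ 5 := by
    simp only [← map_mul, ← map_pow, ← map_add]
    exact Ideal.Quotient.eq.mpr (Ideal.subset_span (by simp))
  have r3 : π (X 0) * π (X 2) + π (X 2) * π (X 3) ^ 2 = π (X 0) * π (X 1) * π (X 3) ^ 2 := by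
    simp only [← map_mul, ← map_pow, ← map_add]
    exact Ideal.Quotient.eq.mpr (Ideal.subset_span (by simp))
  let ι : Polynomial K →+* MvPolynomial (Fin 4) K :=
    (Polynomial.aeval (X 3) : Polynomial K →ₐ[K] MvPolynomial (Fin 4) K).toRingHom
  let _ : Algebra (Polynomial K) (MvPolynomial (Fin 4) K ⧸ I) := (π.comp ι).toAlgebra
  have hmap (f : Polynomial K) : algebraMap (Polynomial K) (MvPolynomial (Fin 4) K ⧸ I) f =
      π (ι f) := rfl
  have hιX : ι Polynomial.X = X 3 := by simp [ι]
  have hmem : π x ∈ separatedSums (Polynomial K) (π (X 0)) (π (X 1)) (π (X 2)) := by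
    clear hx
    induction x using MvPolynomial.induction_on with
    | C k =>
      have hk : π (C k) = (Polynomial.C k : Polynomial K) • π (X 0) ^ 0 := by
        rw [Algebra.smul_def, hmap]; simp [ι, MvPolynomial.algebraMap_eq]
      rw [hk]
      exact Submodule.smul_mem _ _ (pow_left_mem_separatedSums _ _ _ 0)
    | add x y hx hy => rw [map_add]; exact add_mem hx hy
    | mul_X x i hx =>
      rw [map_mul, mul_comm]
      have hmul := mul_mem_separatedSums_of_relations
        (k := Polynomial.X ^ 5) (l := Polynomial.X ^ 5) (m := -Polynomial.X ^ 3)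
        (n := Polynomial.X ^ 7) (o := -Polynomial.X ^ 2)
        (by rw [hmap, map_pow, hιX, map_pow, r1])
        (by
          simp only [Algebra.smul_def, hmap, map_neg, map_pow, hιX]
          linear_combination r2)
        (by
          simp only [Algebra.smul_def, hmap, map_neg, map_pow, hιX]
          linear_combination r3 + π (X 3) ^ 2 * r1) hx
      fin_cases i
      · exact hmul.1
      · exact hmul.2.1
      · exact hmul.2.2
      · have := Submodule.smul_mem _ (Polynomial.X : Polynomial K) hx
        rwa [Algebra.smul_def, hmap, hιX] at this
  obtain ⟨p, q, r, hpqr⟩ := exists_aeval_of_mem_separatedSums hmem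
  let ψ : MvPolynomial (Fin 4) K ⧸ I →+* L := Ideal.Quotient.lift I φ.toRingHom hle
  have hψ (y : MvPolynomial (Fin 4) K) : ψ (π y) = φ y := Ideal.Quotient.lift_mk _ _ _
  let h : Polynomial K →+* MvPolynomial (Fin 2) K :=
    (Polynomial.aeval (X 1) : Polynomial K →ₐ[K] MvPolynomial (Fin 2) K).toRingHom
  have hψh : ψ.comp (algebraMap (Polynomial K) (MvPolynomial (Fin 4) K ⧸ I)) = g.comp h := by
    refine Polynomial.ringHom_ext (fun k => ?_) ?_
    · rw [RingHom.comp_apply, hmap, hψ]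
      simp [ι, h, g, IsScalarTower.algebraMap_apply K (MvPolynomial (Fin 2) K) L,
        MvPolynomial.algebraMap_eq]
    · rw [RingHom.comp_apply, hmap, hψ, hιX, φ3]
      simp [h]
  have h0 := congrArg ψ hpqr
  rw [hψ, show φ x = 0 from hx, map_add, map_add] at h0
  simp only [Polynomial.aeval_def, Polynomial.hom_eval₂, hψh, hψ, φ0, φ1, φ2] at h0
  obtain ⟨c, d, rfl, rfl, rfl⟩ := partialFractions_eq_zero g ginj p q r h rfl h0.symm
  refine Ideal.Quotient.eq_zero_iff_mem.mp (hpqr.trans ?_)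
  simp only [Polynomial.aeval_C, map_neg, map_add]
  ring
end

section
/- Let K be a field of prime characteristic p and let S = K[A, B, C, T]/(AB − T⁵, BC + CT³ − BT⁵, AC + CT² − ABT²), with a, b, c, t denoting the images of A, B, C, T. Let h = a¹⁵ + b¹⁰ + c⁶. Then the ideal (t, h) of S is Frobenius closed: for every u ∈ S and every e ≥ 0, if u^{p^e} lies in the ideal (t^{p^e}, h^{p^e}) of S, then u lies in the ideal (t, h) of S. -/
open MvPolynomial

/-- Restriction of a polynomial to the `i`-th coordinate axis. -/
noncomputable def axisRestrict {σ : Type*} [DecidableEq σ] (K : Type*) [CommRing K] (i : σ) :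
    MvPolynomial σ K →ₐ[K] Polynomial K :=
  aeval (Pi.single i Polynomial.X)

theorem axisRestrict_X {σ : Type*} [DecidableEq σ] (K : Type*) [CommRing K] (i j : σ) :
    axisRestrict K i (X j) = if j = i then Polynomial.X else 0 := by
  simp [axisRestrict, Pi.single_apply]

theorem axisRestrict_X_mul_X {σ : Type*} [DecidableEq σ] (K : Type*) [CommRing K] (i : σ)
    {j k : σ} (hjk : j ≠ k) : axisRestrict K i (X j) * axisRestrict K i (X k) = 0 := by
  rw [axisRestrict_X, axisRestrict_X]
  split_ifs with hj hk
  · exact absurd (hj.trans hk.symm) hjk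
  all_goals simp

theorem coeff_zero_axisRestrict {σ : Type*} [DecidableEq σ] {K : Type*} [CommRing K] (i : σ)
    (P : MvPolynomial σ K) : (axisRestrict K i P).coeff 0 = constantCoeff P := by
  induction P using MvPolynomial.induction_on with
  | C r => simp [axisRestrict]
  | add f g hf hg => simp [hf, hg]
  | mul_X f j _ =>
    rw [map_mul, Polynomial.mul_coeff_zero, axisRestrict_X]
    split_ifs <;> simp

/-- At a point whose coordinates have pairwise product zero, a polynomial is determined by its
restrictions to the coordinate axes. -/
theorem aeval_eq_sum_axisRestrict {σ : Type*} [DecidableEq σ] [Fintype σ] {K R : Type*}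
    [CommRing K] [CommRing R] [Algebra K R] (v : σ → R)
    (hv : ∀ i j, i ≠ j → v i * v j = 0) (P : MvPolynomial σ K) :
    aeval v P = algebraMap K R (constantCoeff P) +
      ∑ i, (Polynomial.aeval (v i) (axisRestrict K i P) -
        algebraMap K R (constantCoeff P)) := by
  induction P using MvPolynomial.induction_on with
  | C r => simp [axisRestrict]
  | add f g hf hg =>
    simp only [map_add, hf, hg, Finset.sum_sub_distrib, Finset.sum_add_distrib]
    ring
  | mul_X f j hf =>
    rw [map_mul, aeval_X, hf, add_mul, Finset.sum_mul, Finset.sum_eq_single j,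
      Finset.sum_eq_single j]
    · simp [axisRestrict_X]
      ring
    · intro i _ hij
      simp [axisRestrict_X, hij.symm]
    · simp
    · intro i _ hij
      obtain ⟨g, hg⟩ := Polynomial.X_dvd_sub_C (p := axisRestrict K i f)
      have := congrArg (Polynomial.aeval (v i)) hg
      rw [coeff_zero_axisRestrict, map_sub, Polynomial.aeval_C, map_mul, Polynomial.aeval_X] at this
      rw [this, mul_right_comm, hv i j hij, zero_mul]
    · simp

/-- If `g ^ q` is a multiple of `(X ^ n) ^ q`, then `g` is a multiple of `X ^ n`, and the constant
coefficients of the cofactors correspond. -/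
theorem Polynomial.exists_eq_X_pow_mul_of_pow_eq {K : Type*} [Field K] {g w : Polynomial K}
    {n q : ℕ} (hq : q ≠ 0) (hg : g ^ q = (Polynomial.X ^ n) ^ q * w) :
    ∃ f, g = Polynomial.X ^ n * f ∧ f.coeff 0 ^ q = w.coeff 0 := by
  obtain ⟨f, rfl⟩ := (IsIntegrallyClosed.pow_dvd_pow_iff hq).1 (Dvd.intro _ hg.symm)
  refine ⟨f, rfl, ?_⟩
  rw [mul_pow] at hg
  rw [← mul_left_cancel₀ (pow_ne_zero _ (pow_ne_zero _ Polynomial.X_ne_zero)) hg]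
  simp only [Polynomial.coeff_zero_eq_eval_zero, Polynomial.eval_pow]

/-- A multiple of `X ^ n` evaluated at a point `x` with `x ^ (n + 1) = 0`. -/
theorem Polynomial.aeval_X_pow_mul_of_pow_succ_eq_zero {K R : Type*} [CommRing K] [CommRing R]
    [Algebra K R] {x : R} {n : ℕ} (hx : x ^ (n + 1) = 0) (f : Polynomial K) :
    Polynomial.aeval x (Polynomial.X ^ n * f) = x ^ n * algebraMap K R (f.coeff 0) := by
  obtain ⟨g, hg⟩ := Polynomial.X_dvd_sub_C (p := f)
  rw [sub_eq_iff_eq_add.1 hg]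
  simp only [map_mul, map_pow, map_add, Polynomial.aeval_X, Polynomial.aeval_C, mul_add,
    ← mul_assoc, ← pow_succ, hx]
  simp

/-- A homomorphism killing `T`, the three relations and `A ^ 15 + B ^ 10 + C ^ 6` kills every
polynomial whose restrictions to the axes have the same leading behaviour as a scalar multiple of
`A ^ 15 + B ^ 10 + C ^ 6`. -/
theorem algHom_eq_zero_of_axisRestrict {K R : Type*} [CommRing K] [CommRing R] [Algebra K R]
    (φ : MvPolynomial (Fin 4) K →ₐ[K] R)
    (hr₁ : φ (X 0 * X 1 - X 3 ^ 5) = 0)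
    (hr₂ : φ (X 1 * X 2 + X 2 * X 3 ^ 3 - X 1 * X 3 ^ 5) = 0)
    (hr₃ : φ (X 0 * X 2 + X 2 * X 3 ^ 2 - X 0 * X 1 * X 3 ^ 2) = 0)
    (ht : φ (X 3) = 0) (hh : φ (X 0 ^ 15 + X 1 ^ 10 + X 2 ^ 6) = 0)
    {P : MvPolynomial (Fin 4) K} {f₀ f₁ f₂ : Polynomial K}
    (hf₀ : axisRestrict K 0 P = Polynomial.X ^ 15 * f₀)
    (hf₁ : axisRestrict K 1 P = Polynomial.X ^ 10 * f₁)
    (hf₂ : axisRestrict K 2 P = Polynomial.X ^ 6 * f₂)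
    (h₁ : f₁.coeff 0 = f₀.coeff 0) (h₂ : f₂.coeff 0 = f₀.coeff 0) : φ P = 0 := by
  have hP : constantCoeff P = 0 := by
    rw [← coeff_zero_axisRestrict 0, hf₀]
    simp
  have hax₃ : Polynomial.aeval (0 : R) (axisRestrict K 3 P) = 0 := by
    rw [← Polynomial.coeff_zero_eq_aeval_zero', coeff_zero_axisRestrict, hP, map_zero]
  have hφ : φ = aeval (fun i => φ (X i)) := by
    ext i
    simp
  simp only [map_sub, map_add, map_mul, map_pow, ht] at hr₁ hr₂ hr₃ hh
  have h01 : φ (X 0) * φ (X 1) = 0 := by linear_combination hr₁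
  have h12 : φ (X 1) * φ (X 2) = 0 := by linear_combination hr₂
  have h02 : φ (X 0) * φ (X 2) = 0 := by linear_combination hr₃
  have hprod : ∀ i j : Fin 4, i ≠ j → φ (X i) * φ (X j) = 0 := by
    simp only [Fin.forall_fin_succ]
    simp [ht, h01, h12, h02, mul_comm (φ (X 1)) (φ (X 0)), mul_comm (φ (X 2))]
  have hpow₀ : φ (X 0) ^ (15 + 1) = 0 := by
    linear_combination φ (X 0) * hh - φ (X 1) ^ 9 * h01 - φ (X 2) ^ 5 * h02
  have hpow₁ : φ (X 1) ^ (10 + 1) = 0 := by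
    linear_combination φ (X 1) * hh - φ (X 0) ^ 14 * h01 - φ (X 2) ^ 5 * h12
  have hpow₂ : φ (X 2) ^ (6 + 1) = 0 := by
    linear_combination φ (X 2) * hh - φ (X 0) ^ 14 * h02 - φ (X 1) ^ 9 * h12
  rw [hφ, aeval_eq_sum_axisRestrict _ hprod, Fin.sum_univ_four, hf₀, hf₁, hf₂, ht, hax₃, hP,
    Polynomial.aeval_X_pow_mul_of_pow_succ_eq_zero hpow₀,
    Polynomial.aeval_X_pow_mul_of_pow_succ_eq_zero hpow₁,
    Polynomial.aeval_X_pow_mul_of_pow_succ_eq_zero hpow₂, h₁, h₂, map_zero]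
  linear_combination algebraMap K R (f₀.coeff 0) * hh

/-- Let `K` be a field of prime characteristic `p` and
`S = K[A,B,C,T]/(AB − T⁵, BC + CT³ − BT⁵, AC + CT² − ABT²)`, with `a, b, c, t`
the images of the variables, and `h = a¹⁵ + b¹⁰ + c⁶`.  Then the ideal `(t, h)`
of `S` is Frobenius closed: for every `u ∈ S` and every `e ≥ 0`, if
`u^{p^e} ∈ (t^{p^e}, h^{p^e})` then `u ∈ (t, h)`. -/
theorem stmt_9 (K : Type*) [Field K] (p : ℕ) [Fact p.Prime] [CharP K p]
    (I : Ideal (MvPolynomial (Fin 4) K))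
    (hI : I = Ideal.span {X 0 * X 1 - X 3 ^ 5,
      X 1 * X 2 + X 2 * X 3 ^ 3 - X 1 * X 3 ^ 5,
      X 0 * X 2 + X 2 * X 3 ^ 2 - X 0 * X 1 * X 3 ^ 2})
    (a b c t : MvPolynomial (Fin 4) K ⧸ I)
    (ha : a = Ideal.Quotient.mk I (X 0))
    (hb : b = Ideal.Quotient.mk I (X 1))
    (hc : c = Ideal.Quotient.mk I (X 2))
    (ht : t = Ideal.Quotient.mk I (X 3))
    (h : MvPolynomial (Fin 4) K ⧸ I)
    (hh : h = a ^ 15 + b ^ 10 + c ^ 6) :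
    ∀ (u : MvPolynomial (Fin 4) K ⧸ I) (e : ℕ),
      u ^ p ^ e ∈ Ideal.span ({t ^ p ^ e, h ^ p ^ e} : Set (MvPolynomial (Fin 4) K ⧸ I)) →
        u ∈ Ideal.span ({t, h} : Set (MvPolynomial (Fin 4) K ⧸ I)) := by
  subst ha hb hc ht hh
  intro u e hu
  obtain ⟨P, rfl⟩ := Ideal.Quotient.mk_surjective u
  have hq : p ^ e ≠ 0 := pow_ne_zero _ (Fact.out : p.Prime).ne_zero
  -- Restricting the membership to the three axes of `t = 0`.
  obtain ⟨v, w, hvw⟩ := Ideal.mem_span_pair.1 hu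
  obtain ⟨V, rfl⟩ := Ideal.Quotient.mk_surjective v
  obtain ⟨W, rfl⟩ := Ideal.Quotient.mk_surjective w
  simp only [← map_pow, ← map_add, ← map_mul] at hvw
  have hmem := Ideal.Quotient.eq.1 hvw
  have hker : ∀ i : Fin 4, i ≠ 3 → ∀ F ∈ I, axisRestrict K i F = 0 := by
    intro i hi F hF
    have : I ≤ RingHom.ker (axisRestrict K i) := by
      rw [hI, Ideal.span_le]
      have h3 : axisRestrict K i (X 3) = 0 := by rw [axisRestrict_X, if_neg hi.symm]
      have h01 := axisRestrict_X_mul_X K i (show (0 : Fin 4) ≠ 1 by decide)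
      have h12 := axisRestrict_X_mul_X K i (show (1 : Fin 4) ≠ 2 by decide)
      have h02 := axisRestrict_X_mul_X K i (show (0 : Fin 4) ≠ 2 by decide)
      rintro G (rfl | rfl | rfl) <;>
        simp only [SetLike.mem_coe, RingHom.mem_ker, map_sub, map_add, map_mul, map_pow, h3, h01,
          h12, h02] <;> ring
    exact this hF
  have hP : ∀ i : Fin 4, i ≠ 3 → axisRestrict K i P ^ p ^ e =
      axisRestrict K i (X 0 ^ 15 + X 1 ^ 10 + X 2 ^ 6) ^ p ^ e * axisRestrict K i W := by
    intro i hi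
    have := hker i hi _ hmem
    simp only [map_sub, map_add, map_mul, map_pow, axisRestrict_X K i 3, if_neg hi.symm,
      zero_pow hq] at this ⊢
    linear_combination -this
  obtain ⟨f₀, hf₀, hc₀⟩ :=
    Polynomial.exists_eq_X_pow_mul_of_pow_eq (n := 15) (w := axisRestrict K 0 W) hq
      (by simpa [axisRestrict_X] using hP 0 (by decide))
  obtain ⟨f₁, hf₁, hc₁⟩ :=
    Polynomial.exists_eq_X_pow_mul_of_pow_eq (n := 10) (w := axisRestrict K 1 W) hq
      (by simpa [axisRestrict_X] using hP 1 (by decide))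
  obtain ⟨f₂, hf₂, hc₂⟩ :=
    Polynomial.exists_eq_X_pow_mul_of_pow_eq (n := 6) (w := axisRestrict K 2 W) hq
      (by simpa [axisRestrict_X] using hP 2 (by decide))
  rw [coeff_zero_axisRestrict] at hc₀ hc₁ hc₂
  have h₁ : f₁.coeff 0 = f₀.coeff 0 := iterateFrobenius_inj K p e (hc₁.trans hc₀.symm)
  have h₂ : f₂.coeff 0 = f₀.coeff 0 := iterateFrobenius_inj K p e (hc₂.trans hc₀.symm)
  set J : Ideal (MvPolynomial (Fin 4) K ⧸ I) := Ideal.span _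
  have hπ : ∀ F, Ideal.Quotient.mkₐ K (J.comap (Ideal.Quotient.mk I)) F = 0 ↔
      Ideal.Quotient.mk I F ∈ J := fun F => by
    rw [Ideal.Quotient.mkₐ_eq_mk, Ideal.Quotient.eq_zero_iff_mem, Ideal.mem_comap]
  have hπI : ∀ F ∈ I, Ideal.Quotient.mkₐ K (J.comap (Ideal.Quotient.mk I)) F = 0 :=
    fun F hF => by
      rw [hπ, Ideal.Quotient.eq_zero_iff_mem.2 hF]
      exact zero_mem J
  rw [← hπ]
  refine algHom_eq_zero_of_axisRestrict _ (hπI _ ?_) (hπI _ ?_) (hπI _ ?_) ((hπ _).2 ?_)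
    ((hπ _).2 ?_) hf₀ hf₁ hf₂ h₁ h₂
  · rw [hI]
    exact Ideal.subset_span (by simp)
  · rw [hI]
    exact Ideal.subset_span (by simp)
  · rw [hI]
    exact Ideal.subset_span (by simp)
  · exact Ideal.subset_span (Set.mem_insert _ _)
  · simp only [map_add, map_pow]
    exact Ideal.subset_span (Set.mem_insert_of_mem _ rfl)
end

section
/- Let K be a field of prime characteristic p, let k and d be integers with 3 ≤ k ≤ d, and let F, G ∈ K[X₁, …, X_k] be homogeneous polynomials of degree d such that the coefficient of the monomial X_k^d in G equals 1 and the coefficient of X_k^d in F equals 0. Let R be the K-subalgebra of K[X₁, …, X_k] generated by the 2k elements X₁F, …, X_kF, X₁G, …, X_kG. Then for every power q = p^e of p, the element (X_k F)^{(d−1)(q+1)} lies in the ideal of R generated by the elements (X₁F)^q, …, (X_{k−1}F)^q, (X₁G)^q, …, (X_{k−1}G)^q. Consequently, (X_kF)^{d−1} lies in the tight closure in R of the ideal of R generated by X₁F, …, X_{k−1}F, X₁G, …, X_{k−1}G. -/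
open MvPolynomial

theorem MvPolynomial.mul_mem_of_forall_mem_support {σ K : Type*} [CommSemiring K]
    (P : Submodule K (MvPolynomial σ K)) (H A : MvPolynomial σ K)
    (h : ∀ m ∈ H.support, monomial m 1 * A ∈ P) : H * A ∈ P := by
  rw [H.as_sum, Finset.sum_mul]
  refine Submodule.sum_mem _ fun m hm => ?_
  have := P.smul_mem (H.coeff m) (h m hm)
  rwa [← smul_mul_assoc, smul_monomial, smul_eq_mul, mul_one] at this

theorem monomial_mul_pow_mem {σ K : Type*} [CommRing K]
    {R : Subalgebra K (MvPolynomial σ K)} {F G : MvPolynomial σ K}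
    (hF : ∀ i, X i * F ∈ R) (hG : ∀ i, X i * G ∈ R) (n b c : ℕ) (μ : σ →₀ ℕ)
    (hbc : b + c = n) (hμ : μ.degree = n) :
    monomial μ 1 * (F ^ b * G ^ c) ∈ R := by
  induction n generalizing b c μ with
  | zero =>
    obtain ⟨rfl, rfl⟩ : b = 0 ∧ c = 0 := by omega
    obtain rfl : μ = 0 := (Finsupp.degree_eq_zero_iff μ).1 hμ
    simp [R.one_mem]
  | succ n ih =>
    obtain ⟨i, hi⟩ : ∃ i, μ i ≠ 0 := by
      by_contra! h
      obtain rfl : μ = 0 := Finsupp.ext h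
      simp at hμ
    obtain ⟨ν, rfl⟩ : ∃ ν, μ = Finsupp.single i 1 + ν :=
      ⟨μ - Finsupp.single i 1, (add_tsub_cancel_of_le
        (Finsupp.single_le_iff.2 (Nat.one_le_iff_ne_zero.2 hi))).symm⟩
    have hν : ν.degree = n := by
      rw [map_add, Finsupp.degree_single] at hμ
      omega
    have hmon : (monomial (Finsupp.single i 1 + ν) 1 : MvPolynomial σ K) =
        X i * monomial ν 1 := by simp [X, monomial_mul]
    rw [hmon]
    rcases b with _ | b
    · obtain ⟨c, rfl⟩ : ∃ c', c = c' + 1 := ⟨n, by omega⟩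
      convert R.mul_mem (hG i) (ih 0 c ν (by omega) hν) using 1
      ring
    · convert R.mul_mem (hF i) (ih b c ν (by omega) hν) using 1
      ring

theorem exists_le_apply_of_lt_degree {σ : Type*} [Fintype σ] (j : σ) {q d : ℕ}
    (hd : 2 ≤ d) (hq : 0 < q) (hσ : Fintype.card σ ≤ d) (μ : σ →₀ ℕ) (hj : μ j < d)
    (hμ : μ.degree = (d - 1) * (q + 1)) : ∃ i, i ≠ j ∧ q ≤ μ i := by
  classical
  by_contra! h
  have hsum : ∑ i ∈ Finset.univ.erase j, μ i ≤ (Finset.univ.erase j).card • (q - 1) :=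
    Finset.sum_le_card_nsmul _ _ _ fun i hi => by
      have := h i (Finset.ne_of_mem_erase hi)
      omega
  rw [Finset.card_erase_of_mem (Finset.mem_univ j), Finset.card_univ, smul_eq_mul] at hsum
  rw [Finsupp.degree_eq_sum, ← Finset.add_sum_erase _ _ (Finset.mem_univ j)] at hμ
  have h1 : (Fintype.card σ - 1) * (q - 1) ≤ (d - 1) * (q - 1) :=
    Nat.mul_le_mul_right _ (by omega)
  obtain ⟨r, rfl⟩ : ∃ r, q = r + 1 := ⟨q - 1, by omega⟩
  obtain ⟨e, rfl⟩ : ∃ e, d = e + 2 := ⟨d - 2, by omega⟩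
  simp only [Nat.add_sub_cancel, show e + 2 - 1 = e + 1 by omega] at *
  nlinarith

theorem MvPolynomial.IsHomogeneous.apply_lt_of_mem_support {σ K : Type*} [CommSemiring K]
    {H : MvPolynomial σ K} {d : ℕ} (hH : H.IsHomogeneous d) {j : σ}
    (hc : H.coeff (Finsupp.single j d) = 0) {m : σ →₀ ℕ} (hm : m ∈ H.support) :
    m.degree = d ∧ m j < d := by
  have hdeg : m.degree = d := by
    by_contra h
    exact (mem_support_iff.1 hm) (hH.coeff_eq_zero h)
  refine ⟨hdeg, lt_of_le_of_ne (hdeg ▸ Finsupp.le_degree j m) fun h => ?_⟩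
  have hle : Finsupp.single j d ≤ m := Finsupp.single_le_iff.2 h.ge
  obtain ⟨ν, rfl⟩ := exists_add_of_le hle
  rw [map_add, Finsupp.degree_single] at hdeg
  obtain rfl : ν = 0 := (Finsupp.degree_eq_zero_iff ν).1 (by omega)
  rw [add_zero] at hm
  exact (mem_support_iff.1 hm) hc

/-- The relation `X_j ^ d * F = F * G - (G - X_j ^ d) * F` trades powers of `X_j` for the other
variables until the hypothesis on small powers of `X_j` applies. -/
theorem monomial_mul_pow_mem_of_lt {σ K : Type*} [CommRing K]
    (P : Submodule K (MvPolynomial σ K)) {F G : MvPolynomial σ K} {d N : ℕ} (hd : 0 < d)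
    (hF : F.IsHomogeneous d) (hG : G.IsHomogeneous d) (j : σ)
    (hGc : G.coeff (Finsupp.single j d) = 1) (hFc : F.coeff (Finsupp.single j d) = 0)
    (hP : ∀ (μ : σ →₀ ℕ) (b c : ℕ), μ.degree = N → b + c = N → μ j < d →
      monomial μ 1 * (F ^ b * G ^ c) ∈ P)
    (μ : σ →₀ ℕ) (b c : ℕ) (hμ : μ.degree = N) (hbc : b + c = N) (hb : μ j ≤ b) :
    monomial μ 1 * (F ^ b * G ^ c) ∈ P := by
  classical
  induction hn : μ j using Nat.strong_induction_on generalizing μ b c with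
  | _ n ih =>
    subst hn
    rcases lt_or_ge (μ j) d with h | h
    · exact hP μ b c hμ hbc h
    obtain ⟨ν, rfl⟩ := exists_add_of_le (Finsupp.single_le_iff.2 h)
    simp only [map_add, Finsupp.degree_single, Finsupp.add_apply, Finsupp.single_eq_same]
      at hμ hb ih
    obtain ⟨b, rfl⟩ : ∃ b', b = b' + 1 := ⟨b - 1, by omega⟩
    have hH : (G - X j ^ d).IsHomogeneous d := hG.sub (isHomogeneous_X_pow j d)
    have hHc : (G - X j ^ d).coeff (Finsupp.single j d) = 0 := by
      rw [coeff_sub, hGc, X_pow_eq_monomial, coeff_monomial, if_pos rfl, sub_self]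
    have step : ∀ (H : MvPolynomial σ K) (b' c' : ℕ), H.IsHomogeneous d →
        H.coeff (Finsupp.single j d) = 0 → b' + c' = N → b ≤ b' →
        H * (monomial ν 1 * (F ^ b' * G ^ c')) ∈ P := by
      intro H b' c' hh hc hbc' hb'
      refine MvPolynomial.mul_mem_of_forall_mem_support P _ _ fun m hm => ?_
      obtain ⟨hm1, hm2⟩ := hh.apply_lt_of_mem_support hc hm
      rw [← mul_assoc, monomial_mul, one_mul]
      refine ih (m j + ν j) (by omega) (m + ν) b' c' ?_ hbc' ?_ rfl
      · rw [map_add]; omega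
      · rw [Finsupp.add_apply]; omega
    convert P.sub_mem (step F b (c + 1) hF hFc (by omega) le_rfl)
      (step (G - X j ^ d) (b + 1) c hH hHc hbc (by omega)) using 1
    have hmon : (monomial (Finsupp.single j d + ν) 1 : MvPolynomial σ K) =
        X j ^ d * monomial ν 1 := by simp [X_pow_eq_monomial, monomial_mul]
    rw [hmon]
    ring

/-- Let `K` be a field of prime characteristic `p`, `3 ≤ k ≤ d`, and let
`F, G ∈ K[X₁,…,X_k]` be homogeneous of degree `d` with the coefficient of
`X_k^d` equal to `1` in `G` and to `0` in `F`.  Let `R` be the `K`-subalgebra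
generated by `X₁F, …, X_kF, X₁G, …, X_kG`.  Then for every `q = p^e`, the
element `(X_kF)^{(d−1)(q+1)}` lies in the ideal of `R` generated by the `q`-th
powers `(XᵢF)^q, (XᵢG)^q` for `i ≠ k`; consequently `(X_kF)^{d−1}` lies in the
tight closure of the ideal `(X₁F, …, X_{k−1}F, X₁G, …, X_{k−1}G)` of `R`. -/
theorem stmt_10 (K : Type*) [Field K] (p : ℕ) [Fact p.Prime] [CharP K p]
    (k d : ℕ) (hk : 3 ≤ k) (hkd : k ≤ d)
    (F G : MvPolynomial (Fin k) K)
    (hF : F.IsHomogeneous d) (hG : G.IsHomogeneous d)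
    (lst : Fin k) (hlst : (lst : ℕ) = k - 1)
    (hGc : G.coeff (Finsupp.single lst d) = 1)
    (hFc : F.coeff (Finsupp.single lst d) = 0)
    (R : Subalgebra K (MvPolynomial (Fin k) K))
    (hR : R = Algebra.adjoin K
      ((Set.range fun i : Fin k => X i * F) ∪ (Set.range fun i : Fin k => X i * G)))
    (xF xG : Fin k → R)
    (hxF : ∀ i, (xF i : MvPolynomial (Fin k) K) = X i * F)
    (hxG : ∀ i, (xG i : MvPolynomial (Fin k) K) = X i * G) :
    (∀ e : ℕ,
      xF lst ^ ((d - 1) * (p ^ e + 1)) ∈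
        Ideal.span ({y : R | ∃ i : Fin k, i ≠ lst ∧
          (y = xF i ^ p ^ e ∨ y = xG i ^ p ^ e)} : Set R)) ∧
    ∃ c : R, c ≠ 0 ∧ ∃ E : ℕ, ∀ e ≥ E,
      c * (xF lst ^ (d - 1)) ^ p ^ e ∈
        Ideal.span ({y : R | ∃ i : Fin k, i ≠ lst ∧
          (y = xF i ^ p ^ e ∨ y = xG i ^ p ^ e)} : Set R) := by
  have hFR : ∀ i, X i * F ∈ R := fun i => hxF i ▸ (xF i).2
  have hGR : ∀ i, X i * G ∈ R := fun i => hxG i ▸ (xG i).2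
  have main : ∀ e : ℕ,
      xF lst ^ ((d - 1) * (p ^ e + 1)) ∈
        Ideal.span ({y : R | ∃ i : Fin k, i ≠ lst ∧
          (y = xF i ^ p ^ e ∨ y = xG i ^ p ^ e)} : Set R) := by
    intro e
    have hq : 0 < p ^ e := pow_pos (Fact.out : p.Prime).pos e
    generalize p ^ e = q at hq ⊢
    set J := Ideal.span ({y : R | ∃ i : Fin k, i ≠ lst ∧
          (y = xF i ^ q ∨ y = xG i ^ q)} : Set R) with hJ
    let P : Submodule K (MvPolynomial (Fin k) K) :=
      (J.restrictScalars K).map R.val.toLinearMap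
    have hP : ∀ (x : R) (y : MvPolynomial (Fin k) K), x ∈ J → y ∈ R →
        (x : MvPolynomial (Fin k) K) * y ∈ P := fun x y hx hy =>
      ⟨x * ⟨y, hy⟩, J.mul_mem_right _ hx, rfl⟩
    have hN : 2 * (q + 1) ≤ (d - 1) * (q + 1) := Nat.mul_le_mul_right _ (by omega)
    have key := monomial_mul_pow_mem_of_lt P (by omega) hF hG lst hGc hFc
      (N := (d - 1) * (q + 1)) (fun μ b c hμ hbc hlt => by
        obtain ⟨i, hi, hqi⟩ := exists_le_apply_of_lt_degree lst (by omega) hq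
          (by simpa using hkd) μ hlt hμ
        obtain ⟨ν, rfl⟩ := exists_add_of_le (Finsupp.single_le_iff.2 hqi)
        rw [map_add, Finsupp.degree_single] at hμ
        have hmon : (monomial (Finsupp.single i q + ν) 1 : MvPolynomial (Fin k) K) =
            X i ^ q * monomial ν 1 := by simp [X_pow_eq_monomial, monomial_mul]
        rw [hmon]
        rcases le_or_gt q b with hb | hb
        · obtain ⟨b, rfl⟩ := exists_add_of_le hb
          convert hP (xF i ^ q) _ (Ideal.subset_span ⟨i, hi, Or.inl rfl⟩)
            (monomial_mul_pow_mem hFR hGR (b + c) b c ν rfl (by omega)) using 1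
          rw [SubmonoidClass.coe_pow, hxF]
          ring
        · obtain ⟨c, rfl⟩ := exists_add_of_le (show q ≤ c by omega)
          convert hP (xG i ^ q) _ (Ideal.subset_span ⟨i, hi, Or.inr rfl⟩)
            (monomial_mul_pow_mem hFR hGR (b + c) b c ν rfl (by omega)) using 1
          rw [SubmonoidClass.coe_pow, hxG]
          ring)
      (Finsupp.single lst ((d - 1) * (q + 1))) ((d - 1) * (q + 1)) 0
      (Finsupp.degree_single _ _) rfl (by simp)
    obtain ⟨y, hy, hyx⟩ := key
    convert (show y ∈ J from hy) using 1
    refine Subtype.ext (Eq.trans ?_ hyx.symm)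
    rw [SubmonoidClass.coe_pow, hxF, ← X_pow_eq_monomial]
    ring
  refine ⟨main, ?_⟩
  by_cases hF0 : F = 0
  · refine ⟨1, one_ne_zero, 0, fun e _ => ?_⟩
    have h0 : xF lst = 0 := Subtype.ext (by simp [hxF, hF0])
    have hq : p ^ e ≠ 0 := (pow_pos (Fact.out : p.Prime).pos e).ne'
    rw [h0, zero_pow (by omega : d - 1 ≠ 0), zero_pow hq, mul_zero]
    exact Ideal.zero_mem _
  · refine ⟨xF lst ^ (d - 1), pow_ne_zero _ fun h => ?_, 0, fun e _ => ?_⟩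
    · have h' := hxF lst
      rw [h] at h'
      exact mul_ne_zero (X_ne_zero lst) hF0 h'.symm
    · convert main e using 1
      ring
end

section
/- Let K be a field, let F = X₁X₂X₃ and G = X₁³ + X₂³ + X₃³ in the polynomial ring K[X₁, X₂, X₃], and let R be the K-subalgebra of K[X₁, X₂, X₃] generated by X₁F, X₂F, X₃F, X₁G, X₂G, X₃G. Then (X₃F)² does not lie in the ideal of R generated by X₁F, X₂F, X₁G, X₂G. -/
open MvPolynomial

/-- The exponent vector `(a, b, c)` of a monomial in three variables. -/
noncomputable def expVec (a b c : ℕ) : Fin 3 →₀ ℕ :=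
  Finsupp.equivFunOnFinite.symm ![a, b, c]

theorem expVec_add (a b c a' b' c' : ℕ) :
    expVec a b c + expVec a' b' c' = expVec (a + a') (b + b') (c + c') := by
  ext i
  fin_cases i <;> simp [expVec]

theorem expVec_inj (a b c a' b' c' : ℕ) :
    expVec a b c = expVec a' b' c' ↔ a = a' ∧ b = b' ∧ c = c' := by
  simp [expVec]

theorem degree_expVec (a b c : ℕ) : (expVec a b c).degree = a + b + c := by
  simp [expVec, Finsupp.degree_eq_sum, Fin.sum_univ_three]

/-- The monomial `X₁ᵃ X₂ᵇ X₃ᶜ`. -/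
noncomputable def triMonomial (K : Type*) [Field K] (a b c : ℕ) : MvPolynomial (Fin 3) K :=
  monomial (expVec a b c) 1

section

variable {K : Type*} [Field K]

theorem triMonomial_mul (a b c a' b' c' : ℕ) :
    triMonomial K a b c * triMonomial K a' b' c' =
      triMonomial K (a + a') (b + b') (c + c') := by
  simp [triMonomial, monomial_mul, expVec_add]

theorem triMonomial_eq (a b c : ℕ) :
    triMonomial K a b c = X 0 ^ a * X 1 ^ b * X 2 ^ c := by
  rw [triMonomial, monomial_eq, Finsupp.prod_fintype _ _ (by simp), Fin.prod_univ_three]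
  simp [expVec]

theorem isHomogeneous_triMonomial (a b c : ℕ) :
    (triMonomial K a b c).IsHomogeneous (a + b + c) :=
  isHomogeneous_monomial _ (degree_expVec a b c)

/-- The difference of the coefficients of `X₁²X₂²X₃⁴` and `X₁⁵X₂²X₃`. -/
noncomputable def coeffDiff (K : Type*) [Field K] : MvPolynomial (Fin 3) K →ₗ[K] K :=
  lcoeff K (expVec 2 2 4) - lcoeff K (expVec 5 2 1)

theorem coeffDiff_triMonomial (a b c : ℕ) :
    coeffDiff K (triMonomial K a b c) =
      (if a = 2 ∧ b = 2 ∧ c = 4 then 1 else 0) - (if a = 5 ∧ b = 2 ∧ c = 1 then 1 else 0) := by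
  classical
  simp [coeffDiff, triMonomial, coeff_monomial, expVec_inj]

theorem coeffDiff_eq_zero_of_isHomogeneous {p : MvPolynomial (Fin 3) K} {n : ℕ}
    (hp : p.IsHomogeneous n) (hn : n ≠ 8) : coeffDiff K p = 0 := by
  simp only [coeffDiff, LinearMap.sub_apply, lcoeff_apply]
  rw [hp.coeff_eq_zero (by rw [degree_expVec]; omega),
    hp.coeff_eq_zero (by rw [degree_expVec]; omega), sub_zero]

theorem eq_one_or_mem_or_isHomogeneous_of_mem_closure {S : Set (MvPolynomial (Fin 3) K)}
    (hS : ∀ s ∈ S, s.IsHomogeneous 4) {m : MvPolynomial (Fin 3) K}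
    (hm : m ∈ Submonoid.closure S) :
    m = 1 ∨ m ∈ S ∨ ∃ n, 8 ≤ n ∧ m.IsHomogeneous n := by
  induction hm using Submonoid.closure_induction with
  | mem x hx => exact .inr (.inl hx)
  | one => exact .inl rfl
  | mul x y _ _ hx hy =>
    have key {z : MvPolynomial (Fin 3) K}
        (hz : z ∈ S ∨ ∃ n, 8 ≤ n ∧ z.IsHomogeneous n) :
        ∃ n, 4 ≤ n ∧ z.IsHomogeneous n := by
      rcases hz with hz | ⟨n, hn, hz⟩
      · exact ⟨4, le_rfl, hS z hz⟩
      · exact ⟨n, by omega, hz⟩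
    rcases hx with rfl | hx
    · simpa using hy
    rcases hy with rfl | hy
    · simpa using Or.inr hx
    obtain ⟨k, hk, hx⟩ := key hx
    obtain ⟨l, hl, hy⟩ := key hy
    exact .inr (.inr ⟨k + l, by omega, hx.mul hy⟩)

theorem coeffDiff_mul_eq_zero_of_mem_adjoin {S : Set (MvPolynomial (Fin 3) K)}
    (hS : ∀ s ∈ S, s.IsHomogeneous 4) {a : MvPolynomial (Fin 3) K} (ha : a.IsHomogeneous 4)
    (h : ∀ s ∈ S, coeffDiff K (s * a) = 0) {r : MvPolynomial (Fin 3) K}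
    (hr : r ∈ Algebra.adjoin K S) : coeffDiff K (r * a) = 0 := by
  rw [← Subalgebra.mem_toSubmodule, Algebra.adjoin_eq_span] at hr
  induction hr using Submodule.span_induction with
  | mem x hx =>
    rcases eq_one_or_mem_or_isHomogeneous_of_mem_closure hS hx with rfl | hx | ⟨n, hn, hx⟩
    · rw [one_mul]
      exact coeffDiff_eq_zero_of_isHomogeneous ha (by norm_num)
    · exact h x hx
    · exact coeffDiff_eq_zero_of_isHomogeneous (hx.mul ha) (by omega)
  | zero => simp
  | add x y _ _ hx hy => rw [add_mul, map_add, hx, hy, add_zero]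
  | smul c x _ hx => rw [smul_mul_assoc, map_smul, hx, smul_zero]

end

/-- Let `K` be a field, `F = X₁X₂X₃`, `G = X₁³ + X₂³ + X₃³`, and `R` the
`K`-subalgebra of `K[X₁,X₂,X₃]` generated by `X₁F, X₂F, X₃F, X₁G, X₂G, X₃G`.
Then `(X₃F)²` does not lie in the ideal of `R` generated by
`X₁F, X₂F, X₁G, X₂G`. -/
theorem stmt_11 (K : Type*) [Field K]
    (F G : MvPolynomial (Fin 3) K)
    (hF : F = X 0 * X 1 * X 2)
    (hG : G = X 0 ^ 3 + X 1 ^ 3 + X 2 ^ 3)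
    (R : Subalgebra K (MvPolynomial (Fin 3) K))
    (hR : R = Algebra.adjoin K
      {X 0 * F, X 1 * F, X 2 * F, X 0 * G, X 1 * G, X 2 * G})
    (a₁ a₂ a₃ b₁ b₂ : R)
    (ha₁ : (a₁ : MvPolynomial (Fin 3) K) = X 0 * F)
    (ha₂ : (a₂ : MvPolynomial (Fin 3) K) = X 1 * F)
    (ha₃ : (a₃ : MvPolynomial (Fin 3) K) = X 2 * F)
    (hb₁ : (b₁ : MvPolynomial (Fin 3) K) = X 0 * G)
    (hb₂ : (b₂ : MvPolynomial (Fin 3) K) = X 1 * G) :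
    a₃ ^ 2 ∉ Ideal.span ({a₁, a₂, b₁, b₂} : Set R) := by
  have hX0 : (X 0 : MvPolynomial (Fin 3) K) = triMonomial K 1 0 0 := by simp [triMonomial_eq]
  have hX1 : (X 1 : MvPolynomial (Fin 3) K) = triMonomial K 0 1 0 := by simp [triMonomial_eq]
  have hX2 : (X 2 : MvPolynomial (Fin 3) K) = triMonomial K 0 0 1 := by simp [triMonomial_eq]
  have hF' : F = triMonomial K 1 1 1 := by simp [hF, triMonomial_eq]
  have hG' : G = triMonomial K 3 0 0 + triMonomial K 0 3 0 + triMonomial K 0 0 3 := by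
    simp [hG, triMonomial_eq]
  have hFhom : F.IsHomogeneous 3 := hF' ▸ isHomogeneous_triMonomial 1 1 1
  have hGhom : G.IsHomogeneous 3 := hG' ▸
    ((isHomogeneous_triMonomial 3 0 0).add (isHomogeneous_triMonomial 0 3 0)).add
      (isHomogeneous_triMonomial 0 0 3)
  have hmul {H : MvPolynomial (Fin 3) K} (hH : H.IsHomogeneous 3) (i : Fin 3) :
      (X i * H).IsHomogeneous 4 := (isHomogeneous_X K i).mul hH
  have hS : ∀ s ∈ ({X 0 * F, X 1 * F, X 2 * F, X 0 * G, X 1 * G, X 2 * G} :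
      Set (MvPolynomial (Fin 3) K)), s.IsHomogeneous 4 := by
    rintro s (rfl | rfl | rfl | rfl | rfl | rfl)
    exacts [hmul hFhom 0, hmul hFhom 1, hmul hFhom 2, hmul hGhom 0, hmul hGhom 1, hmul hGhom 2]
  have hzero : ∀ x ∈ Ideal.span ({a₁, a₂, b₁, b₂} : Set R), ∀ r : R,
      coeffDiff K ((r * x : R) : MvPolynomial (Fin 3) K) = 0 := by
    intro x hx
    induction hx using Submodule.span_induction with
    | mem x hx =>
      intro r
      rw [Subalgebra.coe_mul]
      refine coeffDiff_mul_eq_zero_of_mem_adjoin hS ?_ ?_ (hR ▸ r.2)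
      · rcases hx with rfl | rfl | rfl | rfl
        exacts [ha₁ ▸ hmul hFhom 0, ha₂ ▸ hmul hFhom 1, hb₁ ▸ hmul hGhom 0, hb₂ ▸ hmul hGhom 1]
      · rcases hx with rfl | rfl | rfl | rfl <;>
        rintro s (rfl | rfl | rfl | rfl | rfl | rfl) <;>
        simp only [ha₁, ha₂, hb₁, hb₂, hX0, hX1, hX2, hF', hG', mul_add, add_mul,
          triMonomial_mul, map_add, coeffDiff_triMonomial] <;>
        norm_num
    | zero => simp
    | add x y _ _ hx hy =>
      intro r
      rw [mul_add, Subalgebra.coe_add, map_add, hx, hy, add_zero]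
    | smul c x _ hx =>
      intro r
      rw [smul_eq_mul, ← mul_assoc]
      exact hx (r * c)
  intro hmem
  have h := hzero _ hmem 1
  rw [one_mul, Subalgebra.coe_pow, ha₃, hX2, hF', pow_two] at h
  simp only [triMonomial_mul, coeffDiff_triMonomial] at h
  norm_num at h
end

section
/- Let K be a field of characteristic zero, let F = X₁X₂X₃ and G = X₁³ + X₂³ + X₃³ in K[X₁, X₂, X₃], and let R be the K-subalgebra of K[X₁, X₂, X₃] generated by X₁F, X₂F, X₃F, X₁G, X₂G, X₃G. Let a = X₁G, b = X₂G − X₁F, and c = X₃G − X₂F, viewed as elements of R. Then the quotient ring R/(a, b, c) is a K-vector space of dimension exactly 7. -/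
open MvPolynomial

set_option synthInstance.maxHeartbeats 800000

namespace TernaryCubics

/-- The exponent vector `(i, j, k)`. -/
noncomputable def expo (i j k : ℕ) : Fin 3 →₀ ℕ := Finsupp.equivFunOnFinite.symm ![i, j, k]

lemma expo_add (i j k i' j' k' : ℕ) :
    expo i j k + expo i' j' k' = expo (i + i') (j + j') (k + k') := by
  ext t; fin_cases t <;> simp [expo]

lemma expo_inj (i j k i' j' k' : ℕ) :
    expo i j k = expo i' j' k' ↔ i = i' ∧ j = j' ∧ k = k' := by
  simp [expo]

lemma degree_expo (i j k : ℕ) : (expo i j k).degree = i + j + k := by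
  simp [expo, Finsupp.degree_eq_sum, Fin.sum_univ_three]

variable {K : Type*} [Field K]

/-- The monomial `X₁ⁱ X₂ʲ X₃ᵏ`. -/
noncomputable def mono (K : Type*) [Field K] (i j k : ℕ) : MvPolynomial (Fin 3) K :=
  monomial (expo i j k) 1

lemma mono_mul (i j k i' j' k' : ℕ) :
    mono K i j k * mono K i' j' k' = mono K (i + i') (j + j') (k + k') := by
  simp [mono, monomial_mul, expo_add]

lemma lcoeff_mono (i j k i' j' k' : ℕ) :
    lcoeff K (expo i j k) (mono K i' j' k') = if i' = i ∧ j' = j ∧ k' = k then 1 else 0 := by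
  simp [mono, coeff_monomial, expo_inj]

lemma isHomogeneous_mono (i j k : ℕ) : (mono K i j k).IsHomogeneous (i + j + k) :=
  isHomogeneous_monomial _ (degree_expo i j k)

lemma X_zero_eq : (X 0 : MvPolynomial (Fin 3) K) = mono K 1 0 0 := by
  have h : Finsupp.single (0 : Fin 3) 1 = expo 1 0 0 := by
    ext t; fin_cases t <;> simp [expo]
  rw [X, mono, h]

lemma X_one_eq : (X 1 : MvPolynomial (Fin 3) K) = mono K 0 1 0 := by
  have h : Finsupp.single (1 : Fin 3) 1 = expo 0 1 0 := by
    ext t; fin_cases t <;> simp [expo]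
  rw [X, mono, h]

lemma X_two_eq : (X 2 : MvPolynomial (Fin 3) K) = mono K 0 0 1 := by
  have h : Finsupp.single (2 : Fin 3) 1 = expo 0 0 1 := by
    ext t; fin_cases t <;> simp [expo]
  rw [X, mono, h]

/-- The products `X₁X₂X₃ · Xᵢ` and `(X₁³ + X₂³ + X₃³) · Xᵢ`, expanded into monomials. -/
noncomputable def gens (K : Type*) [Field K] : Set (MvPolynomial (Fin 3) K) :=
  {mono K 2 1 1, mono K 1 2 1, mono K 1 1 2,
    mono K 4 0 0 + mono K 1 3 0 + mono K 1 0 3,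
    mono K 3 1 0 + mono K 0 4 0 + mono K 0 1 3,
    mono K 3 0 1 + mono K 0 3 1 + mono K 0 0 4}

/-- Linear forms in the coefficients of degrees 0, 4 and 8 which cut out the ideal `(a, b, c)`
inside the subalgebra `R`. -/
noncomputable def coords (K : Type*) [Field K] : MvPolynomial (Fin 3) K →ₗ[K] (Fin 7 → K) :=
  LinearMap.pi ![
    lcoeff K (expo 0 0 0),
    lcoeff K (expo 2 1 1) + lcoeff K (expo 0 4 0),
    lcoeff K (expo 1 2 1) + lcoeff K (expo 0 0 4),
    lcoeff K (expo 1 1 2),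
    lcoeff K (expo 3 2 3) - (2 : K) • lcoeff K (expo 0 8 0) + lcoeff K (expo 1 5 2)
      + lcoeff K (expo 0 0 8) + lcoeff K (expo 2 4 2) - lcoeff K (expo 2 1 5),
    lcoeff K (expo 2 3 3) - (2 : K) • lcoeff K (expo 8 0 0) + lcoeff K (expo 1 1 6)
      - lcoeff K (expo 7 1 0),
    lcoeff K (expo 2 2 4) - lcoeff K (expo 5 2 1)]

lemma isHomogeneous_of_mem_gens {p : MvPolynomial (Fin 3) K} (hp : p ∈ gens K) :
    p.IsHomogeneous 4 := by
  simp only [gens, Set.mem_insert_iff, Set.mem_singleton_iff] at hp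
  rcases hp with rfl | rfl | rfl | rfl | rfl | rfl
  · exact isHomogeneous_mono 2 1 1
  · exact isHomogeneous_mono 1 2 1
  · exact isHomogeneous_mono 1 1 2
  · exact ((isHomogeneous_mono 4 0 0).add (isHomogeneous_mono 1 3 0)).add (isHomogeneous_mono 1 0 3)
  · exact ((isHomogeneous_mono 3 1 0).add (isHomogeneous_mono 0 4 0)).add (isHomogeneous_mono 0 1 3)
  · exact ((isHomogeneous_mono 3 0 1).add (isHomogeneous_mono 0 3 1)).add (isHomogeneous_mono 0 0 4)

lemma lcoeff_expo_eq_zero {p : MvPolynomial (Fin 3) K} {n : ℕ} (hp : p.IsHomogeneous n)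
    {i j k : ℕ} (h : i + j + k < n) : lcoeff K (expo i j k) p = 0 := by
  rw [lcoeff_apply]
  refine hp.coeff_eq_zero ?_
  rw [degree_expo]
  exact h.ne

lemma coords_eq_zero_of_isHomogeneous {p : MvPolynomial (Fin 3) K} {n : ℕ}
    (hp : p.IsHomogeneous n) (hn : 8 < n) : coords K p = 0 := by
  have h {i j k : ℕ} (hd : i + j + k ≤ 8) : lcoeff K (expo i j k) p = 0 :=
    lcoeff_expo_eq_zero hp (hd.trans_lt hn)
  ext t
  fin_cases t <;>
    simp only [coords, LinearMap.pi_apply] <;> simp [-lcoeff_apply, h]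

/-- A product of generators is `1`, a generator, or homogeneous of degree at least `8`. -/
lemma eq_one_or_mem_gens_or_isHomogeneous {m : MvPolynomial (Fin 3) K}
    (hm : m ∈ Submonoid.closure (gens K)) :
    m = 1 ∨ m ∈ gens K ∨ ∃ n, 8 ≤ n ∧ m.IsHomogeneous n := by
  induction hm using Submonoid.closure_induction_left with
  | one => exact .inl rfl
  | mul_left x hx y _ ih =>
    have hx4 := isHomogeneous_of_mem_gens hx
    right
    rcases ih with rfl | hy | ⟨n, hn, hy⟩
    · left; rwa [mul_one]
    · exact .inr ⟨4 + 4, le_rfl, hx4.mul (isHomogeneous_of_mem_gens hy)⟩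
    · exact .inr ⟨4 + n, by omega, hx4.mul hy⟩

lemma coords_mul_eq_zero {a : MvPolynomial (Fin 3) K} (ha : a.IsHomogeneous 4)
    (h1 : coords K a = 0) (hg : ∀ g ∈ gens K, coords K (g * a) = 0)
    {r : MvPolynomial (Fin 3) K} (hr : r ∈ Algebra.adjoin K (gens K)) :
    coords K (r * a) = 0 := by
  rw [← Subalgebra.mem_toSubmodule, Algebra.adjoin_eq_span] at hr
  induction hr using Submodule.span_induction with
  | mem m hm =>
    rcases eq_one_or_mem_gens_or_isHomogeneous hm with rfl | hm | ⟨n, hn, hm⟩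
    · rwa [one_mul]
    · exact hg m hm
    · exact coords_eq_zero_of_isHomogeneous (hm.mul ha) (by omega)
  | zero => simp
  | add x y _ _ hx hy => rw [add_mul, map_add, hx, hy, add_zero]
  | smul k x _ hx => rw [smul_mul_assoc, map_smul, hx, smul_zero]

/-- The three elements `X₁G`, `X₂G - X₁F`, `X₃G - X₂F`, expanded into monomials. -/
noncomputable def params (K : Type*) [Field K] : Set (MvPolynomial (Fin 3) K) :=
  {mono K 4 0 0 + mono K 1 3 0 + mono K 1 0 3,
    mono K 3 1 0 + mono K 0 4 0 + mono K 0 1 3 - mono K 2 1 1,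
    mono K 3 0 1 + mono K 0 3 1 + mono K 0 0 4 - mono K 1 2 1}

set_option maxHeartbeats 2000000 in
lemma coords_mul_params {a r : MvPolynomial (Fin 3) K} (ha : a ∈ params K)
    (hr : r ∈ Algebra.adjoin K (gens K)) : coords K (r * a) = 0 := by
  have hhom : ∀ p ∈ gens K, p.IsHomogeneous 4 := fun _ => isHomogeneous_of_mem_gens
  simp only [gens, Set.forall_mem_insert, Set.mem_singleton_iff, forall_eq] at hhom
  obtain ⟨h1, h2, -, h4, h5, h6⟩ := hhom
  simp only [params, Set.mem_insert_iff, Set.mem_singleton_iff] at ha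
  rcases ha with rfl | rfl | rfl
  · refine coords_mul_eq_zero h4 ?_ ?_ hr
    · ext t
      fin_cases t <;>
        simp only [coords, LinearMap.pi_apply] <;> simp [-lcoeff_apply, lcoeff_mono]
    · simp only [gens, Set.forall_mem_insert, Set.mem_singleton_iff, forall_eq, mul_add, add_mul,
        mono_mul]
      refine ⟨?_, ?_, ?_, ?_, ?_, ?_⟩ <;> ext t <;> fin_cases t <;>
        simp only [coords, LinearMap.pi_apply] <;> simp [-lcoeff_apply, lcoeff_mono]
      norm_num
  · refine coords_mul_eq_zero (h5.sub h1) ?_ ?_ hr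
    · ext t
      fin_cases t <;>
        simp only [coords, LinearMap.pi_apply] <;> simp [-lcoeff_apply, lcoeff_mono]
    · simp only [gens, Set.forall_mem_insert, Set.mem_singleton_iff, forall_eq, mul_add, add_mul,
        mul_sub, mono_mul]
      refine ⟨?_, ?_, ?_, ?_, ?_, ?_⟩ <;> ext t <;> fin_cases t <;>
        simp only [coords, LinearMap.pi_apply] <;> simp [-lcoeff_apply, lcoeff_mono]
      norm_num
  · refine coords_mul_eq_zero (h6.sub h2) ?_ ?_ hr
    · ext t
      fin_cases t <;>
        simp only [coords, LinearMap.pi_apply] <;> simp [-lcoeff_apply, lcoeff_mono]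
    · simp only [gens, Set.forall_mem_insert, Set.mem_singleton_iff, forall_eq, mul_add, add_mul,
        mul_sub, mono_mul]
      refine ⟨?_, ?_, ?_, ?_, ?_, ?_⟩ <;> ext t <;> fin_cases t <;>
        simp only [coords, LinearMap.pi_apply] <;> simp [-lcoeff_apply, lcoeff_mono]

/-- Monomials spanning a graded algebra with Hilbert function `(1, 3, 3)`. -/
def basisMonomials {A : Type*} [CommRing A] (u v w : A) : Fin 7 → A :=
  ![1, u, v, w, u * w, v * w, w * w]

lemma map_basisMonomials {A B : Type*} [CommRing A] [CommRing B] (f : A →+* B) (u v w : A)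
    (i : Fin 7) : f (basisMonomials u v w i) = basisMonomials (f u) (f v) (f w) i := by
  fin_cases i <;> simp [basisMonomials]

lemma span_basisMonomials_mul_mem {A : Type*} [CommRing A] [Algebra K A] {u v w : A}
    (huu : u * u = 0) (huv : u * v = 0) (hvv : v * v = w * u)
    (hw : u ^ 3 + v ^ 3 + w ^ 3 = u * v * v) (hv : v ^ 2 * u + w ^ 2 * v = u * u * v)
    (hu : v * u ^ 2 + w * v ^ 2 = 0) {g : A} (hg : g = 0 ∨ g = u ∨ g = v ∨ g = w)
    {n : A} (hn : n ∈ Submodule.span K (Set.range (basisMonomials u v w))) :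
    g * n ∈ Submodule.span K (Set.range (basisMonomials u v w)) := by
  have huw : u * w * w = 0 := by linear_combination hu - v * huu - w * hvv
  have hvw : v * w * w = 0 := by linear_combination hv + u * huv - v * huv
  have hww : w * w * w = 0 := by linear_combination hw - u * huu - v * hvv + (v - w) * huv
  have hmem (i : Fin 7) : basisMonomials u v w i ∈
      Submodule.span K (Set.range (basisMonomials u v w)) := Submodule.subset_span ⟨i, rfl⟩
  induction hn using Submodule.span_induction with
  | zero => simp
  | add x y _ _ hx hy => rw [mul_add]; exact add_mem hx hy
  | smul k x _ hx => rw [mul_smul_comm]; exact Submodule.smul_mem _ _ hx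
  | mem x hx =>
    have key : g * x = 0 ∨ ∃ i, g * x = basisMonomials u v w i := by
      simp only [basisMonomials, Fin.exists_fin_succ, Set.mem_range] at hx ⊢
      simp at hx ⊢
      rcases hg with rfl | rfl | rfl | rfl <;>
        rcases hx with rfl | rfl | rfl | rfl | rfl | rfl | rfl <;> grind
    rcases key with h | ⟨i, h⟩
    · rw [h]; exact zero_mem _
    · rw [h]; exact hmem i

lemma map_mul_mem_of_adjoin {A Q : Type*} [CommRing A] [Algebra K A] [CommRing Q] [Algebra K Q]
    {s : Set A} {R : Subalgebra K A} (hR : R = Algebra.adjoin K s) (π : R →ₐ[K] Q)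
    (N : Submodule K Q) (h : ∀ x : R, (x : A) ∈ s → ∀ n ∈ N, π x * n ∈ N) (x : R) :
    ∀ n ∈ N, π x * n ∈ N := by
  subst hR
  have hx : x ∈ Algebra.adjoin K ((↑) ⁻¹' s : Set (Algebra.adjoin K s)) := by
    rw [Algebra.adjoin_adjoin_coe_preimage]; trivial
  induction hx using Algebra.adjoin_induction with
  | mem x hx => exact h x hx
  | algebraMap k =>
    intro n hn
    rw [AlgHom.commutes, ← Algebra.smul_def]
    exact N.smul_mem k hn
  | add x y _ _ ihx ihy =>
    intro n hn
    rw [map_add, add_mul]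
    exact add_mem (ihx n hn) (ihy n hn)
  | mul x y _ _ ihx ihy =>
    intro n hn
    rw [map_mul, mul_assoc]
    exact ihx _ (ihy n hn)

lemma linearIndependent_comp_of_ker_le {ι M Q : Type*} [Fintype ι] [DecidableEq ι]
    [AddCommGroup M] [Module K M] [AddCommGroup Q] [Module K Q] (π : M →ₗ[K] Q)
    (Φ : M →ₗ[K] (ι → K)) (h : LinearMap.ker π ≤ LinearMap.ker Φ) {v : ι → M}
    (hv : ∀ i, Φ (v i) = Pi.single i 1) : LinearIndependent K fun i => π (v i) := by
  rw [Fintype.linearIndependent_iff]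
  intro g hg i
  have h0 : Φ (∑ i, g i • v i) = 0 := h (by simpa using hg)
  simpa [hv, Pi.single_apply] using congrFun h0 i

lemma coords_basisMonomials (i : Fin 7) :
    coords K (basisMonomials (mono K 2 1 1) (mono K 1 2 1) (mono K 1 1 2) i) =
      Pi.single i 1 := by
  have h1 : (1 : MvPolynomial (Fin 3) K) = mono K 0 0 0 := by
    have h : (0 : Fin 3 →₀ ℕ) = expo 0 0 0 := by ext t; fin_cases t <;> simp [expo]
    rw [mono, ← h, monomial_zero', map_one]
  fin_cases i <;> ext t <;> fin_cases t <;>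
    simp only [basisMonomials, coords, LinearMap.pi_apply] <;>
    simp [-lcoeff_apply, lcoeff_mono, mono_mul, h1]

lemma finrank_eq_seven
    (F G : MvPolynomial (Fin 3) K)
    (hF : F = X 0 * X 1 * X 2)
    (hG : G = X 0 ^ 3 + X 1 ^ 3 + X 2 ^ 3)
    (R : Subalgebra K (MvPolynomial (Fin 3) K))
    (hR : R = Algebra.adjoin K
      {X 0 * F, X 1 * F, X 2 * F, X 0 * G, X 1 * G, X 2 * G})
    (a b c : R)
    (ha : (a : MvPolynomial (Fin 3) K) = X 0 * G)
    (hb : (b : MvPolynomial (Fin 3) K) = X 1 * G - X 0 * F)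
    (hc : (c : MvPolynomial (Fin 3) K) = X 2 * G - X 1 * F)
    {Q : Type*} [CommRing Q] [Algebra K Q] (π : R →ₐ[K] Q) (hπsurj : Function.Surjective π)
    (hπker : RingHom.ker π = Ideal.span {a, b, c}) : Module.finrank K Q = 7 := by
  have hx (p : MvPolynomial (Fin 3) K) (hp : p ∈ ({X 0 * F, X 1 * F, X 2 * F, X 0 * G, X 1 * G,
      X 2 * G} : Set (MvPolynomial (Fin 3) K))) : p ∈ R := hR ▸ Algebra.subset_adjoin hp
  obtain ⟨y₁, hy₁⟩ : ∃ y : R, (y : MvPolynomial (Fin 3) K) = X 0 * F := ⟨⟨_, hx _ (by simp)⟩, rfl⟩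
  obtain ⟨y₂, hy₂⟩ : ∃ y : R, (y : MvPolynomial (Fin 3) K) = X 1 * F := ⟨⟨_, hx _ (by simp)⟩, rfl⟩
  obtain ⟨y₃, hy₃⟩ : ∃ y : R, (y : MvPolynomial (Fin 3) K) = X 2 * F := ⟨⟨_, hx _ (by simp)⟩, rfl⟩
  have hF' : F = mono K 1 1 1 := by
    simp [hF, X_zero_eq, X_one_eq, X_two_eq, mono_mul]
  have hG' : G = mono K 3 0 0 + mono K 0 3 0 + mono K 0 0 3 := by
    simp [hG, X_zero_eq, X_one_eq, X_two_eq, mono_mul, pow_succ]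
  have hgens : ({X 0 * F, X 1 * F, X 2 * F, X 0 * G, X 1 * G, X 2 * G} :
      Set (MvPolynomial (Fin 3) K)) = gens K := by
    simp [hF', hG', X_zero_eq, X_one_eq, X_two_eq, mono_mul, mul_add, gens]
  have hRg : R = Algebra.adjoin K (gens K) := by rw [hR, hgens]
  have hpar : ∀ p ∈ ({a, b, c} : Set R), (p : MvPolynomial (Fin 3) K) ∈ params K := by
    simp [ha, hb, hc, hF', hG', X_zero_eq, X_one_eq, X_two_eq, mono_mul, mul_add, params]
  let Φ : R →ₗ[K] (Fin 7 → K) := coords K ∘ₗ R.val.toLinearMap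
  have hker : LinearMap.ker π.toLinearMap ≤ LinearMap.ker Φ := by
    intro x hx
    replace hx : x ∈ Ideal.span {a, b, c} := hπker ▸ hx
    induction hx using Submodule.closure_induction with
    | zero => exact zero_mem _
    | add x y _ _ hx hy => exact add_mem hx hy
    | smul_mem r x hx => exact coords_mul_params (hpar x hx) (hRg ▸ r.2)
  have hπ {x : R} (hx : x ∈ ({a, b, c} : Set R)) : π x = 0 :=
    RingHom.mem_ker.1 (hπker.symm ▸ Ideal.subset_span hx)
  have hπa : π a = 0 := hπ (by simp)
  have hπb : π b = 0 := hπ (by simp)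
  have hπc : π c = 0 := hπ (by simp)
  have e₁ : y₁ * (b + y₁) = y₂ * a := by
    ext1; push_cast; rw [ha, hb, hy₁, hy₂]; ring
  have e₂ : y₁ * (c + y₂) = y₃ * a := by
    ext1; push_cast; rw [ha, hc, hy₁, hy₂, hy₃]; ring
  have e₃ : y₂ * (c + y₂) = y₃ * (b + y₁) := by
    ext1; push_cast; rw [hb, hc, hy₁, hy₂, hy₃]; ring
  have e₄ : y₁ ^ 3 + y₂ ^ 3 + y₃ ^ 3 = y₁ * y₂ * (c + y₂) := by
    ext1; push_cast; rw [hc, hy₁, hy₂, hy₃, hF, hG]; ring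
  have e₅ : y₁ ^ 2 * a + y₂ ^ 2 * (b + y₁) + y₃ ^ 2 * (c + y₂) = y₁ * (b + y₁) * (c + y₂) := by
    ext1; push_cast; rw [ha, hb, hc, hy₁, hy₂, hy₃, hF, hG]; ring
  have e₆ : y₁ * a ^ 2 + y₂ * (b + y₁) ^ 2 + y₃ * (c + y₂) ^ 2 = a * (b + y₁) * (c + y₂) := by
    ext1; push_cast; rw [ha, hb, hc, hy₁, hy₂, hy₃, hF, hG]; ring
  apply_fun π at e₁ e₂ e₃ e₄ e₅ e₆
  simp only [map_add, map_mul, map_pow, hπa, hπb, hπc, zero_add, mul_zero, zero_mul,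
    ne_eq, OfNat.ofNat_ne_zero, not_false_eq_true, zero_pow]
    at e₁ e₂ e₃ e₄ e₅ e₆
  let N := Submodule.span K (Set.range (basisMonomials (π y₁) (π y₂) (π y₃)))
  have hmul {g : Q} (hg : g = 0 ∨ g = π y₁ ∨ g = π y₂ ∨ g = π y₃) {n : Q} (hn : n ∈ N) :
      g * n ∈ N :=
    span_basisMonomials_mul_mem e₁ e₂ e₃ e₄ e₅ e₆ hg hn
  have hclosed : ∀ x : R, ∀ n ∈ N, π x * n ∈ N := by
    refine map_mul_mem_of_adjoin hR π N fun x h n hn => hmul ?_ hn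
    simp only [Set.mem_insert_iff, Set.mem_singleton_iff] at h
    rcases h with h | h | h | h | h | h
    · exact .inr (.inl (congrArg π (Subtype.ext (h.trans hy₁.symm))))
    · exact .inr (.inr (.inl (congrArg π (Subtype.ext (h.trans hy₂.symm)))))
    · exact .inr (.inr (.inr (congrArg π (Subtype.ext (h.trans hy₃.symm)))))
    · exact .inl ((congrArg π (Subtype.ext (h.trans ha.symm))).trans hπa)
    · have hx : x = b + y₁ := by ext1; push_cast; rw [h, hb, hy₁]; ring
      exact .inr (.inl (by rw [hx, map_add, hπb, zero_add]))
    · have hx : x = c + y₂ := by ext1; push_cast; rw [h, hc, hy₂]; ring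
      exact .inr (.inr (.inl (by rw [hx, map_add, hπc, zero_add])))
  have hspan : ⊤ ≤ N := by
    rintro q -
    obtain ⟨x, rfl⟩ := hπsurj q
    have h1 : (1 : Q) ∈ N := Submodule.subset_span ⟨0, rfl⟩
    simpa only [mul_one] using hclosed x 1 h1
  have hΦb (i : Fin 7) : Φ (basisMonomials y₁ y₂ y₃ i) = Pi.single i 1 := by
    rw [← coords_basisMonomials i]
    have h₁ : mono K 2 1 1 = y₁ := by rw [hy₁, hF', X_zero_eq, mono_mul]
    have h₂ : mono K 1 2 1 = y₂ := by rw [hy₂, hF', X_one_eq, mono_mul]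
    have h₃ : mono K 1 1 2 = y₃ := by rw [hy₃, hF', X_two_eq, mono_mul]
    rw [h₁, h₂, h₃]
    exact congrArg (coords K) (map_basisMonomials R.val.toRingHom y₁ y₂ y₃ i)
  have hind : LinearIndependent K (basisMonomials (π y₁) (π y₂) (π y₃)) := by
    have hi : basisMonomials (π y₁) (π y₂) (π y₃) =
        fun i => π.toLinearMap (basisMonomials y₁ y₂ y₃ i) :=
      funext fun i => (map_basisMonomials π.toRingHom y₁ y₂ y₃ i).symm
    rw [hi]
    exact linearIndependent_comp_of_ker_le π.toLinearMap Φ hker hΦb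
  rw [Module.finrank_eq_card_basis (Module.Basis.mk hind hspan), Fintype.card_fin]

lemma finrank_quotient_eq {A : Type*} [CommRing A] [Algebra K A] (I : Ideal A) {n : ℕ}
    (h : ∀ π : A →ₐ[K] A ⧸ I, Function.Surjective π → RingHom.ker π = I →
      Module.finrank K (A ⧸ I) = n) : Module.finrank K (A ⧸ I) = n :=
  h _ (Ideal.Quotient.mkₐ_surjective K I) (Ideal.Quotient.mkₐ_ker K I)

end TernaryCubics

open TernaryCubics in
/-- Let `K` be a field of characteristic zero, `F = X₁X₂X₃`,
`G = X₁³ + X₂³ + X₃³`, and `R` the `K`-subalgebra of `K[X₁,X₂,X₃]` generated by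
`X₁F, X₂F, X₃F, X₁G, X₂G, X₃G`.  With `a = X₁G`, `b = X₂G − X₁F`,
`c = X₃G − X₂F` in `R`, the quotient `R/(a,b,c)` is a `K`-vector space of
dimension exactly 7. -/
theorem stmt_12 (K : Type*) [Field K] [CharZero K]
    (F G : MvPolynomial (Fin 3) K)
    (hF : F = X 0 * X 1 * X 2)
    (hG : G = X 0 ^ 3 + X 1 ^ 3 + X 2 ^ 3)
    (R : Subalgebra K (MvPolynomial (Fin 3) K))
    (hR : R = Algebra.adjoin K
      {X 0 * F, X 1 * F, X 2 * F, X 0 * G, X 1 * G, X 2 * G})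
    (a b c : R)
    (ha : (a : MvPolynomial (Fin 3) K) = X 0 * G)
    (hb : (b : MvPolynomial (Fin 3) K) = X 1 * G - X 0 * F)
    (hc : (c : MvPolynomial (Fin 3) K) = X 2 * G - X 1 * F) :
    Module.finrank K (↥R ⧸ Ideal.span ({a, b, c} : Set ↥R)) = 7 := by
  have key := fun π hs hk => finrank_eq_seven (Q := R ⧸ Ideal.span {a, b, c})
    F G hF hG R hR a b c ha hb hc π hs hk
  have hdim := finrank_quotient_eq (K := K) (Ideal.span {a, b, c}) key
  exact hdim
end

section
/- Let K be a field of characteristic zero, let F = X₁X₂X₃ and G = X₁³ + X₂³ + X₃³ in K[X₁, X₂, X₃], and let R be the K-subalgebra of K[X₁, X₂, X₃] generated by X₁F, X₂F, X₃F, X₁G, X₂G, X₃G. Then the elements X₁G, X₂G − X₁F, X₃G − X₂F of R form a regular sequence on R: X₁G is a nonzerodivisor on R, X₂G − X₁F is a nonzerodivisor on R/(X₁G), X₃G − X₂F is a nonzerodivisor on R/(X₁G, X₂G − X₁F), and the ideal (X₁G, X₂G − X₁F, X₃G − X₂F) is proper in R. -/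
open MvPolynomial

set_option synthInstance.maxHeartbeats 800000

section ScaledVariables

variable {σ K : Type*} [Field K]

theorem MvPolynomial.aeval_X_mul_of_isHomogeneous {n : ℕ} {f : MvPolynomial σ K}
    (hf : f.IsHomogeneous n) (g : MvPolynomial σ K) :
    aeval (fun i => X i * g) f = g ^ n * f := by
  conv_rhs => rw [f.as_sum]
  rw [aeval_def, eval₂_eq, Finset.mul_sum]
  refine Finset.sum_congr rfl fun d hd => ?_
  have hdeg : ∑ i ∈ d.support, d i = n := by
    rw [← hf.degree_eq_sum_deg_support hd]
  rw [monomial_eq, ← hdeg, Finsupp.prod, ← Finset.prod_pow_eq_pow_sum]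
  simp only [mul_pow, Finset.prod_mul_distrib, algebraMap_eq]
  ring

/-- Multiplying all variables by a nonzero form gives an injective substitution. -/
theorem MvPolynomial.aeval_X_mul_injective {k : ℕ} {g : MvPolynomial σ K}
    (hg : g.IsHomogeneous k) (hg0 : g ≠ 0) :
    Function.Injective (aeval (R := K) fun i : σ => X i * g) := by
  rw [injective_iff_map_eq_zero]
  intro f hf
  rw [← sum_homogeneousComponent f] at hf ⊢
  refine Finset.sum_eq_zero fun n hn => ?_
  have hhom : ∀ m, (g ^ m * homogeneousComponent m f).IsHomogeneous ((k + 1) * m) := by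
    intro m
    have := (hg.pow m).mul (homogeneousComponent_isHomogeneous m f)
    convert this using 1
    ring
  rw [map_sum] at hf
  have h := congrArg (homogeneousComponent ((k + 1) * n)) hf
  rw [map_sum, map_zero, Finset.sum_eq_single n] at h
  · rw [aeval_X_mul_of_isHomogeneous (homogeneousComponent_isHomogeneous n f),
      homogeneousComponent_eq_self (hhom n)] at h
    exact (mul_eq_zero.mp h).resolve_left (pow_ne_zero _ hg0)
  · intro m _ hmn
    rw [aeval_X_mul_of_isHomogeneous (homogeneousComponent_isHomogeneous m f),
      homogeneousComponent_of_mem (hhom m), if_neg]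
    intro h
    exact hmn (Nat.eq_of_mul_eq_mul_left k.succ_pos h).symm
  · exact fun h => absurd hn h

theorem MvPolynomial.mem_span_X_of_X_mul_mem {s : Set σ} {j : σ} (hj : j ∉ s)
    {f : MvPolynomial σ K} (h : X j * f ∈ Ideal.span (X '' s : Set (MvPolynomial σ K))) :
    f ∈ Ideal.span (X '' s : Set (MvPolynomial σ K)) := by
  rw [mem_ideal_span_X_image] at h ⊢
  intro m hm
  obtain ⟨i, his, hi⟩ := h (Finsupp.single j 1 + m) (by
    rw [mem_support_iff, coeff_X_mul]
    exact mem_support_iff.mp hm)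
  refine ⟨i, his, ?_⟩
  have hji : j ≠ i := fun h => hj (h ▸ his)
  simpa [Finsupp.single_apply, hji] using hi

end ScaledVariables

section FreeExpansion

variable {P B ι : Type*} [CommRing P] [CommRing B] [Fintype ι]

/-- If every element of `B` has a unique expansion in the family `E` with coefficients in `P`,
then an element of `P` that is a nonzerodivisor modulo `I` is one modulo the extension of `I`. -/
theorem Ideal.mem_map_of_mul_mem_of_expansion (ψ : P →+* B) (E : ι → B)
    (hspan : ∀ y, ∃ f : ι → P, ∑ i, ψ (f i) * E i = y)
    (hinj : ∀ f : ι → P, ∑ i, ψ (f i) * E i = 0 → f = 0)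
    {I : Ideal P} {x : P} (hx : ∀ y, x * y ∈ I → y ∈ I) {y : B}
    (hy : ψ x * y ∈ I.map ψ) : y ∈ I.map ψ := by
  have hmem : ∀ z ∈ I.map ψ, ∃ g : ι → P, (∀ i, g i ∈ I) ∧ ∑ i, ψ (g i) * E i = z := by
    intro z hz
    induction hz using Submodule.span_induction with
    | mem z hz =>
      obtain ⟨r, hr, rfl⟩ := hz
      obtain ⟨f, hf⟩ := hspan 1
      refine ⟨fun i => r * f i, fun i => I.mul_mem_right _ hr, ?_⟩
      simp only [map_mul, mul_assoc, ← Finset.mul_sum, hf, mul_one]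
    | zero => exact ⟨0, fun _ => I.zero_mem, by simp⟩
    | add z w _ _ hz hw =>
      obtain ⟨g, hg, rfl⟩ := hz
      obtain ⟨h, hh, rfl⟩ := hw
      exact ⟨g + h, fun i => I.add_mem (hg i) (hh i), by
        simp [add_mul, Finset.sum_add_distrib]⟩
    | smul r z _ hz =>
      obtain ⟨g, hg, rfl⟩ := hz
      choose f hf using fun i => hspan (r * E i)
      refine ⟨fun j => ∑ i, g i * f i j,
        fun j => I.sum_mem fun i _ => I.mul_mem_right _ (hg i), ?_⟩
      simp only [map_sum, map_mul, Finset.sum_mul, smul_eq_mul, Finset.mul_sum]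
      rw [Finset.sum_comm]
      refine Finset.sum_congr rfl fun i _ => ?_
      simp only [mul_assoc, ← Finset.mul_sum, hf]
      ring
  obtain ⟨f, rfl⟩ := hspan y
  obtain ⟨g, hg, hgy⟩ := hmem _ hy
  have hzero := hinj (fun i => g i - x * f i) (by
    simp only [map_sub, map_mul, sub_mul, Finset.sum_sub_distrib, hgy, Finset.mul_sum, mul_assoc]
    simp)
  refine Ideal.sum_mem _ fun i _ => Ideal.mul_mem_right _ _ (Ideal.mem_map_of_mem ψ (hx _ ?_))
  rw [← sub_eq_zero.mp (congrFun hzero i)]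
  exact hg i

theorem Ideal.Quotient.mk_mem_nonZeroDivisors {I : Ideal B} {x : B}
    (h : ∀ y, x * y ∈ I → y ∈ I) : Ideal.Quotient.mk I x ∈ nonZeroDivisors (B ⧸ I) := by
  rw [mem_nonZeroDivisors_iff_right]
  intro z hz
  obtain ⟨y, rfl⟩ := Ideal.Quotient.mk_surjective z
  rw [← map_mul, Ideal.Quotient.eq_zero_iff_mem, mul_comm] at hz
  exact Ideal.Quotient.eq_zero_iff_mem.mpr (h y hz)

end FreeExpansion

namespace CubicDiagonal

variable (K : Type*) [Field K]

/-- The cubic form `X₁X₂X₃`. -/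
noncomputable abbrev prodForm : MvPolynomial (Fin 3) K := X 0 * X 1 * X 2

/-- The Fermat cubic form `X₁³ + X₂³ + X₃³`. -/
noncomputable abbrev fermatForm : MvPolynomial (Fin 3) K := X 0 ^ 3 + X 1 ^ 3 + X 2 ^ 3

/-- The three parameters. -/
noncomputable abbrev param : Fin 3 → MvPolynomial (Fin 3) K :=
  ![X 0 * fermatForm K, X 1 * fermatForm K - X 0 * prodForm K,
    X 2 * fermatForm K - X 1 * prodForm K]

/-- A basis of the diagonal subalgebra over the polynomial ring in the parameters. -/
noncomputable abbrev basisElem : Fin 7 → MvPolynomial (Fin 3) K :=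
  ![1, X 0 * prodForm K, X 1 * prodForm K, X 2 * prodForm K,
    (X 0 * prodForm K) * (X 2 * prodForm K), (X 1 * prodForm K) * (X 2 * prodForm K),
    (X 2 * prodForm K) * (X 2 * prodForm K)]

/-- The diagonal subalgebra. -/
noncomputable abbrev diag : Subalgebra K (MvPolynomial (Fin 3) K) :=
  Algebra.adjoin K
    {X 0 * prodForm K, X 1 * prodForm K, X 2 * prodForm K,
      X 0 * fermatForm K, X 1 * fermatForm K, X 2 * fermatForm K}

section Spanning

/-- The relations express the quadratic and cubic monomials outside `p * d`, `q * d`, `d * d`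
through the seven given elements of `N`. -/
theorem mem_of_relations {S M : Type*} [CommRing S] [CommRing M] [Algebra S M] (N : Submodule S M)
    {a b c : S} {p q d : M}
    (hpp : p * p = a • q - b • p) (hpq : p * q = a • d - c • p)
    (hqq : q * q = b • d + p * d - c • q)
    (hT : a • a • p + (algebraMap S M b + p) ^ 2 * q + (algebraMap S M c + q) ^ 2 * d
      - a • ((algebraMap S M b + p) * (algebraMap S M c + q)) = 0)
    (hST : a • (p * p) + (algebraMap S M b + p) * q ^ 2 + (algebraMap S M c + q) * d ^ 2
      - a • ((algebraMap S M b + p) * d) = 0)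
    (hS : p ^ 3 + q ^ 3 + d ^ 3 - p * q * (algebraMap S M c + q) = 0)
    (hone : 1 ∈ N) (hp : p ∈ N) (hq : q ∈ N) (hd : d ∈ N)
    (hpd : p * d ∈ N) (hqd : q * d ∈ N) (hdd : d * d ∈ N) :
    (p * (p * d) ∈ N ∧ p * (q * d) ∈ N ∧ p * (d * d) ∈ N) ∧
    (q * (q * d) ∈ N ∧ q * (d * d) ∈ N) ∧ d * (d * d) ∈ N ∧ p * p ∈ N ∧ p * q ∈ N ∧ q * q ∈ N := by
  simp only [Algebra.smul_def] at *
  have hs : ∀ (r : S) {x : M}, x ∈ N → algebraMap S M r * x ∈ N := fun r x hx => by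
    rw [← Algebra.smul_def]
    exact N.smul_mem r hx
  have hpp' : p * p ∈ N := hpp ▸ N.sub_mem (hs a hq) (hs b hp)
  have hpq' : p * q ∈ N := hpq ▸ N.sub_mem (hs a hd) (hs c hp)
  have hqq' : q * q ∈ N := hqq ▸ N.sub_mem (N.add_mem (hs b hd) hpd) (hs c hq)
  have hppd : p * (p * d) ∈ N := by
    have : p * (p * d) = algebraMap S M a * (q * d) - algebraMap S M b * (p * d) := by
      linear_combination d * hpp
    exact this ▸ N.sub_mem (hs a hqd) (hs b hpd)
  have hpqd : p * (q * d) ∈ N := by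
    have : p * (q * d) = algebraMap S M a * (d * d) - algebraMap S M c * (p * d) := by
      linear_combination d * hpq
    exact this ▸ N.sub_mem (hs a hdd) (hs c hpd)
  have hpdd : p * (d * d) ∈ N := by
    have : p * (d * d) = algebraMap S M a * (algebraMap S M b * (algebraMap S M c * 1))
        - algebraMap S M a * (algebraMap S M a * p)
        - algebraMap S M b * (algebraMap S M b * q) - algebraMap S M b * (p * q)
        - algebraMap S M a * (algebraMap S M b * d) - algebraMap S M a * (p * d)
        + algebraMap S M a * (algebraMap S M c * q) - algebraMap S M c * (algebraMap S M c * d)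
        - algebraMap S M c * (q * d) - algebraMap S M b * (d * d)
        + algebraMap S M a * (algebraMap S M b * q) + algebraMap S M a * (algebraMap S M c * p)
        + algebraMap S M a * (p * q) := by
      linear_combination hT - q * hpp - d * hqq - algebraMap S M a * hqq
    rw [this]
    apply_rules [N.add_mem, N.sub_mem, hs]
  have hqqd : q * (q * d) ∈ N := by
    have : q * (q * d) = algebraMap S M b * (d * d) + p * (d * d) - algebraMap S M c * (q * d) := by
      linear_combination d * hqq
    rw [this]
    apply_rules [N.add_mem, N.sub_mem, hs]
  have hpqq : p * (q * q) ∈ N := by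
    have : p * (q * q) = algebraMap S M a * (q * d) - algebraMap S M c * (p * q) := by
      linear_combination q * hpq
    exact this ▸ N.sub_mem (hs a hqd) (hs c hpq')
  have hqdd : q * (d * d) ∈ N := by
    have : q * (d * d) = algebraMap S M a * (algebraMap S M b * d) + algebraMap S M a * (p * d)
        - algebraMap S M a * (p * p) - algebraMap S M b * (q * q) - p * (q * q)
        - algebraMap S M c * (d * d) := by
      linear_combination hST
    rw [this]
    apply_rules [N.add_mem, N.sub_mem, hs]
  have hddd : d * (d * d) ∈ N := by
    have : d * (d * d) = algebraMap S M c * (p * q) + p * (q * q)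
        - algebraMap S M a * (p * q) + algebraMap S M b * (p * p)
        - algebraMap S M b * (q * d) - p * (q * d) + algebraMap S M c * (q * q) := by
      linear_combination hS - p * hpp - q * hqq
    rw [this]
    apply_rules [N.add_mem, N.sub_mem, hs]
  exact ⟨⟨hppd, hpqd, hpdd⟩, ⟨hqqd, hqdd⟩, hddd, hpp', hpq', hqq'⟩

theorem exists_expansion {y : MvPolynomial (Fin 3) K} (hy : y ∈ diag K) :
    ∃ f : Fin 7 → MvPolynomial (Fin 3) K, ∑ i, aeval (param K) (f i) * basisElem K i = y := by
  let S := (aeval (R := K) (param K)).range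
  let N : Submodule S (MvPolynomial (Fin 3) K) := Submodule.span S (Set.range (basisElem K))
  suffices hN : y ∈ N by
    obtain ⟨g, rfl⟩ := (Submodule.mem_span_range_iff_exists_fun S).mp hN
    choose f hf using fun i => (g i).2
    refine ⟨f, Finset.sum_congr rfl fun i _ => ?_⟩
    rw [Subalgebra.smul_def, smul_eq_mul, ← hf i]
    rfl
  have hbasis : ∀ i, basisElem K i ∈ N := fun i => Submodule.subset_span ⟨i, rfl⟩
  have hone : 1 ∈ N := hbasis 0
  have hp : X 0 * prodForm K ∈ N := hbasis 1
  have hq : X 1 * prodForm K ∈ N := hbasis 2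
  have hd : X 2 * prodForm K ∈ N := hbasis 3
  have hpd : (X 0 * prodForm K) * (X 2 * prodForm K) ∈ N := hbasis 4
  have hqd : (X 1 * prodForm K) * (X 2 * prodForm K) ∈ N := hbasis 5
  have hdd : (X 2 * prodForm K) * (X 2 * prodForm K) ∈ N := hbasis 6
  let t : Fin 3 → S := fun i => ⟨param K i, X i, by simp⟩
  have ht : ∀ i, algebraMap S (MvPolynomial (Fin 3) K) (t i) = param K i := fun _ => rfl
  obtain ⟨⟨hppd, hpqd, hpdd⟩, ⟨hqqd, hqdd⟩, hddd, hpp, hpq, hqq⟩ :=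
    mem_of_relations (a := t 0) (b := t 1) (c := t 2) N
      (by simp [Algebra.smul_def, ht]; ring) (by simp [Algebra.smul_def, ht]; ring)
      (by simp [Algebra.smul_def, ht]; ring) (by simp [Algebra.smul_def, ht]; ring)
      (by simp [Algebra.smul_def, ht]; ring) (by simp [ht]; ring)
      hone hp hq hd hpd hqd hdd
  have hmul : ∀ g : MvPolynomial (Fin 3) K, (∀ i, g * basisElem K i ∈ N) → ∀ x ∈ N, g * x ∈ N := by
    intro g hg x hx
    induction hx using Submodule.span_induction with
    | mem x hx =>
      obtain ⟨i, rfl⟩ := hx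
      exact hg i
    | zero => simp
    | add x y _ _ hx hy =>
      rw [mul_add]
      exact N.add_mem hx hy
    | smul r x _ hx =>
      rw [mul_smul_comm]
      exact N.smul_mem r hx
  have hscalar : ∀ i, ∀ x ∈ N, param K i * x ∈ N := fun i x hx => N.smul_mem (t i) hx
  have hpN : ∀ x ∈ N, X 0 * prodForm K * x ∈ N := by
    refine hmul _ fun i => ?_
    fin_cases i
    exacts [by simpa using hp, hpp, hpq, hpd, hppd, hpqd, hpdd]
  have hqN : ∀ x ∈ N, X 1 * prodForm K * x ∈ N := by
    refine hmul _ fun i => ?_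
    fin_cases i
    exacts [by simpa using hq, mul_comm (X 0 * prodForm K) _ ▸ hpq, hqq, hqd,
      mul_left_comm (X 0 * prodForm K) _ _ ▸ hpqd, hqqd, hqdd]
  have hdN : ∀ x ∈ N, X 2 * prodForm K * x ∈ N := by
    refine hmul _ fun i => ?_
    fin_cases i
    exacts [by simpa using hd, mul_comm (X 0 * prodForm K) _ ▸ hpd,
      mul_comm (X 1 * prodForm K) _ ▸ hqd, hdd,
      mul_left_comm (X 0 * prodForm K) _ _ ▸ hpdd,
      mul_left_comm (X 1 * prodForm K) _ _ ▸ hqdd, hddd]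
  suffices hyN : ∀ x ∈ N, y * x ∈ N by simpa using hyN 1 hone
  induction hy using Algebra.adjoin_induction with
  | mem g hg =>
    simp only [Set.mem_insert_iff, Set.mem_singleton_iff] at hg
    rcases hg with rfl | rfl | rfl | rfl | rfl | rfl
    · exact hpN
    · exact hqN
    · exact hdN
    · exact hscalar 0
    · intro x hx
      have h := N.add_mem (hscalar 1 x hx) (hpN x hx)
      simpa [← add_mul] using h
    · intro x hx
      have h := N.add_mem (hscalar 2 x hx) (hqN x hx)
      simpa [← add_mul] using h
  | algebraMap r =>
    intro x hx
    exact N.smul_mem (algebraMap K S r) hx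
  | add u v _ _ hu hv =>
    intro x hx
    rw [add_mul]
    exact N.add_mem (hu x hx) (hv x hx)
  | mul u v _ _ hu hv =>
    intro x hx
    rw [mul_assoc]
    exact hu _ (hv x hx)

end Spanning

section Independence

theorem _root_.Polynomial.C_mul_X_sub_C_dvd_of_aeval_div_eq_zero {A L : Type*} [CommRing A]
    [IsDomain A] [IsGCDMonoid A] [Field L] [Algebra A L] [IsFractionRing A L] {f g : A}
    (hg : g ≠ 0) (hfg : IsRelPrime g f) {V : Polynomial A}
    (hV : Polynomial.aeval (algebraMap A L f / algebraMap A L g) V = 0) :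
    Polynomial.C g * Polynomial.X - Polynomial.C f ∣ V := by
  have hirr : Irreducible (Polynomial.C g * Polynomial.X + Polynomial.C (-f)) :=
    Polynomial.irreducible_C_mul_X_add_C hg hfg.neg_right
  have hgL : algebraMap A L g ≠ 0 := by simpa using hg
  have hdeg : (Polynomial.C g * Polynomial.X + Polynomial.C (-f)).natDegree ≠ 0 := by
    rw [Polynomial.natDegree_linear hg]
    exact one_ne_zero
  rw [sub_eq_add_neg, ← Polynomial.C_neg,
    (hirr.isPrimitive hdeg).dvd_iff_fraction_map_dvd_fraction_map L]
  have hroot : Polynomial.X - Polynomial.C (algebraMap A L f / algebraMap A L g) ∣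
      V.map (algebraMap A L) := by
    rw [Polynomial.dvd_iff_isRoot, Polynomial.IsRoot, Polynomial.eval_map_algebraMap, hV]
  refine Dvd.dvd.trans ⟨Polynomial.C (algebraMap A L g)⁻¹, ?_⟩ hroot
  have hinv : Polynomial.C (algebraMap A L g) * Polynomial.C (algebraMap A L g)⁻¹ = 1 := by
    rw [← Polynomial.C_mul, mul_inv_cancel₀ hgL, Polynomial.C_1]
  simp only [Polynomial.map_add, Polynomial.map_mul, Polynomial.map_C, Polynomial.map_X,
    Polynomial.C_neg,
    Polynomial.C_mul, Polynomial.map_neg,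
    div_eq_mul_inv]
  linear_combination -Polynomial.X * hinv

theorem fermatForm_isHomogeneous : (fermatForm K).IsHomogeneous 3 :=
  ((isHomogeneous_X_pow _ _).add (isHomogeneous_X_pow _ _)).add (isHomogeneous_X_pow _ _)

theorem fermatForm_ne_zero : fermatForm K ≠ 0 := by
  intro h
  simpa using congrArg (MvPolynomial.eval (![1, 0, 0] : Fin 3 → K)) h

theorem isRelPrime_fermatForm_prodForm : IsRelPrime (fermatForm K) (prodForm K) := by
  have hX : ∀ (i : Fin 3) (v : Fin 3 → K), v i = 0 → MvPolynomial.eval v (fermatForm K) ≠ 0 →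
      IsRelPrime (fermatForm K) (X i) := by
    intro i v hv hG
    refine IsRelPrime.symm ((X_prime (i := i)).irreducible.isRelPrime_iff_not_dvd.mpr ?_)
    rintro ⟨w, hw⟩
    exact hG (by rw [hw]; simp [hv])
  exact ((hX 0 ![0, 1, 0] (by simp) (by simp)).mul_right
    (hX 1 ![1, 0, 0] (by simp) (by simp))).mul_right (hX 2 ![1, 0, 0] (by simp) (by simp))

local notation "𝓟" => MvPolynomial (Fin 3) K

/-- The substitution `X₁ ↦ X₁, X₂ ↦ X₂ - sX₁, X₃ ↦ X₃ - sX₂`, over the line with coordinate `s`. -/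
noncomputable abbrev shear : Polynomial 𝓟 →+* Polynomial 𝓟 :=
  Polynomial.eval₂RingHom (eval₂Hom (Polynomial.C.comp C)
    ![Polynomial.C (X 0), Polynomial.C (X 1) - Polynomial.X * Polynomial.C (X 0),
      Polynomial.C (X 2) - Polynomial.X * Polynomial.C (X 1)]) Polynomial.X

/-- The inverse substitution of `shear`. -/
noncomputable abbrev unshear : Polynomial 𝓟 →+* Polynomial 𝓟 :=
  Polynomial.eval₂RingHom (eval₂Hom (Polynomial.C.comp C)
    ![Polynomial.C (X 0), Polynomial.C (X 1) + Polynomial.X * Polynomial.C (X 0),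
      Polynomial.C (X 2) + Polynomial.X * Polynomial.C (X 1)
        + Polynomial.X ^ 2 * Polynomial.C (X 0)]) Polynomial.X

theorem unshear_shear (W : Polynomial 𝓟) : unshear K (shear K W) = W := by
  suffices h : (unshear K).comp (shear K) = RingHom.id _ from congrArg (fun f => f W) h
  refine Polynomial.ringHom_ext' (MvPolynomial.ringHom_ext (fun r => ?_) fun i => ?_) ?_
  · simp
  · fin_cases i
    · simp
    · simp
    · simp
      ring
  · simp

/-- Evaluation at the parameters and at `s = X₁X₂X₃ / (X₁³ + X₂³ + X₃³)`. -/
noncomputable abbrev evalParam : Polynomial 𝓟 →+* FractionRing 𝓟 :=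
  Polynomial.eval₂RingHom ((algebraMap 𝓟 (FractionRing 𝓟)).comp (aeval (param K)).toRingHom)
    (algebraMap 𝓟 (FractionRing 𝓟) (prodForm K) / algebraMap 𝓟 (FractionRing 𝓟) (fermatForm K))

theorem coeff_unshear_ne_zero : (unshear K (Polynomial.C (fermatForm K) * Polynomial.X
    - Polynomial.C (prodForm K))).coeff 7 ≠ 0 := by
  have hX : ∀ i, unshear K (Polynomial.C (X i)) = ![Polynomial.C (X 0),
      Polynomial.C (X 1) + Polynomial.X * Polynomial.C (X 0),
      Polynomial.C (X 2) + Polynomial.X * Polynomial.C (X 1)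
        + Polynomial.X ^ 2 * Polynomial.C (X 0)] i := fun i => by
    rw [Polynomial.coe_eval₂RingHom, Polynomial.eval₂_C, eval₂Hom_X']
  have hs : unshear K Polynomial.X = Polynomial.X := Polynomial.eval₂_X _ _
  have h : (unshear K (Polynomial.C (fermatForm K) * Polynomial.X
      - Polynomial.C (prodForm K))).coeff 7 = X 0 ^ 3 := by
    simp only [map_sub, map_mul, map_add, map_pow, hX, hs, Matrix.cons_val_zero,
      Matrix.cons_val_one, Matrix.cons_val]
    compute_degree!
  rw [h]
  exact pow_ne_zero 3 (X_ne_zero 0)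

theorem map_param {L : Type*} [CommRing L] (φ : 𝓟 →+* L) {s : L}
    (hs : s * φ (fermatForm K) = φ (prodForm K)) (i : Fin 3) :
    φ (param K i)
      = ![φ (X 0), φ (X 1) - s * φ (X 0), φ (X 2) - s * φ (X 1)] i * φ (fermatForm K) := by
  fin_cases i
  · exact φ.map_mul _ _
  · refine (φ.map_sub _ _).trans ?_
    rw [φ.map_mul, φ.map_mul _ (prodForm K), ← hs]
    simp only [Fin.mk_one, Matrix.cons_val_one, Matrix.cons_val_zero]
    ring
  · refine (φ.map_sub _ _).trans ?_
    rw [φ.map_mul, φ.map_mul _ (prodForm K), ← hs]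
    simp only [Fin.reduceFinMk, Matrix.cons_val]
    ring

theorem eq_zero_of_evalParam_eq_zero {W : Polynomial 𝓟} (hW : evalParam K W = 0)
    (hdeg : W.natDegree < 7) : W = 0 := by
  let L := FractionRing 𝓟
  have hG := fermatForm_ne_zero K
  have hGL : algebraMap 𝓟 L (fermatForm K) ≠ 0 :=
    (map_ne_zero_iff _ (IsFractionRing.injective 𝓟 L)).mpr hG
  let μ : 𝓟 →+* 𝓟 := (aeval (R := K) fun i : Fin 3 => X i * fermatForm K).toRingHom
  have hμ : Function.Injective μ := aeval_X_mul_injective (fermatForm_isHomogeneous K) hG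
  have hμC : ∀ r, μ (C r) = C r := fun r => by simp [μ]
  have hμX : ∀ i, μ (X i) = X i * fermatForm K := fun i => by simp [μ]
  let μL : L →+* L := IsFractionRing.map hμ
  have hμL : ∀ x, μL (algebraMap 𝓟 L x) = algebraMap 𝓟 L (μ x) := fun x =>
    IsLocalization.map_eq _ x
  obtain ⟨s, hsdef⟩ : ∃ s : L,
    s = algebraMap 𝓟 L (prodForm K) / algebraMap 𝓟 L (fermatForm K) := ⟨_, rfl⟩
  have hs : μL s = s := by
    have h₁ : μ (prodForm K) = fermatForm K ^ 3 * prodForm K := by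
      simp only [prodForm, map_mul, hμX]
      ring
    have h₂ : μ (fermatForm K) = fermatForm K ^ 3 * fermatForm K := by
      rw [fermatForm, map_add, map_add, map_pow, map_pow, map_pow, hμX, hμX, hμX]
      ring
    rw [hsdef, map_div₀, hμL, hμL, h₁, h₂, (algebraMap 𝓟 L).map_mul (fermatForm K ^ 3),
      (algebraMap 𝓟 L).map_mul (fermatForm K ^ 3), map_pow (algebraMap 𝓟 L) (fermatForm K)]
    exact mul_div_mul_left _ _ (pow_ne_zero 3 hGL)
  have hcomp : evalParam K
      = (μL.comp (Polynomial.aeval (R := 𝓟) s).toRingHom).comp (shear K) := by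
    have hsG : s * algebraMap 𝓟 L (fermatForm K) = algebraMap 𝓟 L (prodForm K) :=
      hsdef ▸ div_mul_cancel₀ _ hGL
    have hX : ∀ i, evalParam K (Polynomial.C (X i)) = algebraMap 𝓟 L (param K i) := fun i => by
      rw [Polynomial.coe_eval₂RingHom, Polynomial.eval₂_C]
      simp [L]
    have haC : ∀ x : 𝓟, (Polynomial.aeval s).toRingHom (Polynomial.C x) = algebraMap 𝓟 L x :=
      fun x => Polynomial.aeval_C s x
    have haX : (Polynomial.aeval (R := 𝓟) s).toRingHom Polynomial.X = s := Polynomial.aeval_X s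
    refine Polynomial.ringHom_ext' (MvPolynomial.ringHom_ext (fun r => ?_) fun i => ?_) ?_
    · simp [hμL, hμC, L]
    · rw [RingHom.comp_apply, RingHom.comp_apply, hX, RingHom.comp_apply, RingHom.comp_apply,
        Polynomial.coe_eval₂RingHom, Polynomial.eval₂_C, eval₂Hom_X']
      rw [map_param K (algebraMap 𝓟 L) hsG]
      have hμL' : ∀ i, μL (algebraMap 𝓟 L (X i))
          = algebraMap 𝓟 L (X i) * algebraMap 𝓟 L (fermatForm K) := fun i => by
        rw [hμL, hμX, (algebraMap 𝓟 L).map_mul]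
      fin_cases i
      · simp only [Fin.zero_eta, Matrix.cons_val_zero, haC, hμL']
      · simp only [Fin.mk_one, Matrix.cons_val_one, Matrix.cons_val_zero, map_sub, map_mul,
          haC, haX, hμL', hs]
        ring
      · simp only [Fin.reduceFinMk, Matrix.cons_val, map_sub, map_mul, haC, haX, hμL', hs]
        ring
    · simp only [RingHom.comp_apply, Polynomial.coe_eval₂RingHom, Polynomial.eval₂_X, haX, hs]
      exact hsdef.symm
  have hroot : Polynomial.aeval s (shear K W) = 0 := by
    apply μL.injective
    rw [map_zero, ← hW, hcomp]
    rfl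
  rw [hsdef] at hroot
  have hdvd := map_dvd (unshear K) (Polynomial.C_mul_X_sub_C_dvd_of_aeval_div_eq_zero hG
    (isRelPrime_fermatForm_prodForm K) hroot)
  rw [unshear_shear] at hdvd
  exact Polynomial.eq_zero_of_dvd_of_natDegree_lt hdvd
    (hdeg.trans_le (Polynomial.le_natDegree_of_ne_zero (coeff_unshear_ne_zero K)))

theorem expansion_unique {f : Fin 7 → 𝓟}
    (hf : ∑ i, aeval (param K) (f i) * basisElem K i = 0) : f = 0 := by
  let L := FractionRing 𝓟
  let w : Fin 7 → 𝓟 := ![f 0, f 1 * X 0 + f 2 * X 1 + f 3 * X 2,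
    f 2 * X 0 + f 3 * X 1 + f 4 * (X 0 * X 2) + f 5 * (X 1 * X 2) + f 6 * X 2 ^ 2,
    f 3 * X 0 + f 4 * (X 0 * X 1) + f 5 * (X 1 ^ 2 + X 0 * X 2) + f 6 * (2 * X 1 * X 2),
    f 4 * X 0 ^ 2 + f 5 * (2 * X 0 * X 1) + f 6 * (X 1 ^ 2 + 2 * X 0 * X 2),
    f 5 * X 0 ^ 2 + f 6 * (2 * X 0 * X 1), f 6 * X 0 ^ 2]
  let W : Polynomial 𝓟 := ∑ i, Polynomial.C (w i) * Polynomial.X ^ (i : ℕ)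
  have hdeg : W.natDegree < 7 := by
    refine Nat.lt_of_le_pred (by simp) (Polynomial.natDegree_sum_le_of_forall_le _ _ fun i _ => ?_)
    exact (Polynomial.natDegree_C_mul_X_pow_le _ _).trans (Nat.le_of_lt_succ i.2)
  have hW : evalParam K W = 0 := by
    obtain ⟨s, hsdef⟩ : ∃ s : L,
      s = algebraMap 𝓟 L (prodForm K) / algebraMap 𝓟 L (fermatForm K) := ⟨_, rfl⟩
    let ρ : 𝓟 →+* L := (algebraMap 𝓟 L).comp (aeval (param K)).toRingHom
    have hC : ∀ x : 𝓟, evalParam K (Polynomial.C x) = ρ x := fun x => Polynomial.eval₂_C _ _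
    have hX : evalParam K Polynomial.X = s := (Polynomial.eval₂_X _ _).trans hsdef.symm
    have hρ : ∀ i, ρ (X i) = algebraMap 𝓟 L (param K i) := fun i => by simp [ρ]
    have hsG : s * algebraMap 𝓟 L (fermatForm K) = algebraMap 𝓟 L (prodForm K) :=
      hsdef ▸ div_mul_cancel₀ _ ((map_ne_zero_iff _ (IsFractionRing.injective 𝓟 L)).mpr
        (fermatForm_ne_zero K))
    have hρX : ∀ i, ρ (X i) = ![algebraMap 𝓟 L (X 0),
        algebraMap 𝓟 L (X 1) - s * algebraMap 𝓟 L (X 0),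
        algebraMap 𝓟 L (X 2) - s * algebraMap 𝓟 L (X 1)] i * algebraMap 𝓟 L (fermatForm K) :=
      fun i => (hρ i).trans (map_param K _ hsG i)
    have hp : algebraMap 𝓟 L (X 0 * prodForm K) = s * ρ (X 0) := by
      rw [hρX, (algebraMap 𝓟 L).map_mul, ← hsG]
      simp only [Matrix.cons_val]
      ring
    have hq : algebraMap 𝓟 L (X 1 * prodForm K) = s * ρ (X 1) + s ^ 2 * ρ (X 0) := by
      rw [hρX, hρX, (algebraMap 𝓟 L).map_mul, ← hsG]
      simp only [Matrix.cons_val]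
      ring
    have hd : algebraMap 𝓟 L (X 2 * prodForm K)
        = s * ρ (X 2) + s ^ 2 * ρ (X 1) + s ^ 3 * ρ (X 0) := by
      rw [hρX, hρX, hρX, (algebraMap 𝓟 L).map_mul, ← hsG]
      simp only [Matrix.cons_val]
      ring
    have hsum : ∑ i, ρ (f i) * algebraMap 𝓟 L (basisElem K i) = 0 := by
      rw [← map_zero (algebraMap 𝓟 L), ← hf, map_sum]
      exact Finset.sum_congr rfl fun i _ => ((algebraMap 𝓟 L).map_mul _ _).symm
    have hE : ∀ i, algebraMap 𝓟 L (basisElem K i) = ![1, algebraMap 𝓟 L (X 0 * prodForm K),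
        algebraMap 𝓟 L (X 1 * prodForm K), algebraMap 𝓟 L (X 2 * prodForm K),
        algebraMap 𝓟 L (X 0 * prodForm K) * algebraMap 𝓟 L (X 2 * prodForm K),
        algebraMap 𝓟 L (X 1 * prodForm K) * algebraMap 𝓟 L (X 2 * prodForm K),
        algebraMap 𝓟 L (X 2 * prodForm K) * algebraMap 𝓟 L (X 2 * prodForm K)] i := by
      intro i
      fin_cases i
      exacts [map_one _, rfl, rfl, rfl, map_mul _ _ _, map_mul _ _ _, map_mul _ _ _]
    simp only [hE, hp, hq, hd] at hsum
    rw [← hsum]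
    simp only [W, w, map_mul, map_pow, map_zero, hC, hX, Fin.sum_univ_succ, map_add, map_ofNat,
      Matrix.cons_val_zero, Matrix.cons_val_succ, Fin.val_zero, Fin.val_succ,
      Finset.univ_eq_empty, Finset.sum_empty]
    simp only [Fin.succ_zero_eq_one, Fin.succ_one_eq_two, Fin.isValue, Fin.reduceSucc]
    ring
  have hw : ∀ i, w i = 0 := by
    intro i
    have h := congrArg (fun V => Polynomial.coeff V i) (eq_zero_of_evalParam_eq_zero K hW hdeg)
    simpa [W, Polynomial.finsetSum_coeff, Polynomial.coeff_C_mul, Polynomial.coeff_X_pow,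
      Fin.val_inj] using h
  have h0 : f 0 = 0 := hw 0
  have hX : (X 0 : 𝓟) ≠ 0 := X_ne_zero 0
  have h6 : f 6 = 0 := by simpa [w] using hw 6
  have h5 : f 5 = 0 := by simpa [w, h6] using hw 5
  have h4 : f 4 = 0 := by simpa [w, h5, h6] using hw 4
  have h3 : f 3 = 0 := by simpa [w, h4, h5, h6] using hw 3
  have h2 : f 2 = 0 := by simpa [w, h3, h4, h5, h6] using hw 2
  have h1 : f 1 = 0 := by simpa [w, h2, h3] using hw 1
  funext i
  fin_cases i <;> assumption

end Independence

end CubicDiagonal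

open CubicDiagonal in
/-- Let `K` be a field of characteristic zero, `F = X₁X₂X₃`,
`G = X₁³ + X₂³ + X₃³`, and `R` the `K`-subalgebra of `K[X₁,X₂,X₃]` generated by
`X₁F, X₂F, X₃F, X₁G, X₂G, X₃G`.  Then `X₁G, X₂G − X₁F, X₃G − X₂F` is a regular
sequence on `R`: `X₁G` is a nonzerodivisor on `R`, `X₂G − X₁F` is a
nonzerodivisor on `R/(X₁G)`, `X₃G − X₂F` is a nonzerodivisor on
`R/(X₁G, X₂G − X₁F)`, and the ideal `(X₁G, X₂G − X₁F, X₃G − X₂F)` is proper. -/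
theorem stmt_13 (K : Type*) [Field K] [CharZero K]
    (F G : MvPolynomial (Fin 3) K)
    (hF : F = X 0 * X 1 * X 2)
    (hG : G = X 0 ^ 3 + X 1 ^ 3 + X 2 ^ 3)
    (R : Subalgebra K (MvPolynomial (Fin 3) K))
    (hR : R = Algebra.adjoin K
      {X 0 * F, X 1 * F, X 2 * F, X 0 * G, X 1 * G, X 2 * G})
    (a b c : R)
    (ha : (a : MvPolynomial (Fin 3) K) = X 0 * G)
    (hb : (b : MvPolynomial (Fin 3) K) = X 1 * G - X 0 * F)
    (hc : (c : MvPolynomial (Fin 3) K) = X 2 * G - X 1 * F) :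
    a ∈ nonZeroDivisors R ∧
    Ideal.Quotient.mk (Ideal.span ({a} : Set R)) b ∈
      nonZeroDivisors (↥R ⧸ Ideal.span ({a} : Set ↥R)) ∧
    Ideal.Quotient.mk (Ideal.span ({a, b} : Set R)) c ∈
      nonZeroDivisors (↥R ⧸ Ideal.span ({a, b} : Set ↥R)) ∧
    Ideal.span ({a, b, c} : Set R) ≠ ⊤ := by
  subst hF hG hR
  let ψ : MvPolynomial (Fin 3) K →+* diag K := (aeval (R := K) ![a, b, c]).toRingHom
  have hval : ∀ f, (ψ f : MvPolynomial (Fin 3) K) = aeval (param K) f := by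
    intro f
    suffices h : (diag K).val.comp (aeval ![a, b, c]) = aeval (param K) from
      congrArg (fun g => g f) h
    refine MvPolynomial.algHom_ext fun i => ?_
    fin_cases i <;> simp [ha, hb, hc]
  have hψ : ψ (X 0) = a ∧ ψ (X 1) = b ∧ ψ (X 2) = c := by simp [ψ]
  obtain ⟨hψa, hψb, hψc⟩ := hψ
  have hp : X 0 * prodForm K ∈ diag K := Algebra.subset_adjoin (by simp)
  have hq : X 1 * prodForm K ∈ diag K := Algebra.subset_adjoin (by simp)
  have hd : X 2 * prodForm K ∈ diag K := Algebra.subset_adjoin (by simp)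
  have hE : ∀ i, basisElem K i ∈ diag K := by
    intro i
    fin_cases i
    exacts [one_mem _, hp, hq, hd, mul_mem hp hd, mul_mem hq hd, mul_mem hd hd]
  have hkey := fun (s : Set (Fin 3)) (j : Fin 3) (hj : j ∉ s) (y : diag K) =>
    Ideal.mem_map_of_mul_mem_of_expansion ψ (fun i => (⟨basisElem K i, hE i⟩ : diag K))
      (fun y => by
        obtain ⟨f, hf⟩ := exists_expansion K y.2
        refine ⟨f, Subtype.ext ?_⟩
        simpa [hval] using hf)
      (fun f hf => expansion_unique K (by simpa [hval] using congrArg Subtype.val hf))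
      (fun _ => mem_span_X_of_X_mul_mem hj) (y := y)
  simp only [Ideal.map_span, ← Set.image_comp] at hkey
  refine ⟨?_, Ideal.Quotient.mk_mem_nonZeroDivisors fun y hy => ?_,
    Ideal.Quotient.mk_mem_nonZeroDivisors fun y hy => ?_, ?_⟩
  · rw [mem_nonZeroDivisors_iff_right]
    intro y hy
    simpa using hkey ∅ 0 (by simp) y (by simp [hψa, mul_comm a, hy])
  · simpa [hψa, hψb] using hkey {0} 1 (by simp) y (by simpa [hψa, hψb] using hy)
  · simpa [Set.image_insert_eq, hψa, hψb, hψc] using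
      hkey {0, 1} 2 (by simp) y (by simpa [Set.image_insert_eq, hψa, hψb, hψc] using hy)
  · let ε : diag K →+* K := (constantCoeff (σ := Fin 3)).comp (diag K).val.toRingHom
    refine fun h => RingHom.ker_ne_top ε (top_le_iff.mp (h ▸ Ideal.span_le.mpr ?_))
    rintro x (rfl | rfl | rfl) <;> simp [ε, RingHom.mem_ker, ha, hb, hc]
end
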